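/- Existence and uniqueness for the ergodic state-constraint problem: assume f ∈ C(Ω̄) and m > 2. Then there exist a constant c ∈ ℝ and a function u_∞, Hölder continuous on Ω̄ with exponent (m−2)/(m−1) and locally Lipschitz in Ω, such that u_∞ is a viscosity solution of Erg(Ω,f,c). Moreover, if c̃ ∈ ℝ and ṽ is a viscosity solution of Erg(Ω,f,c̃) which is Hölder continuous on Ω̄ with exponent (m−2)/(m−1) and locally Lipschitz in Ω, then c̃ = c and ṽ = u_∞ + K on Ω̄ for some constant K ∈ ℝ. -/

import Mathlib

open Set Filter Topology Metric MeasureTheory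

noncomputable section

/-- Euclidean space `ℝ^N`. -/
abbrev Euc (N : ℕ) : Type := EuclideanSpace ℝ (Fin N)

/-- The Laplacian of `φ` at `x`, computed as the trace of the second derivative
in the standard orthonormal basis of `ℝ^N`. -/
noncomputable def lapl {N : ℕ} (φ : Euc N → ℝ) (x : Euc N) : ℝ :=
  ∑ i : Fin N,
    iteratedFDeriv ℝ 2 φ x ![EuclideanSpace.single i 1, EuclideanSpace.single i 1]

/-- `Ω` is a domain with `C²` boundary: it is the sublevel set of a `C²`
defining function whose gradient does not vanish on the boundary. -/
def HasC2Boundary {N : ℕ} (Ω : Set (Euc N)) : Prop :=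
  ∃ ρ : Euc N → ℝ, ContDiff ℝ 2 ρ ∧ Ω = {x | ρ x < 0} ∧
    frontier Ω = {x | ρ x = 0} ∧ ∀ x ∈ frontier Ω, gradient ρ x ≠ 0

/-- The stationary operator `−Δφ(x) + |Dφ(x)|^m + λ r − h(x)` evaluated with the
value `r` of the (sub/super)solution at `x`. -/
noncomputable def statOp {N : ℕ} (h : Euc N → ℝ) (lam m : ℝ)
    (φ : Euc N → ℝ) (r : ℝ) (x : Euc N) : ℝ :=
  -lapl φ x + ‖gradient φ x‖ ^ m + lam * r - h x

/-- Viscosity subsolution of the generalized Dirichlet problem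
`S(Ω,h,k,λ)`: `−Δw + |Dw|^m + λ w = h` in `Ω`, `w = k` on `∂Ω`. -/
def IsStatSub {N : ℕ} (Ω : Set (Euc N)) (h k : Euc N → ℝ) (lam m : ℝ)
    (u : Euc N → ℝ) : Prop :=
  UpperSemicontinuousOn u (closure Ω) ∧
  ∀ φ : Euc N → ℝ, ContDiff ℝ 2 φ → ∀ x₀ ∈ closure Ω,
    IsLocalMaxOn (u - φ) (closure Ω) x₀ →
      (x₀ ∈ Ω → statOp h lam m φ (u x₀) x₀ ≤ 0) ∧
      (x₀ ∈ frontier Ω → min (statOp h lam m φ (u x₀) x₀) (u x₀ - k x₀) ≤ 0)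

/-- Viscosity supersolution of the generalized Dirichlet problem `S(Ω,h,k,λ)`. -/
def IsStatSuper {N : ℕ} (Ω : Set (Euc N)) (h k : Euc N → ℝ) (lam m : ℝ)
    (v : Euc N → ℝ) : Prop :=
  LowerSemicontinuousOn v (closure Ω) ∧
  ∀ φ : Euc N → ℝ, ContDiff ℝ 2 φ → ∀ x₀ ∈ closure Ω,
    IsLocalMinOn (v - φ) (closure Ω) x₀ →
      (x₀ ∈ Ω → 0 ≤ statOp h lam m φ (v x₀) x₀) ∧
      (x₀ ∈ frontier Ω → 0 ≤ max (statOp h lam m φ (v x₀) x₀) (v x₀ - k x₀))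

/-- The parabolic operator
`φ_t(x,t) − Δφ(·,t)(x) + |Dφ(·,t)(x)|^m + λ r − f(x)`. -/
noncomputable def parOp {N : ℕ} (f : Euc N → ℝ) (lam m : ℝ)
    (φ : Euc N × ℝ → ℝ) (r : ℝ) (x : Euc N) (t : ℝ) : ℝ :=
  deriv (fun s => φ (x, s)) t - lapl (fun y => φ (y, t)) x
    + ‖gradient (fun y => φ (y, t)) x‖ ^ m + lam * r - f x

/-- Viscosity subsolution of the generalized initial-boundary value problem
`E(Ω,f,g,u₀,λ)` on the time interval `[0,T]`:
`u_t − Δu + |Du|^m + λ u = f` in `Ω × (0,T]`, `u = g` on `∂Ω × (0,T]`,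
`u(·,0) = u₀` on `closure Ω`. -/
def IsParSub {N : ℕ} (Ω : Set (Euc N)) (f g u₀ : Euc N → ℝ) (lam m T : ℝ)
    (u : Euc N → ℝ → ℝ) : Prop :=
  UpperSemicontinuousOn (fun p : Euc N × ℝ => u p.1 p.2) (closure Ω ×ˢ Ico 0 T) ∧
  (∀ x ∈ closure Ω, u x 0 ≤ u₀ x) ∧
  ∀ φ : Euc N × ℝ → ℝ, ContDiff ℝ 2 φ → ∀ x₀ : Euc N, ∀ t₀ : ℝ,
    (x₀, t₀) ∈ closure Ω ×ˢ Ioc 0 T →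
    IsLocalMaxOn (fun p : Euc N × ℝ => u p.1 p.2 - φ p) (closure Ω ×ˢ Ioc 0 T) (x₀, t₀) →
      (x₀ ∈ Ω → parOp f lam m φ (u x₀ t₀) x₀ t₀ ≤ 0) ∧
      (x₀ ∈ frontier Ω →
        min (parOp f lam m φ (u x₀ t₀) x₀ t₀) (u x₀ t₀ - g x₀) ≤ 0)

/-- Viscosity supersolution of `E(Ω,f,g,u₀,λ)` on the time interval `[0,T]`. -/
def IsParSuper {N : ℕ} (Ω : Set (Euc N)) (f g u₀ : Euc N → ℝ) (lam m T : ℝ)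
    (v : Euc N → ℝ → ℝ) : Prop :=
  LowerSemicontinuousOn (fun p : Euc N × ℝ => v p.1 p.2) (closure Ω ×ˢ Icc 0 T) ∧
  (∀ x ∈ closure Ω, u₀ x ≤ v x 0) ∧
  ∀ φ : Euc N × ℝ → ℝ, ContDiff ℝ 2 φ → ∀ x₀ : Euc N, ∀ t₀ : ℝ,
    (x₀, t₀) ∈ closure Ω ×ˢ Ioc 0 T →
    IsLocalMinOn (fun p : Euc N × ℝ => v p.1 p.2 - φ p) (closure Ω ×ˢ Ioc 0 T) (x₀, t₀) →
      (x₀ ∈ Ω → 0 ≤ parOp f lam m φ (v x₀ t₀) x₀ t₀) ∧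
      (x₀ ∈ frontier Ω →
        0 ≤ max (parOp f lam m φ (v x₀ t₀) x₀ t₀) (v x₀ t₀ - g x₀))

/-- A continuous viscosity solution, global in time, of `E(Ω,f,g,u₀,λ)`. -/
def IsGlobalParSol {N : ℕ} (Ω : Set (Euc N)) (f g u₀ : Euc N → ℝ) (lam m : ℝ)
    (u : Euc N → ℝ → ℝ) : Prop :=
  ContinuousOn (fun p : Euc N × ℝ => u p.1 p.2) (closure Ω ×ˢ Ici 0) ∧
  ∀ T > (0 : ℝ), IsParSub Ω f g u₀ lam m T u ∧ IsParSuper Ω f g u₀ lam m T u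

open scoped Classical in
/-- Redefinition of a parabolic subsolution on the lateral boundary by its
`limsup` from inside `Ω × (0,T]`. -/
noncomputable def uscExtPar {N : ℕ} (Ω : Set (Euc N)) (T : ℝ)
    (u : Euc N → ℝ → ℝ) : Euc N → ℝ → ℝ :=
  fun z t => if z ∈ Ω then u z t
    else limsup (fun p : Euc N × ℝ => u p.1 p.2) (𝓝[Ω ×ˢ Ioc 0 T] (z, t))

open scoped Classical in
/-- Redefinition of a stationary subsolution on the boundary by its `limsup`
from inside `Ω`. -/
noncomputable def uscExtStat {N : ℕ} (Ω : Set (Euc N))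
    (u : Euc N → ℝ) : Euc N → ℝ :=
  fun z => if z ∈ Ω then u z else limsup u (𝓝[Ω] z)

/-- Continuous viscosity solution of the state constraint problem
`−Δw + |Dw|^m + λ w = h` in `Ω`, `−Δw + |Dw|^m + λ w ≥ h` on `∂Ω`. -/
def IsSCSolution {N : ℕ} (Ω : Set (Euc N)) (h : Euc N → ℝ) (lam m : ℝ)
    (w : Euc N → ℝ) : Prop :=
  ContinuousOn w (closure Ω) ∧
  (∀ φ : Euc N → ℝ, ContDiff ℝ 2 φ → ∀ x₀ ∈ Ω, IsLocalMaxOn (w - φ) Ω x₀ →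
      statOp h lam m φ (w x₀) x₀ ≤ 0) ∧
  (∀ φ : Euc N → ℝ, ContDiff ℝ 2 φ → ∀ x₀ ∈ closure Ω,
      IsLocalMinOn (w - φ) (closure Ω) x₀ → 0 ≤ statOp h lam m φ (w x₀) x₀)

/-- Continuous viscosity subsolution of `−Δu + |Du|^m ≤ h` in `Ω`
(no boundary condition). -/
def IsIntSub {N : ℕ} (Ω : Set (Euc N)) (h : Euc N → ℝ) (m : ℝ)
    (u : Euc N → ℝ) : Prop :=
  ∀ φ : Euc N → ℝ, ContDiff ℝ 2 φ → ∀ x₀ ∈ Ω, IsLocalMaxOn (u - φ) Ω x₀ →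
    statOp h 0 m φ (u x₀) x₀ ≤ 0

/-- Hölder continuity with exponent `α` on a set. -/
def HolderOnCl {N : ℕ} (α : ℝ) (s : Set (Euc N)) (w : Euc N → ℝ) : Prop :=
  ∃ C > (0 : ℝ), ∀ x ∈ s, ∀ y ∈ s, |w x - w y| ≤ C * ‖x - y‖ ^ α

/-- Local Lipschitz continuity inside `Ω`. -/
def LocLipIn {N : ℕ} (Ω : Set (Euc N)) (w : Euc N → ℝ) : Prop :=
  ∀ x ∈ Ω, ∃ ε > (0 : ℝ), ∃ K : ℝ, 0 ≤ K ∧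
    ∀ y ∈ ball x ε ∩ Ω, ∀ z ∈ ball x ε ∩ Ω, |w y - w z| ≤ K * ‖y - z‖

/-- A piecewise `C¹` path parametrized on `[0,1]`. -/
def IsPWC1Path {N : ℕ} (γ : ℝ → Euc N) : Prop :=
  ContinuousOn γ (Icc 0 1) ∧
  ∃ n : ℕ, ∃ τ : Fin (n + 1) → ℝ, StrictMono τ ∧ τ 0 = 0 ∧ τ (Fin.last n) = 1 ∧
    ∀ i : Fin n, ContDiffOn ℝ 1 γ (Icc (τ i.castSucc) (τ i.succ))

/-- The length of a path on `[0,1]`. -/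
noncomputable def pathLen {N : ℕ} (γ : ℝ → Euc N) : ℝ :=
  ∫ t in (0 : ℝ)..1, ‖derivWithin γ (Icc (0 : ℝ) 1) t‖

/-- The geodesic-type distance inside `closure S` via piecewise `C¹` paths. -/
noncomputable def dTilde {N : ℕ} (S : Set (Euc N)) (x y : Euc N) : ℝ :=
  sInf {L : ℝ | ∃ γ : ℝ → Euc N, IsPWC1Path γ ∧ γ 0 = x ∧ γ 1 = y ∧
    MapsTo γ (Icc 0 1) (closure S) ∧ L = pathLen γ}

/-- The inner parallel set `Ω_δ = {x ∈ Ω : dist(x,∂Ω) > δ}`. -/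
def innerSet {N : ℕ} (Ω : Set (Euc N)) (δ : ℝ) : Set (Euc N) :=
  {x ∈ Ω | δ < infDist x (frontier Ω)}

end


open Set Filter Topology Metric MeasureTheory


/-- `φ` is `C²` near `x`, with gradient `p` and Laplacian `l` at `x`. -/
def Jet {N : ℕ} (φ : Euc N → ℝ) (x p : Euc N) (l : ℝ) : Prop :=
  ContDiffAt ℝ 2 φ x ∧ gradient φ x = p ∧ lapl φ x = l

lemma lapl_eq_fderiv {N : ℕ} (φ : Euc N → ℝ) (x : Euc N) :
    lapl φ x = ∑ i : Fin N, fderiv ℝ (fderiv ℝ φ) x (EuclideanSpace.single i 1)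
      (EuclideanSpace.single i 1) := by
  unfold lapl
  refine Finset.sum_congr rfl fun i _ => ?_
  rw [iteratedFDeriv_two_apply]
  simp

lemma lapl_eq_laplacian {N : ℕ} (φ : Euc N → ℝ) :
    lapl φ = Laplacian.laplacian φ := by
  rw [InnerProductSpace.laplacian_eq_iteratedFDeriv_orthonormalBasis φ
    (EuclideanSpace.basisFun (Fin N) ℝ)]
  funext x
  simp [lapl]

lemma grad_apply {N : ℕ} (φ : Euc N → ℝ) (x v : Euc N) :
    fderiv ℝ φ x v = inner ℝ (gradient φ x) v := by
  rw [gradient, InnerProductSpace.toDual_symm_apply]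

lemma sum_sq_coord {N : ℕ} (p : Euc N) :
    ∑ i : Fin N, inner ℝ p (EuclideanSpace.single i 1) ^ 2 = ‖p‖ ^ 2 := by
  rw [EuclideanSpace.norm_sq_eq]
  refine Finset.sum_congr rfl fun i _ => ?_
  simp [EuclideanSpace.inner_single_right]

lemma Jet.of_contDiffAt {N : ℕ} {φ : Euc N → ℝ} {x : Euc N} (h : ContDiffAt ℝ 2 φ x) :
    Jet φ x (gradient φ x) (lapl φ x) := ⟨h, rfl, rfl⟩

lemma Jet.of_contDiff {N : ℕ} {φ : Euc N → ℝ} {x : Euc N} (h : ContDiff ℝ 2 φ) :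
    Jet φ x (gradient φ x) (lapl φ x) := ⟨h.contDiffAt, rfl, rfl⟩

section
variable {N : ℕ} {φ ψ : Euc N → ℝ} {x p q : Euc N} {l k : ℝ}

lemma Jet.hasFDerivAt (h : Jet φ x p l) : HasFDerivAt φ (innerSL ℝ p) x := by
  have h1 := (h.1.differentiableAt (by norm_num)).hasFDerivAt
  refine h1.congr_fderiv (ContinuousLinearMap.ext fun v => ?_)
  rw [grad_apply, h.2.1]; rfl

lemma gradient_of_hasFDerivAt (h : HasFDerivAt φ (innerSL ℝ p) x) : gradient φ x = p := by
  have : HasGradientAt φ p x := by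
    rw [hasGradientAt_iff_hasFDerivAt]
    exact h
  exact this.gradient

lemma Jet.congr (h : Jet φ x p l) (e : ψ =ᶠ[𝓝 x] φ) : Jet ψ x p l := by
  refine ⟨h.1.congr_of_eventuallyEq e, ?_, ?_⟩
  · rw [gradient, e.fderiv_eq]; exact h.2.1
  · rw [lapl_eq_fderiv, (e.fderiv).fderiv_eq, ← lapl_eq_fderiv]; exact h.2.2

lemma Jet.add (h : Jet φ x p l) (h' : Jet ψ x q k) :
    Jet (fun y => φ y + ψ y) x (p + q) (l + k) := by
  refine ⟨h.1.add h'.1, ?_, ?_⟩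
  · apply gradient_of_hasFDerivAt
    have := h.hasFDerivAt.add h'.hasFDerivAt
    rw [map_add]; exact this
  · have := ContDiffAt.laplacian_add h.1 h'.1
    have e : (fun y => φ y + ψ y) = φ + ψ := rfl
    rw [e, lapl_eq_laplacian, this, ← lapl_eq_laplacian, ← lapl_eq_laplacian, h.2.2, h'.2.2]

lemma Jet.const_mul (h : Jet φ x p l) (c : ℝ) :
    Jet (fun y => c * φ y) x (c • p) (c * l) := by
  refine ⟨contDiffAt_const.mul h.1, ?_, ?_⟩
  · apply gradient_of_hasFDerivAt
    have := h.hasFDerivAt.const_mul c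
    rw [map_smul]; exact this
  · have := InnerProductSpace.laplacian_smul c h.1
    have e : (fun y => c * φ y) = c • φ := rfl
    rw [e, lapl_eq_laplacian, this, ← lapl_eq_laplacian, h.2.2]; rfl

lemma Jet.neg (h : Jet φ x p l) : Jet (fun y => - φ y) x (-p) (-l) := by
  have := h.const_mul (-1)
  simpa using this

lemma Jet.sub (h : Jet φ x p l) (h' : Jet ψ x q k) :
    Jet (fun y => φ y - ψ y) x (p - q) (l - k) := by
  simpa [sub_eq_add_neg] using h.add h'.neg

lemma Jet.const (c : ℝ) (x : Euc N) : Jet (fun _ => c) x 0 0 := by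
  refine ⟨contDiffAt_const, ?_, ?_⟩
  · simp [gradient]
  · rw [lapl_eq_fderiv]; simp

lemma Jet.add_const (h : Jet φ x p l) (c : ℝ) : Jet (fun y => φ y + c) x p l := by
  simpa using h.add (Jet.const c x)

lemma Jet.sub_const (h : Jet φ x p l) (c : ℝ) : Jet (fun y => φ y - c) x p l := by
  simpa using h.sub (Jet.const c x)

lemma Jet.comp (h : Jet φ x p l) {F F1 : ℝ → ℝ} {a F2 : ℝ} (ha : a = φ x)
    (hF : ContDiffAt ℝ 2 F a)
    (h1 : ∀ᶠ s in 𝓝 a, HasDerivAt F (F1 s) s) (h2 : HasDerivAt F1 F2 a) :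
    Jet (fun y => F (φ y)) x (F1 a • p) (F2 * ‖p‖ ^ 2 + F1 a * l) := by
  subst ha
  have hd : ∀ᶠ y in 𝓝 x, DifferentiableAt ℝ φ y := by
    have := h.1.eventually (by norm_num)
    exact this.mono fun y hy => hy.differentiableAt (by norm_num)
  have hc : ContinuousAt φ x := h.1.continuousAt
  have h1' : ∀ᶠ y in 𝓝 x, HasDerivAt F (F1 (φ y)) (φ y) := hc.eventually h1
  have e : fderiv ℝ (fun y => F (φ y)) =ᶠ[𝓝 x] fun y => F1 (φ y) • fderiv ℝ φ y := by
    filter_upwards [hd, h1'] with y hy1 hy2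
    exact (hy2.comp_hasFDerivAt y hy1.hasFDerivAt).fderiv
  refine ⟨ContDiffAt.comp x hF h.1, ?_, ?_⟩
  · apply gradient_of_hasFDerivAt
    rw [map_smul]
    exact h1'.self_of_nhds.comp_hasFDerivAt x h.hasFDerivAt
  · rw [lapl_eq_fderiv, e.fderiv_eq]
    have hD : HasFDerivAt (fderiv ℝ φ) (fderiv ℝ (fderiv ℝ φ) x) x := by
      apply DifferentiableAt.hasFDerivAt
      have : ContDiffAt ℝ 1 (fderiv ℝ φ) x := h.1.fderiv_right (by norm_num)
      exact this.differentiableAt (by norm_num)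
    have hS : HasFDerivAt (fun y => F1 (φ y)) (F2 • innerSL ℝ p) x :=
      h2.comp_hasFDerivAt x h.hasFDerivAt
    have hSD : HasFDerivAt (fun y => F1 (φ y) • fderiv ℝ φ y) _ x := hS.smul hD
    rw [hSD.fderiv]
    have hh : ∀ v, fderiv ℝ φ x v = inner ℝ p v := by intro v; rw [grad_apply, h.2.1]
    simp only [ContinuousLinearMap.add_apply, ContinuousLinearMap.smul_apply,
      ContinuousLinearMap.smulRight_apply, innerSL_apply_apply, smul_eq_mul, hh]
    rw [Finset.sum_add_distrib, ← Finset.mul_sum, ← lapl_eq_fderiv, h.2.2, ← sum_sq_coord,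
      Finset.mul_sum, add_comm]
    congr 1
    refine Finset.sum_congr rfl fun i _ => ?_
    ring

lemma Jet.innerL (a x : Euc N) : Jet (fun y => inner ℝ a y) x a 0 := by
  have e : (fun y : Euc N => inner ℝ a y) = innerSL ℝ a := rfl
  rw [e]
  refine ⟨(innerSL ℝ a).contDiff.contDiffAt, ?_, ?_⟩
  · exact gradient_of_hasFDerivAt (innerSL ℝ a).hasFDerivAt
  · rw [lapl_eq_fderiv]
    have : fderiv ℝ (innerSL ℝ a) = fun _ => innerSL ℝ a := by
      funext y; exact (innerSL ℝ a).fderiv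
    rw [this]; simp

lemma Jet.normSq (a x : Euc N) :
    Jet (fun y => ‖y - a‖ ^ 2) x ((2 : ℝ) • (x - a)) (2 * N) := by
  have hd : ∀ y : Euc N, HasFDerivAt (fun y => ‖y - a‖ ^ 2) (innerSL ℝ ((2 : ℝ) • (y - a))) y := by
    intro y
    have := ((hasFDerivAt_id y).sub_const a).norm_sq
    refine this.congr_fderiv (ContinuousLinearMap.ext fun v => ?_)
    simp
  refine ⟨?_, gradient_of_hasFDerivAt (hd x), ?_⟩
  · exact ((contDiff_id.sub contDiff_const).norm_sq ℝ).contDiffAt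
  · rw [lapl_eq_fderiv]
    have : fderiv ℝ (fun y => ‖y - a‖ ^ 2) = fun y => innerSL ℝ ((2 : ℝ) • (y - a)) := by
      funext y; exact (hd y).fderiv
    rw [this]
    have h2 : HasFDerivAt (fun y : Euc N => innerSL ℝ ((2 : ℝ) • (y - a)))
        ((innerSL ℝ).comp ((2 : ℝ) • ContinuousLinearMap.id ℝ (Euc N))) x := by
      apply (innerSL ℝ).hasFDerivAt.comp x
      exact ((hasFDerivAt_id x).sub_const a).const_smul (2 : ℝ)
    rw [h2.fderiv]
    have : ∀ i : Fin N, (((innerSL ℝ).comp ((2 : ℝ) • ContinuousLinearMap.id ℝ (Euc N)))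
        (EuclideanSpace.single i 1)) (EuclideanSpace.single i 1) = 2 := by
      intro i
      change (inner ℝ ((2:ℝ) • (EuclideanSpace.single i (1:ℝ) : Euc N))
        (EuclideanSpace.single i (1:ℝ)) : ℝ) = 2
      rw [real_inner_smul_left, EuclideanSpace.inner_single_left]; simp
    rw [Finset.sum_congr rfl fun i _ => this i]
    simp [mul_comm]

lemma Jet.norm (a x : Euc N) (hx : x ≠ a) :
    Jet (fun y => ‖y - a‖) x (‖x - a‖⁻¹ • (x - a)) ((N - 1) / ‖x - a‖) := by
  have h0 : 0 < ‖x - a‖ := norm_pos_iff.2 (sub_ne_zero.2 hx)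
  have hs : 0 < ‖x - a‖ ^ 2 := by positivity
  have hsq : Real.sqrt (‖x - a‖ ^ 2) = ‖x - a‖ := Real.sqrt_sq h0.le
  have h2 : HasDerivAt (fun s => 1 / (2 * Real.sqrt s)) (-(1 / (4 * ‖x - a‖ ^ 3))) (‖x - a‖ ^ 2) := by
    have := ((Real.hasDerivAt_sqrt hs.ne').const_mul 2).inv (by rw [hsq]; positivity)
    simp only [one_div]
    refine this.congr_deriv ?_
    rw [hsq]; field_simp; norm_num
  have := (Jet.normSq a x).comp (F := Real.sqrt) rfl
    (Real.contDiffAt_sqrt hs.ne') (F1 := fun s => 1 / (2 * Real.sqrt s))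
    ((lt_mem_nhds hs).mono fun s hs => Real.hasDerivAt_sqrt hs.ne') h2
  have e : (fun y => Real.sqrt (‖y - a‖ ^ 2)) = fun y => ‖y - a‖ := by
    funext y; exact Real.sqrt_sq (norm_nonneg _)
  rw [e, hsq, smul_smul, norm_smul] at this
  have e1 : ‖x - a‖⁻¹ • (x - a) = (1 / (2 * ‖x - a‖) * 2) • (x - a) := by
    congr 1; field_simp
  have e2 : ((N : ℝ) - 1) / ‖x - a‖ = -(1 / (4 * ‖x - a‖ ^ 3)) * (‖(2 : ℝ)‖ * ‖x - a‖) ^ 2 +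
      1 / (2 * ‖x - a‖) * (2 * N) := by
    norm_num; field_simp; ring
  rw [e1, e2]; exact this

lemma Jet.comp_isom (R : Euc N ≃ₗᵢ[ℝ] Euc N) (a b : Euc N)
    (h : Jet φ (b + R (x - a)) p l) : Jet (fun y => φ (b + R (y - a))) x (R.symm p) l := by
  set A : Euc N → Euc N := fun y => b + R (y - a) with hA
  let RL : Euc N →L[ℝ] Euc N := (R : Euc N ≃L[ℝ] Euc N)
  have hAd : ∀ y, HasFDerivAt A RL y := by
    intro y
    have h1 := RL.hasFDerivAt.comp y ((hasFDerivAt_id y).sub_const a)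
    exact h1.const_add b
  have hAc : ContDiff ℝ 2 A := by
    have h1 := RL.contDiff (n := 2)
    exact contDiff_const.add (h1.comp (contDiff_id.sub contDiff_const))
  have hd : ∀ᶠ y in 𝓝 x, DifferentiableAt ℝ φ (A y) := by
    have h1 := h.1.eventually (by norm_num)
    have h2 : ∀ᶠ y in 𝓝 (A x), DifferentiableAt ℝ φ y :=
      h1.mono fun y hy => hy.differentiableAt (by norm_num)
    exact hAc.continuous.continuousAt.eventually h2
  have e : fderiv ℝ (fun y => φ (A y)) =ᶠ[𝓝 x] fun y => (fderiv ℝ φ (A y)).comp RL := by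
    filter_upwards [hd] with y hy1
    exact (hy1.hasFDerivAt.comp y (hAd y)).fderiv
  refine ⟨ContDiffAt.comp x h.1 hAc.contDiffAt, ?_, ?_⟩
  · apply gradient_of_hasFDerivAt
    have := h.hasFDerivAt.comp x (hAd x)
    refine this.congr_fderiv (ContinuousLinearMap.ext fun v => ?_)
    have : (inner ℝ p (R v) : ℝ) = inner ℝ (R.symm p) v := by
      rw [← R.symm.inner_map_map]; simp
    simpa [RL] using this
  · have hD : HasFDerivAt (fderiv ℝ φ) (fderiv ℝ (fderiv ℝ φ) (A x)) (A x) := by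
      apply DifferentiableAt.hasFDerivAt
      have : ContDiffAt ℝ 1 (fderiv ℝ φ) (A x) := h.1.fderiv_right (by norm_num)
      exact this.differentiableAt (by norm_num)
    have h3 := (hD.comp x (hAd x))
    have h4 : HasFDerivAt (fun y => (fderiv ℝ φ (A y)).comp RL)
        (((ContinuousLinearMap.compL ℝ (Euc N) (Euc N) ℝ).flip RL).comp
          ((fderiv ℝ (fderiv ℝ φ) (A x)).comp RL)) x :=
      ((ContinuousLinearMap.compL ℝ (Euc N) (Euc N) ℝ).flip RL).hasFDerivAt.comp x h3
    rw [lapl_eq_fderiv, e.fderiv_eq, h4.fderiv, ← h.2.2, lapl_eq_laplacian,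
      InnerProductSpace.laplacian_eq_iteratedFDeriv_orthonormalBasis φ
        ((EuclideanSpace.basisFun (Fin N) ℝ).map R)]
    refine Finset.sum_congr rfl fun i _ => ?_
    rw [iteratedFDeriv_two_apply]
    simp [RL, hA]

lemma Jet.localMin (h : Jet φ x p l) (hm : IsLocalMin φ x) : p = 0 ∧ 0 ≤ l := by
  have hp : p = 0 := by
    have h1 := hm.fderiv_eq_zero
    rw [← h.2.1, gradient, h1]; simp
  refine ⟨hp, ?_⟩
  rw [← h.2.2, lapl_eq_fderiv]
  refine Finset.sum_nonneg fun i _ => ?_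
  set v : Euc N := EuclideanSpace.single i 1
  by_contra hneg
  push Not at hneg
  set g : ℝ → ℝ := fun t => φ (x + t • v) with hg
  have hline : ∀ t, HasDerivAt (fun t : ℝ => x + t • v) v t := by
    intro t
    have := ((hasDerivAt_id t).smul_const v).const_add x
    simpa using this
  have hlc : ContinuousAt (fun t : ℝ => x + t • v) 0 := (hline 0).continuousAt
  have hl0 : x + (0 : ℝ) • v = x := by simp
  have hd : ∀ᶠ y in 𝓝 x, DifferentiableAt ℝ φ y := by
    have := h.1.eventually (by norm_num)
    exact this.mono fun y hy => hy.differentiableAt (by norm_num)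
  have hd' : ∀ᶠ t : ℝ in 𝓝 0, DifferentiableAt ℝ φ (x + t • v) := by
    apply hlc.eventually; simpa only [hl0] using hd
  have e : deriv g =ᶠ[𝓝 0] fun t => fderiv ℝ φ (x + t • v) v := by
    filter_upwards [hd'] with t ht
    exact (ht.hasFDerivAt.comp_hasDerivAt t (hline t)).deriv
  have hD : HasFDerivAt (fderiv ℝ φ) (fderiv ℝ (fderiv ℝ φ) x) (x + (0:ℝ) • v) := by
    rw [hl0]
    apply DifferentiableAt.hasFDerivAt
    have : ContDiffAt ℝ 1 (fderiv ℝ φ) x := h.1.fderiv_right (by norm_num)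
    exact this.differentiableAt (by norm_num)
  have h2 : HasDerivAt (deriv g) (fderiv ℝ (fderiv ℝ φ) x v v) 0 := by
    have h3 : HasDerivAt (fun t : ℝ => fderiv ℝ φ (x + t • v)) (fderiv ℝ (fderiv ℝ φ) x v) 0 :=
      hD.comp_hasDerivAt (0:ℝ) (hline 0)
    have h4 : HasDerivAt (fun t : ℝ => fderiv ℝ φ (x + t • v) v)
      (fderiv ℝ (fderiv ℝ φ) x v v) 0 :=
      (HasFDerivAt.comp_hasDerivAt (l := fun L : Euc N →L[ℝ] ℝ => L v) (0:ℝ)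
        (ContinuousLinearMap.apply ℝ ℝ v).hasFDerivAt h3)
    exact h4.congr_of_eventuallyEq e
  have hgm : IsLocalMin g 0 := by
    have h5 : Tendsto (fun t : ℝ => x + t • v) (𝓝 0) (𝓝 x) := by
      have := hlc.tendsto; rwa [hl0] at this
    have := h5.eventually hm
    filter_upwards [this] with t ht
    simpa [hg] using ht
  have hd0 : deriv g 0 = 0 := hgm.deriv_eq_zero
  have hgc : ContinuousAt g 0 := by
    have : DifferentiableAt ℝ g 0 := (hd'.self_of_nhds.hasFDerivAt.comp_hasDerivAt (0:ℝ) (hline 0)).differentiableAt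
    exact this.continuousAt
  have hmax : IsLocalMax g 0 := by
    apply isLocalMax_of_deriv_deriv_neg _ hd0 hgc
    rw [h2.deriv]; exact hneg
  have hconst : g =ᶠ[𝓝 0] fun _ => g 0 := by
    filter_upwards [hmax, hgm] with t h1 h2
    exact le_antisymm h1 h2
  have : deriv g =ᶠ[𝓝 0] fun _ => 0 := by
    have := hconst.deriv
    simpa using this
  have h6 := this.deriv_eq
  rw [h2.deriv] at h6
  simp at h6
  linarith

lemma Jet.localMax (h : Jet φ x p l) (hm : IsLocalMax φ x) : p = 0 ∧ l ≤ 0 := by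
  have := h.neg.localMin hm.neg
  exact ⟨by simpa using this.1, by linarith [this.2]⟩

lemma continuous_gradient (h : ContDiff ℝ 2 φ) : Continuous (gradient φ) := by
  unfold gradient
  exact (InnerProductSpace.toDual ℝ (Euc N)).symm.continuous.comp (h.continuous_fderiv (by norm_num))

lemma continuous_lapl (h : ContDiff ℝ 2 φ) : Continuous (lapl φ) := by
  have e : lapl φ = fun x => ∑ i : Fin N, fderiv ℝ (fderiv ℝ φ) x (EuclideanSpace.single i 1)
      (EuclideanSpace.single i 1) := by funext x; exact lapl_eq_fderiv φ x
  rw [e]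
  have h1 : ContDiff ℝ 1 (fderiv ℝ φ) := h.fderiv_right (by norm_num)
  have h2 : Continuous (fderiv ℝ (fderiv ℝ φ)) := h1.continuous_fderiv (by norm_num)
  refine continuous_finsetSum _ fun i _ => ?_
  exact (h2.clm_apply continuous_const).clm_apply continuous_const

/-- A function which is `C²` near `x` coincides near `x` with a globally `C²` one. -/
lemma exists_global_C2 (h : ContDiffAt ℝ 2 φ x) :
    ∃ ψ : Euc N → ℝ, ContDiff ℝ 2 ψ ∧ ψ =ᶠ[𝓝 x] φ := by
  have h1 := h.eventually (by norm_num)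
  obtain ⟨r, hr, hb⟩ := Metric.eventually_nhds_iff_ball.1 h1
  let χ : ContDiffBump x := ⟨r / 4, r / 2, by positivity, by linarith⟩
  refine ⟨fun y => χ y * φ y, ?_, ?_⟩
  · rw [contDiff_iff_contDiffAt]
    intro y
    by_cases hy : y ∈ ball x r
    · exact (χ.contDiff.contDiffAt).mul (hb y hy)
    · have : (fun y => χ y * φ y) =ᶠ[𝓝 y] fun _ => 0 := by
        have : ∀ᶠ z in 𝓝 y, r / 2 < dist z x := by
          have hc : Continuous fun z => dist z x := by fun_prop
          apply hc.continuousAt.eventually_const_lt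
          simp at hy; linarith
        filter_upwards [this] with z hz
        rw [χ.zero_of_le_dist hz.le, zero_mul]
      exact contDiffAt_const.congr_of_eventuallyEq this
  · filter_upwards [χ.eventuallyEq_one] with y hy
    simp [hy]
end



/-- The operator `-Δφ + |Dφ|^m`. -/
noncomputable def Ham {N : ℕ} (m : ℝ) (φ : Euc N → ℝ) (x : Euc N) : ℝ :=
  -lapl φ x + ‖gradient φ x‖ ^ m

lemma Jet.ham {N : ℕ} {φ : Euc N → ℝ} {x p : Euc N} {l : ℝ} (h : Jet φ x p l) (m : ℝ) :
    Ham m φ x = -l + ‖p‖ ^ m := by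
  unfold Ham; rw [h.2.1, h.2.2]

lemma continuous_ham {N : ℕ} {m : ℝ} (hm : 0 ≤ m) {φ : Euc N → ℝ} (h : ContDiff ℝ 2 φ) :
    Continuous (Ham m φ) := by
  unfold Ham
  exact (continuous_lapl h).neg.add ((continuous_gradient h).norm.rpow_const fun _ => Or.inr hm)

/-- Subsolutions that can be approximated locally uniformly by smooth almost-subsolutions. -/
def SSub {N : ℕ} (Ω : Set (Euc N)) (m : ℝ) (g u : Euc N → ℝ) : Prop :=
  ∀ K : Set (Euc N), IsCompact K → K ⊆ Ω → ∀ ε > (0 : ℝ), ∃ φ : Euc N → ℝ,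
    ContDiff ℝ 2 φ ∧ ∀ x ∈ K, |φ x - u x| ≤ ε ∧ Ham m φ x ≤ g x + ε

lemma norm_rpow_convex {E : Type*} [NormedAddCommGroup E] [NormedSpace ℝ E] {m : ℝ} (hm : 1 ≤ m)
    (p q : E) {θ : ℝ} (h0 : 0 ≤ θ) (h1 : θ ≤ 1) :
    ‖(1 - θ) • p + θ • q‖ ^ m ≤ (1 - θ) * ‖p‖ ^ m + θ * ‖q‖ ^ m := by
  have h2 : ‖(1 - θ) • p + θ • q‖ ≤ (1 - θ) * ‖p‖ + θ * ‖q‖ := by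
    refine (norm_add_le _ _).trans ?_
    rw [norm_smul, norm_smul, Real.norm_of_nonneg h0, Real.norm_of_nonneg (by linarith)]
  have h3 := (convexOn_rpow hm).2 (norm_nonneg p) (norm_nonneg q)
    (by linarith : 0 ≤ 1 - θ) h0 (by ring)
  exact (Real.rpow_le_rpow (norm_nonneg _) h2 (by linarith)).trans (by simpa using h3)

/-- Smooth approximation of the positive part. -/
lemma exists_regmax {ε : ℝ} (hε : 0 < ε) : ∃ Ψ Ψ1 Ψ2 : ℝ → ℝ, ContDiff ℝ 2 Ψ ∧
    (∀ s, HasDerivAt Ψ (Ψ1 s) s) ∧ (∀ s, HasDerivAt Ψ1 (Ψ2 s) s) ∧ (∀ s, 0 ≤ Ψ1 s) ∧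
    (∀ s, Ψ1 s ≤ 1) ∧ (∀ s, 0 ≤ Ψ2 s) ∧ (∀ s ≤ 0, Ψ s = 0) ∧ (∀ s, Ψ s ≤ max s 0) ∧
    (∀ s, max s 0 - ε ≤ Ψ s) ∧ (∀ s, ε ≤ s → Ψ1 s = 1) := by
  set P : ℝ → ℝ := fun s => Real.smoothTransition (s / ε) with hP
  have hPc : ContDiff ℝ 2 P := by
    exact Real.smoothTransition.contDiff.comp (contDiff_id.div_const ε)
  have hPcont : Continuous P := hPc.continuous
  have hPmono : Monotone P := by
    intro a b hab
    exact Real.smoothTransition.monotone (by gcongr)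
  have hPd : Differentiable ℝ P := hPc.differentiable (by norm_num)
  have hder : ∀ s, HasDerivAt (fun s => ∫ t in (0:ℝ)..s, P t) (P s) s := by
    intro s
    exact intervalIntegral.integral_hasDerivAt_right (hPcont.intervalIntegrable _ _)
      (hPcont.stronglyMeasurableAtFilter _ _) hPcont.continuousAt
  have h0 : ∀ s, 0 ≤ P s := fun s => Real.smoothTransition.nonneg _
  have h1 : ∀ s, P s ≤ 1 := fun s => Real.smoothTransition.le_one _
  have hz : ∀ s ≤ 0, ∫ t in (0:ℝ)..s, P t = 0 := by
    intro s hs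
    rw [intervalIntegral.integral_congr (g := fun _ => (0:ℝ))]
    · simp
    · intro t ht
      rw [uIcc_of_ge hs] at ht
      exact Real.smoothTransition.zero_of_nonpos (div_nonpos_of_nonpos_of_nonneg ht.2 hε.le)
  have hone : ∀ s, ε ≤ s → P s = 1 := fun s hs =>
    Real.smoothTransition.one_of_one_le ((one_le_div hε).2 hs)
  have hnn : ∀ s, 0 ≤ ∫ t in (0:ℝ)..s, P t := by
    intro s
    rcases le_total s 0 with h | h
    · rw [hz s h]
    · exact intervalIntegral.integral_nonneg h fun t _ => h0 t
  refine ⟨fun s => ∫ t in (0:ℝ)..s, P t, P, deriv P, ?_, hder, fun s => (hPd s).hasDerivAt, h0, h1,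
    fun s => hPmono.deriv_nonneg, hz, ?_, ?_, hone⟩
  · rw [show (2 : WithTop ℕ∞) = 1 + 1 by norm_num, contDiff_succ_iff_deriv]
    refine ⟨fun s => (hder s).differentiableAt, by simp, ?_⟩
    have : deriv (fun s => ∫ t in (0:ℝ)..s, P t) = P := funext fun s => (hder s).deriv
    rw [this]; exact hPc.of_le (by norm_num)
  · intro s
    rcases le_total s 0 with h | h
    · simp only [hz s h]; exact le_max_right _ _
    · have := intervalIntegral.integral_mono_on h (hPcont.intervalIntegrable 0 s)
        (continuous_const.intervalIntegrable (μ := volume) 0 s) fun t _ => h1 t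
      simp at this
      exact this.trans (le_max_left _ _)
  · intro s
    rcases le_total s ε with h | h
    · have : max s 0 ≤ ε := max_le h hε.le
      linarith [hnn s]
    · have e := intervalIntegral.integral_add_adjacent_intervals
        (hPcont.intervalIntegrable (μ := volume) 0 ε) (hPcont.intervalIntegrable ε s)
      have e2 : ∫ t in ε..s, P t = s - ε := by
        rw [intervalIntegral.integral_congr (g := fun _ => (1:ℝ))]
        · simp
        · intro t ht
          rw [uIcc_of_le h] at ht
          exact hone t ht.1
      have := hnn ε
      rw [max_eq_left (by linarith)]
      simp only
      linarith

section
variable {N : ℕ} {Ω : Set (Euc N)} {m : ℝ} {g g' u v : Euc N → ℝ}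

lemma ham_regmax (hm : 1 ≤ m) {Ψ Ψ1 Ψ2 : ℝ → ℝ} (hΨ : ContDiff ℝ 2 Ψ)
    (hd1 : ∀ s, HasDerivAt Ψ (Ψ1 s) s) (hd2 : ∀ s, HasDerivAt Ψ1 (Ψ2 s) s)
    (h0 : ∀ s, 0 ≤ Ψ1 s) (h1 : ∀ s, Ψ1 s ≤ 1) (h2 : ∀ s, 0 ≤ Ψ2 s)
    {φ ψ : Euc N → ℝ} (hφ : ContDiff ℝ 2 φ) (hψ : ContDiff ℝ 2 ψ) (x : Euc N) :
    Ham m (fun y => φ y + Ψ (ψ y - φ y)) x ≤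
      (1 - Ψ1 (ψ x - φ x)) * Ham m φ x + Ψ1 (ψ x - φ x) * Ham m ψ x := by
  have j1 := Jet.of_contDiff (x := x) hφ
  have j2 := Jet.of_contDiff (x := x) hψ
  have j3 := j1.add ((j2.sub j1).comp (F := Ψ) rfl hΨ.contDiffAt (Eventually.of_forall hd1) (hd2 _))
  rw [j3.ham, j1.ham, j2.ham]
  set θ := Ψ1 (ψ x - φ x)
  have e : gradient φ x + θ • (gradient ψ x - gradient φ x) =
    (1 - θ) • gradient φ x + θ • gradient ψ x := by module
  rw [e]
  have := norm_rpow_convex hm (gradient φ x) (gradient ψ x) (h0 (ψ x - φ x)) (h1 (ψ x - φ x))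
  have h3 := mul_nonneg (h2 (ψ x - φ x)) (sq_nonneg ‖gradient ψ x - gradient φ x‖)
  change ‖(1 - θ) • gradient φ x + θ • gradient ψ x‖ ^ m ≤ (1 - θ) * _ + θ * _ at this
  nlinarith

lemma SSub.mono (h : SSub Ω m g u) (hg : ∀ x ∈ Ω, g x ≤ g' x) : SSub Ω m g' u := by
  intro K hK hKΩ ε hε
  obtain ⟨φ, h1, h2⟩ := h K hK hKΩ ε hε
  exact ⟨φ, h1, fun x hx => ⟨(h2 x hx).1, (h2 x hx).2.trans (by linarith [hg x (hKΩ hx)])⟩⟩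

lemma SSub.add_const (h : SSub Ω m g u) (c : ℝ) : SSub Ω m g (fun x => u x + c) := by
  intro K hK hKΩ ε hε
  obtain ⟨φ, h1, h2⟩ := h K hK hKΩ ε hε
  refine ⟨fun x => φ x + c, h1.add contDiff_const, fun x hx => ⟨?_, ?_⟩⟩
  · simpa using (h2 x hx).1
  · rw [((Jet.of_contDiff (x := x) h1).add_const c).ham]; exact (h2 x hx).2

lemma SSub.of_approx
    (h : ∀ ε > (0:ℝ), ∃ w, SSub Ω m (fun x => g x + ε) w ∧ ∀ x ∈ Ω, |w x - u x| ≤ ε) :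
    SSub Ω m g u := by
  intro K hK hKΩ ε hε
  obtain ⟨w, h1, h2⟩ := h (ε / 2) (by linarith)
  obtain ⟨φ, h3, h4⟩ := h1 K hK hKΩ (ε / 2) (by linarith)
  refine ⟨φ, h3, fun x hx => ⟨?_, ?_⟩⟩
  · have a1 := (h4 x hx).1
    have a2 := h2 x (hKΩ hx)
    have := abs_sub_le (φ x) (w x) (u x)
    linarith
  · linarith [(h4 x hx).2]

lemma SSub.max (hm : 1 ≤ m) (hu : SSub Ω m g u) (hv : SSub Ω m g v) :
    SSub Ω m g (fun x => max (u x) (v x)) := by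
  intro K hK hKΩ ε hε
  obtain ⟨φ, h1, h2⟩ := hu K hK hKΩ (ε / 4) (by linarith)
  obtain ⟨ψ, h3, h4⟩ := hv K hK hKΩ (ε / 4) (by linarith)
  obtain ⟨Ψ, Ψ1, Ψ2, p1, p2, p3, p4, p5, p6, p7, p8, p9, p10⟩ :=
    exists_regmax (ε := ε / 4) (by linarith)
  refine ⟨fun y => φ y + Ψ (ψ y - φ y), h1.add (p1.comp (h3.sub h1)), fun x hx => ⟨?_, ?_⟩⟩
  · have a1 := abs_le.1 (h2 x hx).1
    have a2 := abs_le.1 (h4 x hx).1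
    have a3 := p8 (ψ x - φ x)
    have a4 := p9 (ψ x - φ x)
    have e1 : φ x + Max.max (ψ x - φ x) 0 = Max.max (φ x) (ψ x) := by
      rcases le_total (φ x) (ψ x) with h | h
      · rw [max_eq_left (by linarith), max_eq_right h]; ring
      · rw [max_eq_right (by linarith), max_eq_left h]; ring
    have e2 : Max.max (φ x) (ψ x) ≤ Max.max (u x) (v x) + ε / 4 :=
      max_le (by linarith [le_max_left (u x) (v x)]) (by linarith [le_max_right (u x) (v x)])
    have e3 : Max.max (u x) (v x) ≤ Max.max (φ x) (ψ x) + ε / 4 :=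
      max_le (by linarith [le_max_left (φ x) (ψ x)]) (by linarith [le_max_right (φ x) (ψ x)])
    rw [abs_le]; constructor <;> linarith
  · refine (ham_regmax hm p1 p2 p3 p4 p5 p6 h1 h3 x).trans ?_
    have a1 := (h2 x hx).2
    have a2 := (h4 x hx).2
    have a3 := p4 (ψ x - φ x)
    have a4 := p5 (ψ x - φ x)
    nlinarith

lemma SSub.avg (hm : 1 ≤ m) (hu : SSub Ω m g u) (hv : SSub Ω m g' v) :
    SSub Ω m (fun x => (g x + g' x) / 2) (fun x => (u x + v x) / 2) := by
  intro K hK hKΩ ε hε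
  obtain ⟨φ, h1, h2⟩ := hu K hK hKΩ ε hε
  obtain ⟨ψ, h3, h4⟩ := hv K hK hKΩ ε hε
  refine ⟨fun y => (1/2) * φ y + (1/2) * ψ y, (contDiff_const.mul h1).add (contDiff_const.mul h3),
    fun x hx => ⟨?_, ?_⟩⟩
  · have a1 := abs_le.1 (h2 x hx).1
    have a2 := abs_le.1 (h4 x hx).1
    rw [abs_le]; constructor <;> linarith
  · have j1 := Jet.of_contDiff (x := x) h1
    have j2 := Jet.of_contDiff (x := x) h3
    rw [((j1.const_mul (1/2)).add (j2.const_mul (1/2))).ham]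
    have a1 := (h2 x hx).2
    have a2 := (h4 x hx).2
    rw [j1.ham] at a1
    rw [j2.ham] at a2
    have := norm_rpow_convex hm (gradient φ x) (gradient ψ x) (θ := 1/2) (by norm_num) (by norm_num)
    norm_num at this ⊢
    linarith

lemma ssub_bump (hm : 1 ≤ m) (hu : ContinuousOn u (closure Ω)) (hS : SSub Ω m g u)
    (hg : ContinuousOn g (closure Ω)) {y : Euc N} (hy : y ∈ closure Ω) {φ : Euc N → ℝ}
    (hφ : ContDiff ℝ 2 φ) (hmin : IsLocalMinOn (u - φ) (closure Ω) y) (hlt : Ham m φ y < g y)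
    {r0 : ℝ} (hr0 : 0 < r0) :
    ∃ w, ContinuousOn w (closure Ω) ∧ (∃ η > 0, ∃ r' > 0,
      SSub Ω m g w ∧ SSub Ω m (fun x => g x - (ball y r').indicator (fun _ => η) x) w) ∧
      (∀ x ∈ closure Ω, u x ≤ w x) ∧ (∀ x ∈ closure Ω, r0 ≤ dist x y → w x = u x) ∧ u y < w y := by
  -- the strict perturbation
  obtain ⟨θ, hθ, hθlt⟩ : ∃ θ > 0, Ham m φ y + 2 * N * θ < g y := by
    refine ⟨(g y - Ham m φ y) / (2 * (2 * N + 1)), by apply div_pos <;> [linarith; positivity], ?_⟩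
    have h1 : 0 < g y - Ham m φ y := by linarith
    have h2 : 2 * (N:ℝ) * ((g y - Ham m φ y) / (2 * (2 * N + 1))) ≤ (g y - Ham m φ y) / 2 := by
      have h3 : (0:ℝ) < 2 * N + 1 := by positivity
      rw [mul_div_assoc', div_le_div_iff₀ (by positivity) (by norm_num)]
      nlinarith
    linarith
  set ψ : Euc N → ℝ := fun x => φ x + (u y - φ y) - θ * ‖x - y‖ ^ 2 with hψ
  have hψc : ContDiff ℝ 2 ψ :=
    (hφ.add contDiff_const).sub (contDiff_const.mul ((contDiff_id.sub contDiff_const).norm_sq ℝ))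
  have hψy : ψ y = u y := by simp [hψ]
  have hHy : Ham m ψ y < g y := by
    have j := ((Jet.of_contDiff (x := y) hφ).add_const (u y - φ y)).sub ((Jet.normSq y y).const_mul θ)
    rw [j.ham]
    simp only [sub_self, smul_zero, sub_zero]
    rw [(Jet.of_contDiff (x := y) hφ).ham] at hθlt
    linarith
  obtain ⟨η, hη, hηlt⟩ : ∃ η > 0, Ham m ψ y < g y - η :=
    ⟨(g y - Ham m ψ y) / 2, by linarith, by linarith⟩
  have ev1 : ∀ᶠ x in 𝓝[closure Ω] y, Ham m ψ x < g x - η := by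
    have c1 : ContinuousWithinAt (fun x => g x - η - Ham m ψ x) (closure Ω) y :=
      ((hg y hy).sub continuousWithinAt_const).sub
        (continuous_ham (by linarith) hψc).continuousWithinAt
    have := c1.eventually_const_lt (u := 0) (by linarith)
    filter_upwards [this] with x hx; linarith
  obtain ⟨r1, hr1, hb1⟩ := Metric.mem_nhdsWithin_iff.1 (ev1.and hmin)
  set r := min r1 r0 with hr
  have hrpos : 0 < r := lt_min hr1 hr0
  have hb : ∀ x ∈ closure Ω, dist x y < r → Ham m ψ x < g x - η ∧ ψ x ≤ u x - θ * ‖x - y‖ ^ 2 := by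
    intro x hx hxr
    have := hb1 ⟨mem_ball.2 (lt_of_lt_of_le hxr (min_le_left _ _)), hx⟩
    refine ⟨this.1, ?_⟩
    have h2 := this.2
    simp only [Pi.sub_apply] at h2
    simp only [hψ]; linarith
  set κ := θ * r ^ 2 / 8 with hκ
  have hκp : 0 < κ := by positivity
  have hfar : ∀ x ∈ closure Ω, dist x y < r → r / 2 ≤ dist x y → ψ x + κ ≤ u x - κ := by
    intro x hx h1 h2
    have := (hb x hx h1).2
    rw [dist_eq_norm] at h2
    have h3 : (r / 2) ^ 2 ≤ ‖x - y‖ ^ 2 := by gcongr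
    have : θ * (r / 2) ^ 2 ≤ θ * ‖x - y‖ ^ 2 := by gcongr
    rw [hκ]; nlinarith
  have ev2 : ∀ᶠ x in 𝓝[closure Ω] y, κ / 2 < ψ x + κ - u x := by
    have c1 : ContinuousWithinAt (fun x => ψ x + κ - u x) (closure Ω) y :=
      (hψc.continuous.continuousWithinAt.add continuousWithinAt_const).sub (hu y hy)
    exact c1.eventually_const_lt (by simp only [hψy]; linarith)
  obtain ⟨r2, hr2, hb2⟩ := Metric.mem_nhdsWithin_iff.1 ev2
  let χ : ContDiffBump y := ⟨3 * r / 4, 7 * r / 8, by positivity, by linarith⟩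
  have hχ1 : ∀ x, dist x y ≤ 3 * r / 4 → χ x = 1 := fun x hx => χ.one_of_mem_closedBall hx
  have hχ0 : ∀ x, 7 * r / 8 ≤ dist x y → χ x = 0 := fun x hx => χ.zero_of_le_dist hx
  set w : Euc N → ℝ := fun x => u x + χ x * max (ψ x + κ - u x) 0 with hw
  set r' := min r2 (r / 2) with hr'
  have hr'p : 0 < r' := lt_min hr2 (by linarith)
  have key : ∀ K : Set (Euc N), IsCompact K → K ⊆ Ω → ∀ ε > (0 : ℝ), ∃ Φ : Euc N → ℝ,
    ContDiff ℝ 2 Φ ∧ ∀ x ∈ K, |Φ x - w x| ≤ ε ∧ Ham m Φ x ≤ g x + ε ∧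
      (x ∈ ball y r' → Ham m Φ x ≤ g x - η) := by
    intro K hK hKΩ ε hε
    set ε' := min (ε / 4) (κ / 4) with hε'
    have hε'p : 0 < ε' := lt_min (by linarith) (by linarith)
    have he1 : ε' ≤ ε / 4 := min_le_left _ _
    have he2 : ε' ≤ κ / 4 := min_le_right _ _
    obtain ⟨φ1, h1, h2⟩ := hS K hK hKΩ ε' hε'p
    obtain ⟨Ψ, Ψ1, Ψ2, p1, p2, p3, p4, p5, p6, p7, p8, p9, p10⟩ := exists_regmax hε'p
    have hψκ : ContDiff ℝ 2 (fun x => ψ x + κ) := hψc.add contDiff_const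
    refine ⟨fun x => φ1 x + χ x * Ψ (ψ x + κ - φ1 x),
      h1.add (χ.contDiff.mul (p1.comp (hψκ.sub h1))), fun x hx => ?_⟩
    have hxc : x ∈ closure Ω := subset_closure (hKΩ hx)
    have a1 := abs_le.1 (h2 x hx).1
    have hH1 := (h2 x hx).2
    refine ⟨?_, ?_⟩
    · have b1 := p8 (ψ x + κ - φ1 x)
      have b2 := p9 (ψ x + κ - φ1 x)
      have b3 : |Ψ (ψ x + κ - φ1 x) - max (ψ x + κ - u x) 0| ≤ 2 * ε' := by
        have c1 : max (ψ x + κ - φ1 x) 0 ≤ max (ψ x + κ - u x) 0 + ε' :=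
          max_le (by linarith [le_max_left (ψ x + κ - u x) 0])
            (by linarith [le_max_right (ψ x + κ - u x) 0])
        have c2 : max (ψ x + κ - u x) 0 ≤ max (ψ x + κ - φ1 x) 0 + ε' :=
          max_le (by linarith [le_max_left (ψ x + κ - φ1 x) 0])
            (by linarith [le_max_right (ψ x + κ - φ1 x) 0])
        rw [abs_le]; constructor <;> linarith
      have e : φ1 x + χ x * Ψ (ψ x + κ - φ1 x) - w x =
        (φ1 x - u x) + χ x * (Ψ (ψ x + κ - φ1 x) - max (ψ x + κ - u x) 0) := by
        simp only [hw]; ring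
      simp only [e]
      have c3 : |χ x * (Ψ (ψ x + κ - φ1 x) - max (ψ x + κ - u x) 0)| ≤ 1 * (2 * ε') := by
        rw [abs_mul]
        gcongr
        rw [abs_of_nonneg χ.nonneg]; exact χ.le_one
      have := abs_add_le (φ1 x - u x) (χ x * (Ψ (ψ x + κ - φ1 x) - max (ψ x + κ - u x) 0))
      have := (h2 x hx).1
      linarith
    · by_cases hx1 : dist x y < 3 * r / 4
      · -- inside
        have hnear : ∀ᶠ z in 𝓝 x, dist z y < 3 * r / 4 := by
          have hc : Continuous fun z => dist z y := by fun_prop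
          exact hc.continuousAt.eventually_lt_const hx1
        have e : (fun x => φ1 x + χ x * Ψ (ψ x + κ - φ1 x)) =ᶠ[𝓝 x]
          fun x => φ1 x + Ψ ((ψ x + κ) - φ1 x) := by
          filter_upwards [hnear] with z hz
          rw [hχ1 z hz.le, one_mul]
        have j : ContDiff ℝ 2 (fun x => φ1 x + Ψ ((ψ x + κ) - φ1 x)) :=
          h1.add (p1.comp (hψκ.sub h1))
        rw [((Jet.of_contDiff (x := x) j).congr e).ham, ← (Jet.of_contDiff (x := x) j).ham]
        have hle := ham_regmax hm p1 p2 p3 p4 p5 p6 h1 hψκ x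
        have hHκ : Ham m (fun x => ψ x + κ) x = Ham m ψ x := by
          rw [((Jet.of_contDiff (x := x) hψc).add_const κ).ham, (Jet.of_contDiff (x := x) hψc).ham]
        rw [hHκ] at hle
        have hHψ := (hb x hxc (by linarith)).1
        refine ⟨hle.trans ?_, fun hxb => ?_⟩
        · have a3 := p4 (ψ x + κ - φ1 x)
          have a4 := p5 (ψ x + κ - φ1 x)
          nlinarith
        · have := hb2 ⟨mem_ball.2 (lt_of_lt_of_le (mem_ball.1 hxb) (min_le_left _ _)), hxc⟩
          simp only [mem_ofPred_eq] at this
          rw [p10 (ψ x + κ - φ1 x) (by linarith)] at hle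
          linarith
      · push Not at hx1
        have e : (fun x => φ1 x + χ x * Ψ (ψ x + κ - φ1 x)) =ᶠ[𝓝 x] φ1 := by
          by_cases hx2 : dist x y < r
          · have hneg : ψ x + κ - φ1 x < 0 := by
              have := hfar x hxc hx2 (by linarith)
              linarith
            have hc : Continuous fun x => ψ x + κ - φ1 x :=
              (hψκ.continuous).sub h1.continuous
            filter_upwards [hc.continuousAt.eventually_lt_const hneg] with z hz
            rw [p7 _ hz.le]; simp
          · have hc : Continuous fun z => dist z y := by fun_prop
            have : ∀ᶠ z in 𝓝 x, 7 * r / 8 < dist z y :=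
              hc.continuousAt.eventually_const_lt (by push Not at hx2; linarith)
            filter_upwards [this] with z hz
            rw [hχ0 z hz.le]; simp
        have j := (Jet.of_contDiff (x := x) h1)
        rw [(j.congr e).ham, ← j.ham]
        refine ⟨by linarith, fun hxb => ?_⟩
        have := lt_of_lt_of_le (mem_ball.1 hxb) (min_le_right _ _)
        linarith
  refine ⟨w, ?_, ⟨η, hη, r', hr'p, ?_, ?_⟩, ?_, ?_, ?_⟩
  · have : ContinuousOn (fun x => max (ψ x + κ - u x) 0) (closure Ω) :=
      (((hψc.continuous.continuousOn).add continuousOn_const).sub hu).sup continuousOn_const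
    exact hu.add (χ.continuous.continuousOn.mul this)
  · intro K hK hKΩ ε hε
    obtain ⟨Φ, h1, h2⟩ := key K hK hKΩ ε hε
    exact ⟨Φ, h1, fun x hx => ⟨(h2 x hx).1, (h2 x hx).2.1⟩⟩
  · intro K hK hKΩ ε hε
    obtain ⟨Φ, h1, h2⟩ := key K hK hKΩ ε hε
    refine ⟨Φ, h1, fun x hx => ⟨(h2 x hx).1, ?_⟩⟩
    beta_reduce
    by_cases hxb : x ∈ ball y r'
    · rw [indicator_of_mem hxb]; linarith [(h2 x hx).2.2 hxb]
    · rw [indicator_of_notMem hxb]; linarith [(h2 x hx).2.1]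
  · intro x _
    simp only [hw]
    have := mul_nonneg (χ.nonneg (x := x)) (le_max_right (ψ x + κ - u x) 0)
    linarith
  · intro x hx hxr
    simp only [hw]
    rw [hχ0 x (by have := min_le_right r1 r0; linarith)]; ring
  · simp only [hw]
    rw [hχ1 y (by simp; linarith), hψy]
    have : max (u y + κ - u y) 0 = κ := by rw [max_eq_left] <;> linarith
    rw [this]; linarith

end



lemma barrier_ineq {m : ℝ} (hm : 2 < m) (n : ℕ) {M A : ℝ} (hA : (n : ℝ) + 1 ≤ A) (hM : M < A)
    {s R ε : ℝ} (hs : 0 < s) (hsR : s < R) (hR : R ≤ 1) (hε : 0 ≤ ε) :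
    M < -(A * (-(1 / (m - 1)) * s ^ (-(1 / (m - 1)) - 1)
          + (1 / (m - 1)) * (R - s) ^ (-(1 / (m - 1)) - 1)) + ε * ((R - s) ^ 2)⁻¹)
      - (n - 1) / s * (A * (s ^ (-(1 / (m - 1))) + (R - s) ^ (-(1 / (m - 1)))) + ε * (R - s)⁻¹)
      + (A * (s ^ (-(1 / (m - 1))) + (R - s) ^ (-(1 / (m - 1)))) + ε * (R - s)⁻¹) ^ m := by
  have hm1 : 0 < m - 1 := by linarith
  set b := 1 / (m - 1) with hb
  have hb0 : 0 < b := by positivity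
  have hb1 : b ≤ 1 := by rw [hb, div_le_one hm1]; linarith
  have hbm : b * (m - 1) = 1 := by rw [hb]; field_simp
  have hRs : 0 < R - s := by linarith
  set σ := s ^ (-b) with hσ
  set τ := (R - s) ^ (-b) with hτ
  have hσ0 : 0 < σ := Real.rpow_pos_of_pos hs _
  have hτ0 : 0 < τ := Real.rpow_pos_of_pos hRs _
  have hn : (0:ℝ) ≤ n := Nat.cast_nonneg n
  have hA1 : 1 ≤ A := by linarith
  have hσm : σ ^ (m - 1) = s⁻¹ := by
    rw [hσ, ← Real.rpow_mul hs.le, ← Real.rpow_neg_one]; congr 1; linarith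
  have hτm : τ ^ (m - 1) = (R - s)⁻¹ := by
    rw [hτ, ← Real.rpow_mul hRs.le, ← Real.rpow_neg_one]; congr 1; linarith
  have hσb : s ^ (-b - 1) = σ * s⁻¹ := by
    rw [hσ, ← Real.rpow_neg_one, ← Real.rpow_add hs]; congr 1
  have hτb : (R - s) ^ (-b - 1) = τ * (R - s)⁻¹ := by
    rw [hτ, ← Real.rpow_neg_one (R - s), ← Real.rpow_add hRs]; congr 1
  rw [hσb, hτb]
  set W := A * (σ + τ) + ε * (R - s)⁻¹ with hW
  set X := (σ + τ) ^ (m - 1) with hX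
  have hi0 : 0 < (R - s)⁻¹ := inv_pos.2 hRs
  have hj0 : 0 < s⁻¹ := inv_pos.2 hs
  have hX1 : s⁻¹ ≤ X := by
    rw [← hσm]; exact Real.rpow_le_rpow hσ0.le (by linarith) hm1.le
  have hX2 : (R - s)⁻¹ ≤ X := by
    rw [← hτm]; exact Real.rpow_le_rpow hτ0.le (by linarith) hm1.le
  have hs1 : 1 ≤ s⁻¹ := (one_le_inv₀ hs).2 (by linarith)
  have hσ1 : 1 ≤ σ := Real.one_le_rpow_of_pos_of_le_one_of_nonpos hs (by linarith) (by linarith)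
  have hεi : 0 ≤ ε * (R - s)⁻¹ := by positivity
  have hWA : A ≤ W := by nlinarith
  have hW0 : 0 < W := by linarith
  have hX0 : 0 < X := by linarith
  -- second derivative
  have h2 : A * (-b * (σ * s⁻¹) + b * (τ * (R - s)⁻¹)) + ε * ((R - s) ^ 2)⁻¹ ≤ X * W := by
    have e1 : ((R - s) ^ 2)⁻¹ = (R - s)⁻¹ * (R - s)⁻¹ := by rw [sq, mul_inv]
    rw [e1]
    have t1 : A * (-b * (σ * s⁻¹)) ≤ 0 := by
      have : 0 ≤ A * (b * (σ * s⁻¹)) := by positivity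
      linarith
    have t2 : A * (b * (τ * (R - s)⁻¹)) ≤ A * (τ * (R - s)⁻¹) := by
      have h0 : 0 ≤ τ * (R - s)⁻¹ := by positivity
      exact mul_le_mul_of_nonneg_left (mul_le_of_le_one_left h0 hb1) (by linarith)
    have t3 : (R - s)⁻¹ * (A * τ + ε * (R - s)⁻¹) ≤ X * W := by
      apply mul_le_mul hX2 _ (by positivity) hX0.le
      rw [hW]; nlinarith
    nlinarith
  have h3 : (n - 1) / s * W ≤ n * (X * W) - (s⁻¹ * W) := by
    rw [div_eq_mul_inv]
    have : (n:ℝ) * (s⁻¹ * W) ≤ n * (X * W) := by gcongr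
    linarith
  have h4 : A * (X * W) ≤ W ^ m := by
    have e : W ^ m = W ^ (m - 1) * W := by
      rw [← Real.rpow_add_one hW0.ne']; congr 1; ring
    rw [e, ← mul_assoc]
    have hAA : A ≤ A ^ (m - 1) := by
      have := Real.rpow_le_rpow_of_exponent_le hA1 (by linarith : (1:ℝ) ≤ m - 1)
      rwa [Real.rpow_one] at this
    refine mul_le_mul_of_nonneg_right ?_ hW0.le
    calc A * X ≤ A ^ (m - 1) * X := mul_le_mul_of_nonneg_right hAA hX0.le
      _ = (A * (σ + τ)) ^ (m - 1) := by
          rw [hX, Real.mul_rpow (by linarith) (by positivity)]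
      _ ≤ W ^ (m - 1) := Real.rpow_le_rpow (by positivity) (by linarith) hm1.le
  have h5 : A ≤ s⁻¹ * W := hWA.trans (le_mul_of_one_le_left hW0.le hs1)
  have h6 : (n + 1) * (X * W) ≤ A * (X * W) :=
    mul_le_mul_of_nonneg_right hA (mul_nonneg hX0.le hW0.le)
  linarith

/-- The constant in the interior one-sided Hölder estimate. -/
noncomputable def holdK (N : ℕ) (m M : ℝ) : ℝ := ((N : ℝ) + 1 + |M| + 1) * ((m - 1) / (m - 2))

lemma holdK_pos (N : ℕ) {m : ℝ} (hm : 2 < m) (M : ℝ) : 0 < holdK N m M := by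
  unfold holdK
  have : 0 < m - 1 := by linarith
  have : 0 < m - 2 := by linarith
  positivity

lemma smooth_holder_eps {N : ℕ} {m : ℝ} (hm : 2 < m) {M : ℝ} {φ : Euc N → ℝ} (hφ : ContDiff ℝ 2 φ)
    {x y : Euc N} {R : ℝ} (hR1 : R ≤ 1) (hH : ∀ z ∈ ball x R, Ham m φ z ≤ M)
    (hy : y ∈ ball x R) {ε : ℝ} (hε : 0 < ε) :
    φ y - φ x ≤ holdK N m M * ‖y - x‖ ^ ((m - 2) / (m - 1)) +
      holdK N m M * (R ^ ((m - 2) / (m - 1)) - (R - ‖y - x‖) ^ ((m - 2) / (m - 1))) +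
      ε * (Real.log R - Real.log (R - ‖y - x‖)) := by
  have hm1 : 0 < m - 1 := by linarith
  have hm2 : 0 < m - 2 := by linarith
  set α := (m - 2) / (m - 1) with hα
  have hα0 : 0 < α := by positivity
  have hα1 : α - 1 = -(1 / (m - 1)) := by rw [hα]; field_simp; ring
  set K := holdK N m M with hK
  have hK0 : 0 < K := holdK_pos N hm M
  set A := (N : ℝ) + 1 + |M| + 1 with hAdef
  have hKα : K * α = A := by rw [hK, hα, holdK, ← hAdef]; field_simp
  have hyR : ‖y - x‖ < R := by simpa [dist_eq_norm] using hy
  have hR0 : 0 < R := (norm_nonneg _).trans_lt hyR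
  set W : ℝ → ℝ := fun s => K * s ^ α + K * (R ^ α - (R - s) ^ α) +
    ε * (Real.log R - Real.log (R - s)) with hW
  set W1 : ℝ → ℝ := fun s => A * (s ^ (-(1 / (m - 1))) + (R - s) ^ (-(1 / (m - 1))))
    + ε * (R - s)⁻¹ with hW1
  by_contra hcon
  push Not at hcon
  obtain ⟨B, hB⟩ : ∃ B, ∀ z ∈ closedBall x R, φ z - φ x ≤ B := by
    have hc : ContinuousOn (fun z => φ z - φ x) (closedBall x R) :=
      (hφ.continuous.sub continuous_const).continuousOn
    obtain ⟨B, hB⟩ := (isCompact_closedBall x R).bddAbove_image hc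
    exact ⟨B, fun z hz => hB (mem_image_of_mem _ hz)⟩
  set d := min ((R - ‖y - x‖) / 2) (R * Real.exp (-((|B| + 1) / ε))) with hd
  have hd0 : 0 < d := lt_min (by linarith) (by positivity)
  have hd1 : d ≤ (R - ‖y - x‖) / 2 := min_le_left _ _
  have hd2 : d ≤ R * Real.exp (-((|B| + 1) / ε)) := min_le_right _ _
  have hlog : |B| + 1 ≤ ε * (Real.log R - Real.log d) := by
    have h1 : Real.log d ≤ Real.log R - (|B| + 1) / ε := by
      have := Real.log_le_log hd0 hd2
      rwa [Real.log_mul hR0.ne' (Real.exp_pos _).ne', Real.log_exp, ← sub_eq_add_neg] at this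
    have h2 : ε * ((|B| + 1) / ε) ≤ ε * (Real.log R - Real.log d) := by
      gcongr; linarith
    rwa [mul_div_cancel₀ _ hε.ne'] at h2
  have hWc : ContinuousOn (fun z => φ z - φ x - W ‖z - x‖) (closedBall x (R - d)) := by
    refine (hφ.continuous.sub continuous_const).continuousOn.sub ?_
    have hn : Continuous fun z : Euc N => ‖z - x‖ := by fun_prop
    have c1 : Continuous fun z : Euc N => ‖z - x‖ ^ α := hn.rpow_const fun _ => Or.inr hα0.le
    have c2 : Continuous fun z : Euc N => (R - ‖z - x‖) ^ α :=
      (continuous_const.sub hn).rpow_const fun _ => Or.inr hα0.le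
    have c3 : ContinuousOn (fun z : Euc N => Real.log (R - ‖z - x‖)) (closedBall x (R - d)) := by
      apply ContinuousOn.log (continuous_const.sub hn).continuousOn
      intro z hz
      have : ‖z - x‖ ≤ R - d := by simpa [dist_eq_norm] using hz
      exact (by linarith : 0 < R - ‖z - x‖).ne'
    exact (((continuous_const.mul c1).add (continuous_const.mul
      (continuous_const.sub c2))).continuousOn).add
      (continuousOn_const.mul (continuousOn_const.sub c3))
  have hymem : y ∈ closedBall x (R - d) := by
    rw [mem_closedBall, dist_eq_norm]; linarith
  obtain ⟨z, hz, hzmax⟩ := (isCompact_closedBall x (R - d)).exists_isMaxOn ⟨y, hymem⟩ hWc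
  have hzval : 0 < φ z - φ x - W ‖z - x‖ := by
    have := hzmax hymem
    simp only [mem_ofPred_eq] at this
    simp only [hW] at this ⊢
    linarith
  have hzd : ‖z - x‖ ≤ R - d := by simpa [dist_eq_norm] using hz
  have hz0 : z ≠ x := by
    rintro rfl
    simp only [hW, sub_self, norm_zero, Real.zero_rpow hα0.ne', sub_zero] at hzval
    linarith
  have hs0 : 0 < ‖z - x‖ := norm_pos_iff.2 (sub_ne_zero.2 hz0)
  have hzlt : ‖z - x‖ < R - d := by
    refine lt_of_le_of_ne hzd fun he => ?_
    have h1 := hB z (by rw [mem_closedBall, dist_eq_norm]; linarith)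
    simp only [hW] at hzval
    rw [he, show R - (R - d) = d by ring] at hzval
    have h2 : d ^ α ≤ R ^ α := Real.rpow_le_rpow hd0.le (by linarith) hα0.le
    have h3 : 0 ≤ (R - d) ^ α := Real.rpow_nonneg (by linarith) _
    have h4 := le_abs_self B
    nlinarith
  have hloc : IsLocalMax (fun w => φ w - (fun w => W ‖w - x‖) w) z := by
    have : closedBall x (R - d) ∈ 𝓝 z := by
      apply mem_of_superset (isOpen_ball.mem_nhds (show z ∈ ball x (R - d) by
        rw [mem_ball, dist_eq_norm]; exact hzlt)) ball_subset_closedBall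
    filter_upwards [this] with w hw
    have := hzmax hw
    simp only [mem_ofPred_eq] at this
    linarith
  have hRz : 0 < R - ‖z - x‖ := by linarith
  have hder : ∀ s, 0 < s → s < R → HasDerivAt W (W1 s) s := by
    intro s h1 h2
    have d0 : HasDerivAt (fun s => R - s) (-1) s := by
      simpa using (hasDerivAt_id s).const_sub R
    have d1 := (Real.hasDerivAt_rpow_const (x := s) (p := α) (Or.inl h1.ne')).const_mul K
    have d2 := ((d0.rpow_const (p := α) (Or.inl (by linarith : 0 < R - s).ne')).const_sub (R ^ α)).const_mul K
    have d3 := ((d0.log (by linarith : 0 < R - s).ne').const_sub (Real.log R)).const_mul ε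
    refine ((d1.add d2).add d3).congr_deriv ?_
    simp only [hW1, hα1, ← hKα]
    have : R - s ≠ 0 := (by linarith : 0 < R - s).ne'
    field_simp
  have hder2 : HasDerivAt W1 (A * (-(1 / (m - 1)) * ‖z - x‖ ^ (-(1 / (m - 1)) - 1)
          + (1 / (m - 1)) * (R - ‖z - x‖) ^ (-(1 / (m - 1)) - 1))
          + ε * ((R - ‖z - x‖) ^ 2)⁻¹) ‖z - x‖ := by
    have d0 : HasDerivAt (fun s => R - s) (-1) ‖z - x‖ := by
      simpa using (hasDerivAt_id ‖z - x‖).const_sub R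
    have d1 := (Real.hasDerivAt_rpow_const (x := ‖z - x‖) (p := -(1 / (m - 1))) (Or.inl hs0.ne'))
    have d2 := (d0.rpow_const (p := -(1 / (m - 1))) (Or.inl hRz.ne'))
    have d3 := (d0.inv hRz.ne').const_mul ε
    refine (((d1.add d2).const_mul A).add d3).congr_deriv ?_
    have : R - ‖z - x‖ ≠ 0 := hRz.ne'
    field_simp
  have hcd : ContDiffAt ℝ 2 W ‖z - x‖ := by
    have c0 : ContDiffAt ℝ 2 (fun s => R - s) ‖z - x‖ := contDiffAt_const.sub contDiffAt_id
    have c1 := (contDiffAt_id (𝕜 := ℝ) (n := 2) (x := ‖z - x‖)).rpow_const_of_ne (p := α) hs0.ne'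
    have c2 := c0.rpow_const_of_ne (p := α) hRz.ne'
    have c3 := c0.log hRz.ne'
    exact ((contDiffAt_const.mul c1).add (contDiffAt_const.mul (contDiffAt_const.sub c2))).add
      (contDiffAt_const.mul (contDiffAt_const.sub c3))
  have jW := (Jet.norm x z hz0).comp (F := W) (F1 := W1) rfl hcd
    (by filter_upwards [lt_mem_nhds hs0, gt_mem_nhds (by linarith : ‖z - x‖ < R)] with s h1 h2
        exact hder s h1 h2) hder2
  have jφ := Jet.of_contDiff (x := z) hφ
  have hmx := (jφ.sub jW).localMax hloc
  have hgrad : gradient φ z = W1 ‖z - x‖ • ‖z - x‖⁻¹ • (z - x) := sub_eq_zero.1 hmx.1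
  have hnorm1 : ‖‖z - x‖⁻¹ • (z - x)‖ = 1 := by
    rw [norm_smul, norm_inv, norm_norm]; field_simp
  have hW1nn : 0 ≤ W1 ‖z - x‖ := by
    simp only [hW1]
    have a1 := Real.rpow_nonneg hs0.le (-(1 / (m - 1)))
    have a2 := Real.rpow_nonneg hRz.le (-(1 / (m - 1)))
    have : 0 ≤ A := by rw [hAdef]; positivity
    positivity
  have hHz := hH z (by rw [mem_ball, dist_eq_norm]; linarith)
  rw [jφ.ham, hgrad, norm_smul, hnorm1, mul_one, Real.norm_of_nonneg hW1nn] at hHz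
  have hl := hmx.2
  rw [hnorm1] at hl
  have hb := barrier_ineq hm N (M := M) (A := A) (by rw [hAdef]; linarith [abs_nonneg M])
    (by rw [hAdef]; linarith [le_abs_self M, (Nat.cast_nonneg N : (0:ℝ) ≤ N)]) hs0
    (by linarith : ‖z - x‖ < R) hR1 hε.le
  have e1 : W1 ‖z - x‖ * ((N - 1) / ‖z - x‖) = (N - 1) / ‖z - x‖ * W1 ‖z - x‖ := by ring
  rw [e1] at hl
  simp only [hW1] at hl hHz
  linarith

lemma smooth_holder {N : ℕ} {m : ℝ} (hm : 2 < m) {M : ℝ} {φ : Euc N → ℝ} (hφ : ContDiff ℝ 2 φ)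
    {x y : Euc N} {R : ℝ} (hR1 : R ≤ 1) (hH : ∀ z ∈ ball x R, Ham m φ z ≤ M)
    (hy : y ∈ ball x R) :
    φ y - φ x ≤ 2 * holdK N m M * ‖y - x‖ ^ ((m - 2) / (m - 1)) := by
  have hm1 : 0 < m - 1 := by linarith
  have hm2 : 0 < m - 2 := by linarith
  set α := (m - 2) / (m - 1) with hα
  have hα0 : 0 < α := by positivity
  have hα1 : α ≤ 1 := by rw [hα, div_le_one hm1]; linarith
  have hyR : ‖y - x‖ < R := by simpa [dist_eq_norm] using hy
  have hK0 : 0 < holdK N m M := holdK_pos N hm M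
  have hsub : R ^ α ≤ (R - ‖y - x‖) ^ α + ‖y - x‖ ^ α := by
    have := Real.rpow_add_le_add_rpow (p := α) (a := R - ‖y - x‖) (b := ‖y - x‖)
      (by linarith) (norm_nonneg _) hα0.le hα1
    simpa using this
  apply le_of_forall_pos_le_add
  intro δ hδ
  set L := Real.log R - Real.log (R - ‖y - x‖)
  have h := smooth_holder_eps hm hφ hR1 hH hy (ε := δ / (|L| + 1)) (by positivity)
  have h2 : δ / (|L| + 1) * L ≤ δ := by
    rw [div_mul_eq_mul_div, div_le_iff₀ (by positivity)]
    nlinarith [le_abs_self L]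
  have h3 : holdK N m M * (R ^ α - (R - ‖y - x‖) ^ α) ≤ holdK N m M * ‖y - x‖ ^ α := by
    gcongr; linarith
  linarith

lemma ssub_holder {N : ℕ} {m : ℝ} (hm : 2 < m) {M : ℝ} {Ω : Set (Euc N)} {g u : Euc N → ℝ}
    (hS : SSub Ω m g u) (hg : ∀ x ∈ Ω, g x ≤ M) {x y : Euc N} {R : ℝ} (hR1 : R ≤ 1)
    (hb : ball x R ⊆ Ω) (hy : y ∈ ball x R) :
    u y - u x ≤ 2 * holdK N m (M + 1) * ‖y - x‖ ^ ((m - 2) / (m - 1)) := by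
  apply le_of_forall_pos_le_add
  intro δ hδ
  have hyR : ‖y - x‖ < R := by simpa [dist_eq_norm] using hy
  set R' := (‖y - x‖ + R) / 2 with hR'
  have hR'R : R' < R := by rw [hR']; linarith
  have hsub : closedBall x R' ⊆ Ω := (closedBall_subset_ball hR'R).trans hb
  obtain ⟨φ, h1, h2⟩ := hS (closedBall x R') (isCompact_closedBall _ _) hsub (min (δ / 2) 1)
    (by positivity)
  have hx' : x ∈ closedBall x R' := mem_closedBall_self (by rw [hR']; linarith [norm_nonneg (y - x)])
  have hy' : y ∈ ball x R' := by rw [mem_ball, dist_eq_norm, hR']; linarith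
  have := smooth_holder hm h1 (M := M + 1) (R := R') (by linarith) (fun z hz => by
    have hz' := ball_subset_closedBall hz
    have := (h2 z hz').2
    linarith [hg z (hsub hz'), min_le_right (δ / 2) 1]) hy'
  have a1 := abs_le.1 (h2 x hx').1
  have a2 := abs_le.1 (h2 y (ball_subset_closedBall hy')).1
  have := min_le_left (δ / 2) 1
  linarith



lemma mem_closure_cases {N : ℕ} {Ω : Set (Euc N)} {x : Euc N} (hΩo : IsOpen Ω)
    (hx : x ∈ closure Ω) : x ∈ Ω ∨ x ∈ frontier Ω := by
  by_cases h : x ∈ Ω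
  · exact Or.inl h
  · right
    rw [hΩo.frontier_eq]
    exact ⟨hx, h⟩

lemma interior_cone {N : ℕ} {Ω : Set (Euc N)} (hΩo : IsOpen Ω) (h2 : HasC2Boundary Ω)
    {x0 : Euc N} (hx0 : x0 ∈ closure Ω) :
    ∃ r > (0:ℝ), ∃ ν : Euc N, ∃ θ > (0:ℝ), θ ≤ 1 ∧ ∀ x ∈ ball x0 r ∩ closure Ω, ∀ s : ℝ, 0 < s →
      s ≤ 1 → ball (x + s • ν) (s * θ) ⊆ Ω := by
  rcases mem_closure_cases hΩo hx0 with hx | hx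
  · obtain ⟨ε, hε, hb⟩ := Metric.isOpen_iff.1 hΩo x0 hx
    refine ⟨ε / 2, by positivity, 0, min (ε / 2) 1, by positivity, min_le_right _ _, ?_⟩
    rintro x ⟨hx1, -⟩ s hs hs1 z hz
    apply hb
    rw [smul_zero, add_zero, mem_ball] at hz
    rw [mem_ball] at hx1 ⊢
    have h1 : s * min (ε / 2) 1 ≤ 1 * (ε / 2) :=
      mul_le_mul hs1 (min_le_left _ _) (by positivity) (by norm_num)
    linarith [dist_triangle z x x0]
  · obtain ⟨ρ, hρ, hΩ, hfr, hg⟩ := h2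
    set p := gradient ρ x0 with hp
    have hp0 : p ≠ 0 := hg x0 hx
    have hpn : 0 < ‖p‖ := norm_pos_iff.2 hp0
    have hst : HasStrictFDerivAt ρ (fderiv ℝ ρ x0) x0 :=
      (hρ.contDiffAt).hasStrictFDerivAt (by norm_num)
    have hev := hst.isLittleO.def (show 0 < ‖p‖ / 4 by positivity)
    obtain ⟨r1, hr1, hball⟩ := Metric.eventually_nhds_iff_ball.1 hev
    have hkey : ∀ a ∈ ball x0 r1, ∀ b ∈ ball x0 r1,
        |ρ a - ρ b - inner ℝ p (a - b)| ≤ ‖p‖ / 4 * ‖a - b‖ := by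
      intro a ha b hb
      have := hball (a, b) (by rw [← ball_prod_same]; exact ⟨ha, hb⟩)
      rw [grad_apply, ← hp] at this
      exact this
    have hle : ∀ x ∈ closure Ω, ρ x ≤ 0 := by
      intro x hx
      rcases mem_closure_cases hΩo hx with h | h
      · rw [hΩ] at h; exact le_of_lt h
      · rw [hfr] at h; exact le_of_eq h
    refine ⟨r1 / 2, by positivity, -(r1 / (4 * ‖p‖)) • p, min (r1 / 8) 1, by positivity,
      min_le_right _ _, ?_⟩
    rintro x ⟨hx1, hxc⟩ s hs hs1 z hz
    rw [hΩ]
    change ρ z < 0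
    rw [mem_ball, dist_eq_norm] at hz
    set ν := -(r1 / (4 * ‖p‖)) • p with hν
    have hνn : ‖ν‖ = r1 / 4 := by
      rw [hν, norm_smul, norm_neg, Real.norm_of_nonneg (by positivity)]; field_simp
    set w := z - (x + s • ν) with hw
    have hwn : ‖w‖ < s * (r1 / 8) := hz.trans_le (by gcongr; exact min_le_left _ _)
    have hzx : z - x = s • ν + w := by rw [hw]; abel
    have hsν : ‖s • ν‖ = s * (r1 / 4) := by rw [norm_smul, Real.norm_of_nonneg hs.le, hνn]
    have hzxn : ‖z - x‖ ≤ s * (3 * r1 / 8) := by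
      rw [hzx]; linarith [norm_add_le (s • ν) w]
    have hxb : ‖x - x0‖ < r1 / 2 := by rwa [mem_ball, dist_eq_norm] at hx1
    have hzb : z ∈ ball x0 r1 := by
      rw [mem_ball, dist_eq_norm]
      have : z - x0 = (z - x) + (x - x0) := by abel
      rw [this]
      have := norm_add_le (z - x) (x - x0)
      nlinarith
    have hk := (abs_le.1 (hkey z hzb x (by rw [mem_ball, dist_eq_norm]; linarith))).2
    have hin : inner ℝ p (z - x) ≤ -(s * (r1 / 4) * ‖p‖) + ‖p‖ * (s * (r1 / 8)) := by
      rw [hzx, inner_add_right]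
      have e1 : inner ℝ p (s • ν) = -(s * (r1 / 4) * ‖p‖) := by
        rw [hν, inner_smul_right, inner_smul_right, real_inner_self_eq_norm_sq]; field_simp
      have e2 : inner ℝ p w ≤ ‖p‖ * ‖w‖ := real_inner_le_norm _ _
      have e3 : ‖p‖ * ‖w‖ ≤ ‖p‖ * (s * (r1 / 8)) := by gcongr
      linarith
    have hη : ‖p‖ / 4 * ‖z - x‖ ≤ ‖p‖ / 4 * (s * (3 * r1 / 8)) := by gcongr
    have h0 := hle x hxc
    have hpos : 0 < s * r1 * ‖p‖ := by positivity
    linarith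

lemma ssub_holder_two {N : ℕ} {m : ℝ} (hm : 2 < m) {M : ℝ} {Ω : Set (Euc N)} {g u : Euc N → ℝ}
    (hS : SSub Ω m g u) (hg : ∀ x ∈ Ω, g x ≤ M) {a b : Euc N} {R : ℝ} (hR1 : R ≤ 1)
    (hb : ball a R ⊆ Ω) (hab : ‖a - b‖ < R / 2) :
    |u a - u b| ≤ 2 * holdK N m (M + 1) * ‖a - b‖ ^ ((m - 2) / (m - 1)) := by
  have h0 := norm_nonneg (a - b)
  have h1 := ssub_holder hm hS hg hR1 hb (y := b) (by
    rw [mem_ball, dist_eq_norm, norm_sub_rev]; linarith)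
  have h2 := ssub_holder hm hS hg (x := b) (y := a) (R := R / 2) (by linarith) (by
    intro z hz
    apply hb
    rw [mem_ball] at hz ⊢
    have : dist b a < R / 2 := by rwa [dist_eq_norm, norm_sub_rev]
    linarith [dist_triangle z b a]) (by rw [mem_ball, dist_eq_norm]; exact hab)
  rw [norm_sub_rev] at h1
  rw [abs_le]; constructor <;> linarith

lemma ssub_cone_holder {N : ℕ} {m : ℝ} (hm : 2 < m) (M : ℝ) {Ω : Set (Euc N)} {x0 : Euc N}
    {r θ : ℝ} {ν : Euc N} (hθ : 0 < θ) (hθ1 : θ ≤ 1)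
    (hc : ∀ x ∈ ball x0 r ∩ closure Ω, ∀ s : ℝ, 0 < s →
      s ≤ 1 → ball (x + s • ν) (s * θ) ⊆ Ω) :
    ∃ C : ℝ, ∀ g u : Euc N → ℝ, SSub Ω m g u → (∀ x ∈ Ω, g x ≤ M) →
      ContinuousOn u (closure Ω) → ∀ x ∈ ball x0 r ∩ closure Ω, ∀ y ∈ ball x0 r ∩ closure Ω,
      ‖x - y‖ ≤ θ / 4 → |u x - u y| ≤ C * ‖x - y‖ ^ ((m - 2) / (m - 1)) := by
  have hm1 : 0 < m - 1 := by linarith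
  have hm2 : 0 < m - 2 := by linarith
  set α := (m - 2) / (m - 1) with hα
  have hα0 : 0 < α := by positivity
  set K := 2 * holdK N m (M + 1) with hK
  have hK0 : 0 < K := by have := holdK_pos N hm (M + 1); positivity
  -- ratio
  set δ := θ / (4 * (‖ν‖ + 1)) with hδ
  have hν := norm_nonneg ν
  have hδ0 : 0 < δ := by positivity
  have hδ1 : δ < 1 := by
    rw [hδ, div_lt_one (by positivity)]; linarith
  have hδν : δ * ‖ν‖ < θ / 2 := by
    rw [hδ, div_mul_eq_mul_div, div_lt_iff₀ (by positivity)]; nlinarith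
  set q := 1 - δ with hq
  have hq0 : 0 < q := by linarith
  have hq1 : q < 1 := by linarith
  set Q := q ^ α with hQ
  have hQ0 : 0 < Q := Real.rpow_pos_of_pos hq0 _
  have hQ1 : Q < 1 := Real.rpow_lt_one hq0.le hq1 hα0
  set κ := K * (δ * ‖ν‖) ^ α with hκ
  have hκ0 : 0 ≤ κ := by positivity
  set C1 := κ / (1 - Q) with hC1
  have hC1κ : C1 * (1 - Q) = κ := by rw [hC1]; exact div_mul_cancel₀ _ (by linarith : 0 < 1 - Q).ne'
  have hC10 : 0 ≤ C1 := div_nonneg hκ0 (by linarith)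
  refine ⟨2 * (C1 * (4 / θ) ^ α) + K, ?_⟩
  intro g u hS hg hu
  have step : ∀ x ∈ ball x0 r ∩ closure Ω, ∀ s : ℝ, 0 < s → s ≤ 1 →
      |u (x + s • ν) - u (x + (q * s) • ν)| ≤ κ * s ^ α := by
    intro x hx s hs hs1
    have e : (x + s • ν) - (x + (q * s) • ν) = (s * δ) • ν := by
      rw [add_sub_add_left_eq_sub, ← sub_smul]; congr 1; rw [hq]; ring
    have en : ‖(x + s • ν) - (x + (q * s) • ν)‖ = s * (δ * ‖ν‖) := by
      rw [e, norm_smul, Real.norm_of_nonneg (by positivity)]; ring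
    have := ssub_holder_two hm hS hg (a := x + s • ν) (b := x + (q * s) • ν) (R := s * θ)
      (by nlinarith) (hc x hx s hs hs1) (by rw [en]; nlinarith)
    rw [en, Real.mul_rpow hs.le (by positivity)] at this
    calc _ ≤ _ := this
      _ = κ * s ^ α := by rw [hκ, hK]; ring
  have chain : ∀ x ∈ ball x0 r ∩ closure Ω, ∀ s : ℝ, 0 < s → s ≤ 1 → ∀ k : ℕ,
      |u (x + s • ν) - u (x + (q ^ k * s) • ν)| ≤ C1 * s ^ α * (1 - Q ^ k) := by
    intro x hx s hs hs1 k
    induction k with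
    | zero => simp
    | succ k ih =>
      have hqk : 0 < q ^ k := by positivity
      have hqk1 : q ^ k ≤ 1 := pow_le_one₀ hq0.le hq1.le
      have h1 := step x hx (q ^ k * s) (by positivity) (by nlinarith)
      have e1 : (q ^ k * s) ^ α = Q ^ k * s ^ α := by
        rw [Real.mul_rpow hqk.le hs.le, hQ, ← Real.rpow_natCast, ← Real.rpow_natCast,
          ← Real.rpow_mul hq0.le, ← Real.rpow_mul hq0.le, mul_comm α]
      rw [e1, ← hC1κ, ← mul_assoc, ← pow_succ'] at h1
      have h2 := abs_sub_le (u (x + s • ν)) (u (x + (q ^ k * s) • ν)) (u (x + (q ^ (k+1) * s) • ν))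
      calc _ ≤ _ := h2
        _ ≤ _ := add_le_add ih h1
        _ = _ := by ring
  have lim : ∀ x ∈ ball x0 r ∩ closure Ω, ∀ s : ℝ, 0 < s → s ≤ 1 →
      |u (x + s • ν) - u x| ≤ C1 * s ^ α := by
    intro x hx s hs hs1
    have hpt : Tendsto (fun k : ℕ => x + (q ^ k * s) • ν) atTop (𝓝 x) := by
      have h1 : Tendsto (fun k : ℕ => q ^ k) atTop (𝓝 0) :=
        tendsto_pow_atTop_nhds_zero_of_lt_one hq0.le hq1
      have h2 := ((h1.mul_const s).smul_const ν).const_add x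
      simpa using h2
    have hpt' : Tendsto (fun k : ℕ => x + (q ^ k * s) • ν) atTop (𝓝[closure Ω] x) := by
      rw [tendsto_nhdsWithin_iff]
      refine ⟨hpt, Eventually.of_forall fun k => subset_closure ?_⟩
      have hqk : 0 < q ^ k := by positivity
      have hqk1 : q ^ k ≤ 1 := pow_le_one₀ hq0.le hq1.le
      exact hc x hx (q ^ k * s) (by positivity) (by nlinarith) (mem_ball_self (by positivity))
    have hlim := ((tendsto_const_nhds (x := u (x + s • ν))).sub ((hu x hx.2).tendsto.comp hpt')).abs
    refine le_of_tendsto hlim (Eventually.of_forall fun k => (chain x hx s hs hs1 k).trans ?_)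
    have : 0 < Q ^ k := by positivity
    have h3 : 0 ≤ C1 * s ^ α := by positivity
    nlinarith
  intro x hx y hy hxy
  rcases eq_or_ne x y with rfl | hne
  · simp [Real.zero_rpow hα0.ne']
  have hd : 0 < ‖x - y‖ := norm_pos_iff.2 (sub_ne_zero.2 hne)
  set s := 4 / θ * ‖x - y‖ with hs
  have hs0 : 0 < s := by positivity
  have hs1 : s ≤ 1 := by
    rw [hs, div_mul_eq_mul_div, div_le_one hθ]; linarith
  have hsθ : s * θ = 4 * ‖x - y‖ := by rw [hs]; field_simp
  have e : (x + s • ν) - (y + s • ν) = x - y := by abel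
  have h3 := ssub_holder_two hm hS hg (a := x + s • ν) (b := y + s • ν) (R := s * θ)
      (by nlinarith) (hc x hx s hs0 hs1) (by rw [e]; linarith)
  rw [e] at h3
  have h1 := lim x hx s hs0 hs1
  have h2 := lim y hy s hs0 hs1
  have es : s ^ α = (4 / θ) ^ α * ‖x - y‖ ^ α := by
    rw [hs, Real.mul_rpow (by positivity) hd.le]
  rw [es] at h1 h2
  rw [abs_le] at *
  constructor <;> nlinarith

/-- The class of subsolutions with right-hand side at most `M`, continuous on the closure. -/
def SubClass {N : ℕ} (Ω : Set (Euc N)) (m M : ℝ) (u : Euc N → ℝ) : Prop :=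
  ContinuousOn u (closure Ω) ∧ ∃ g : Euc N → ℝ, SSub Ω m g u ∧ ∀ x ∈ Ω, g x ≤ M

lemma local_equi {N : ℕ} {m : ℝ} (hm : 2 < m) (M : ℝ) {Ω : Set (Euc N)} (hΩo : IsOpen Ω)
    (hΩb : Bornology.IsBounded Ω) (h2 : HasC2Boundary Ω) :
    ∃ C > (0:ℝ), ∃ t > (0:ℝ), ∀ u, SubClass Ω m M u → ∀ x ∈ closure Ω, ∀ y ∈ closure Ω,
      ‖x - y‖ < t → |u x - u y| ≤ C * ‖x - y‖ ^ ((m - 2) / (m - 1)) := by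
  have hK : IsCompact (closure Ω) := hΩb.isCompact_closure
  suffices h : ∃ C > (0:ℝ), ∃ t > (0:ℝ), ∀ u, SubClass Ω m M u → ∀ x ∈ closure Ω,
      x ∈ closure Ω → ∀ y ∈ closure Ω,
      ‖x - y‖ < t → |u x - u y| ≤ C * ‖x - y‖ ^ ((m - 2) / (m - 1)) by
    obtain ⟨C, hC, t, ht, h⟩ := h
    exact ⟨C, hC, t, ht, fun u hu x hx => h u hu x hx hx⟩
  refine hK.induction_on (p := fun S => ∃ C > (0:ℝ), ∃ t > (0:ℝ), ∀ u, SubClass Ω m M u →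
    ∀ x ∈ S, x ∈ closure Ω → ∀ y ∈ closure Ω,
      ‖x - y‖ < t → |u x - u y| ≤ C * ‖x - y‖ ^ ((m - 2) / (m - 1))) ?_ ?_ ?_ ?_
  · exact ⟨1, one_pos, 1, one_pos, fun u _ x hx => absurd hx (notMem_empty x)⟩
  · rintro S T hST ⟨C, hC, t, ht, h⟩
    exact ⟨C, hC, t, ht, fun u hu x hx => h u hu x (hST hx)⟩
  · rintro S T ⟨C, hC, t, ht, h⟩ ⟨C', hC', t', ht', h'⟩
    refine ⟨max C C', lt_max_of_lt_left hC, min t t', lt_min ht ht', ?_⟩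
    intro u hu x hx hxc y hy hxy
    have hp : 0 ≤ ‖x - y‖ ^ ((m - 2) / (m - 1)) := by positivity
    rcases hx with hx | hx
    · exact (h u hu x hx hxc y hy (hxy.trans_le (min_le_left _ _))).trans
        (mul_le_mul_of_nonneg_right (le_max_left _ _) hp)
    · exact (h' u hu x hx hxc y hy (hxy.trans_le (min_le_right _ _))).trans
        (mul_le_mul_of_nonneg_right (le_max_right _ _) hp)
  · intro x0 hx0
    obtain ⟨r, hr, ν, θ, hθ, hθ1, hc⟩ := interior_cone hΩo h2 hx0
    obtain ⟨C, hC⟩ := ssub_cone_holder hm M hθ hθ1 hc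
    refine ⟨ball x0 (r / 2), mem_nhdsWithin_of_mem_nhds (ball_mem_nhds _ (by positivity)),
      |C| + 1, by positivity, min (r / 2) (θ / 4), by positivity, ?_⟩
    rintro u ⟨huc, g, hS, hg⟩ x hx hxc y hy hxy
    rw [mem_ball] at hx
    have hyx : dist y x < r / 2 := by
      rw [dist_comm, dist_eq_norm]; exact hxy.trans_le (min_le_left _ _)
    have := hC g u hS hg huc x ⟨by rw [mem_ball]; linarith, hxc⟩ y
      ⟨by rw [mem_ball]; linarith [dist_triangle y x x0], hy⟩ (hxy.le.trans (min_le_right _ _))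
    refine this.trans (mul_le_mul_of_nonneg_right ?_ (by positivity))
    linarith [le_abs_self C]

lemma global_holder {N : ℕ} {m : ℝ} (hm : 2 < m) (M : ℝ) {Ω : Set (Euc N)} (hΩo : IsOpen Ω)
    (hΩb : Bornology.IsBounded Ω) (hΩc : IsConnected Ω) (h2 : HasC2Boundary Ω) :
    ∃ C > (0:ℝ), ∀ u, SubClass Ω m M u → ∀ x ∈ closure Ω, ∀ y ∈ closure Ω,
      |u x - u y| ≤ C * ‖x - y‖ ^ ((m - 2) / (m - 1)) := by
  have hm1 : 0 < m - 1 := by linarith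
  have hm2 : 0 < m - 2 := by linarith
  have hα0 : 0 < (m - 2) / (m - 1) := by positivity
  have hK : IsCompact (closure Ω) := hΩb.isCompact_closure
  obtain ⟨C, hC, t, ht, h⟩ := local_equi hm M hΩo hΩb h2
  obtain ⟨x0, hx0⟩ := hΩc.closure.nonempty
  have hloc : ∀ x ∈ closure Ω, ∀ u, SubClass Ω m M u → ∀ y ∈ closure Ω ∩ ball x t,
      |u x - u y| ≤ C * t ^ ((m - 2) / (m - 1)) := by
    intro x hx u hu y hy
    have hxy : ‖x - y‖ < t := by
      have := hy.2; rwa [mem_ball, dist_comm, dist_eq_norm] at this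
    refine (h u hu x hx y hy.1 hxy).trans ?_
    gcongr
  have hpt : ∀ x ∈ closure Ω, ∃ B, ∀ u, SubClass Ω m M u → |u x - u x0| ≤ B := by
    intro x hx
    refine hΩc.closure.isPreconnected.induction₂
      (fun x y => ∃ B, ∀ u, SubClass Ω m M u → |u x - u y| ≤ B) ?_ ?_ ?_ hx hx0
    · intro x hx
      filter_upwards [inter_mem_nhdsWithin (closure Ω) (ball_mem_nhds x ht)] with y hy
      exact ⟨_, fun u hu => hloc x hx u hu y hy⟩
    · rintro x y z - - - ⟨B, hB⟩ ⟨B', hB'⟩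
      exact ⟨B + B', fun u hu => (abs_sub_le _ (u y) _).trans (add_le_add (hB u hu) (hB' u hu))⟩
    · rintro x y - - ⟨B, hB⟩
      exact ⟨B, fun u hu => by rw [abs_sub_comm]; exact hB u hu⟩
  obtain ⟨B, hB⟩ : ∃ B, ∀ u, SubClass Ω m M u → ∀ x ∈ closure Ω, |u x - u x0| ≤ B := by
    suffices hh : ∃ B, ∀ u, SubClass Ω m M u → ∀ x ∈ closure Ω, x ∈ closure Ω → |u x - u x0| ≤ B by
      obtain ⟨B, hB⟩ := hh
      exact ⟨B, fun u hu x hx => hB u hu x hx hx⟩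
    refine hK.induction_on (p := fun S => ∃ B, ∀ u, SubClass Ω m M u → ∀ x ∈ S, x ∈ closure Ω →
      |u x - u x0| ≤ B) ?_ ?_ ?_ ?_
    · exact ⟨0, fun u _ x hx => absurd hx (notMem_empty x)⟩
    · rintro S T hST ⟨B, hB⟩
      exact ⟨B, fun u hu x hx => hB u hu x (hST hx)⟩
    · rintro S T ⟨B, hB⟩ ⟨B', hB'⟩
      refine ⟨max B B', fun u hu x hx hxc => ?_⟩
      rcases hx with hx | hx
      · exact (hB u hu x hx hxc).trans (le_max_left _ _)
      · exact (hB' u hu x hx hxc).trans (le_max_right _ _)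
    · intro x hx
      obtain ⟨B, hB⟩ := hpt x hx
      refine ⟨ball x t, mem_nhdsWithin_of_mem_nhds (ball_mem_nhds _ ht),
        C * t ^ ((m - 2) / (m - 1)) + B, fun u hu y hy hyc => ?_⟩
      have h1 := hloc x hx u hu y ⟨hyc, hy⟩
      rw [abs_sub_comm] at h1
      exact (abs_sub_le _ (u x) _).trans (add_le_add h1 (hB u hu))
  set D := 2 * |B| / t ^ ((m - 2) / (m - 1)) with hD
  have htp : 0 < t ^ ((m - 2) / (m - 1)) := by positivity
  refine ⟨C + D, by positivity, fun u hu x hx y hy => ?_⟩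
  have hD0 : 0 ≤ D := by positivity
  have hp : 0 ≤ ‖x - y‖ ^ ((m - 2) / (m - 1)) := by positivity
  rcases lt_or_ge ‖x - y‖ t with hxy | hxy
  · refine (h u hu x hx y hy hxy).trans ?_
    nlinarith
  · have h1 := hB u hu x hx
    have h2 := hB u hu y hy
    rw [abs_sub_comm] at h2
    have h3 := (abs_sub_le (u x) (u x0) (u y)).trans (add_le_add h1 h2)
    have h4 : t ^ ((m - 2) / (m - 1)) ≤ ‖x - y‖ ^ ((m - 2) / (m - 1)) :=
      Real.rpow_le_rpow ht.le hxy hα0.le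
    have h5 : D * t ^ ((m - 2) / (m - 1)) = 2 * |B| := by rw [hD]; field_simp
    have h6 := le_abs_self B
    have h7 : D * t ^ ((m - 2) / (m - 1)) ≤ D * ‖x - y‖ ^ ((m - 2) / (m - 1)) := by gcongr
    nlinarith



/-- Continuous (on the closure) strong subsolutions at level `c`. -/
def Fam {N : ℕ} (Ω : Set (Euc N)) (m : ℝ) (f : Euc N → ℝ) (c : ℝ) (u : Euc N → ℝ) : Prop :=
  ContinuousOn u (closure Ω) ∧ SSub Ω m (fun x => f x + c) u

/-- State-constraint supersolution property. -/
def SCSuper {N : ℕ} (Ω : Set (Euc N)) (m : ℝ) (g u : Euc N → ℝ) : Prop :=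
  ∀ φ : Euc N → ℝ, ContDiff ℝ 2 φ → ∀ x ∈ closure Ω,
    IsLocalMinOn (u - φ) (closure Ω) x → g x ≤ Ham m φ x

lemma continuousOn_of_holder {N : ℕ} {s : Set (Euc N)} {u : Euc N → ℝ} {C α : ℝ} (hα : 0 < α)
    (h : ∀ x ∈ s, ∀ y ∈ s, |u x - u y| ≤ C * ‖x - y‖ ^ α) : ContinuousOn u s := by
  intro x hx
  rw [ContinuousWithinAt, tendsto_iff_dist_tendsto_zero]
  have h1 : Tendsto (fun y => C * ‖y - x‖ ^ α) (𝓝[s] x) (𝓝 0) := by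
    have hc : Continuous fun y : Euc N => C * ‖y - x‖ ^ α :=
      continuous_const.mul ((by fun_prop : Continuous fun y : Euc N => ‖y - x‖).rpow_const
        fun _ => Or.inr hα.le)
    have := (hc.tendsto x).mono_left (nhdsWithin_le_nhds (s := s))
    simpa [Real.zero_rpow hα.ne'] using this
  refine squeeze_zero' (Eventually.of_forall fun _ => dist_nonneg) ?_ h1
  filter_upwards [self_mem_nhdsWithin] with y hy
  rw [Real.dist_eq]; exact h y hy x hx

lemma sup_lemma {N : ℕ} {K : Set (Euc N)} (hK : IsCompact K) {C α B : ℝ} (hα : 0 < α)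
    {G : Set (Euc N → ℝ)} (hne : G.Nonempty)
    (hdir : ∀ w ∈ G, ∀ w' ∈ G, ∃ v ∈ G, ∀ x ∈ K, w x ≤ v x ∧ w' x ≤ v x)
    (hB : ∀ w ∈ G, ∀ x ∈ K, w x ≤ B)
    (hH : ∀ w ∈ G, ∀ x ∈ K, ∀ y ∈ K, |w x - w y| ≤ C * ‖x - y‖ ^ α) :
    ∃ U : Euc N → ℝ, (∀ w ∈ G, ∀ x ∈ K, w x ≤ U x) ∧
      (∀ x ∈ K, ∀ y ∈ K, |U x - U y| ≤ C * ‖x - y‖ ^ α) ∧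
      ∀ ε > (0:ℝ), ∃ w ∈ G, ∀ x ∈ K, U x - ε ≤ w x := by
  set U : Euc N → ℝ := fun x => sSup ((fun w => w x) '' G) with hU
  have hbdd : ∀ x ∈ K, BddAbove ((fun w : Euc N → ℝ => w x) '' G) := by
    rintro x hx
    refine ⟨B, ?_⟩
    rintro _ ⟨w, hw, rfl⟩
    exact hB w hw x hx
  have h1 : ∀ w ∈ G, ∀ x ∈ K, w x ≤ U x := fun w hw x hx =>
    le_csSup (hbdd x hx) (mem_image_of_mem _ hw)
  have h2' : ∀ x ∈ K, ∀ y ∈ K, U x - U y ≤ C * ‖x - y‖ ^ α := by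
    intro x hx y hy
    have : U x ≤ U y + C * ‖x - y‖ ^ α := by
      apply csSup_le (hne.image _)
      rintro _ ⟨w, hw, rfl⟩
      have a := (abs_le.1 (hH w hw x hx y hy)).2
      have b := h1 w hw y hy
      simp only
      linarith
    linarith
  have h2 : ∀ x ∈ K, ∀ y ∈ K, |U x - U y| ≤ C * ‖x - y‖ ^ α := by
    intro x hx y hy
    rw [abs_le]
    have a := h2' x hx y hy
    have b := h2' y hy x hx
    rw [norm_sub_rev] at b
    constructor <;> linarith
  refine ⟨U, h1, h2, fun ε hε => ?_⟩
  suffices hh : ∃ w ∈ G, ∀ x ∈ K, x ∈ K → U x - ε ≤ w x by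
    obtain ⟨w, hw, h⟩ := hh
    exact ⟨w, hw, fun x hx => h x hx hx⟩
  refine hK.induction_on (p := fun S => ∃ w ∈ G, ∀ x ∈ S, x ∈ K → U x - ε ≤ w x) ?_ ?_ ?_ ?_
  · obtain ⟨w, hw⟩ := hne
    exact ⟨w, hw, fun x hx => absurd hx (notMem_empty x)⟩
  · rintro S T hST ⟨w, hw, h⟩
    exact ⟨w, hw, fun x hx => h x (hST hx)⟩
  · rintro S T ⟨w, hw, h⟩ ⟨w', hw', h'⟩
    obtain ⟨v, hv, hvv⟩ := hdir w hw w' hw'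
    refine ⟨v, hv, fun x hx hxK => ?_⟩
    rcases hx with hx | hx
    · exact (h x hx hxK).trans (hvv x hxK).1
    · exact (h' x hx hxK).trans (hvv x hxK).2
  · intro x hx
    obtain ⟨_, ⟨w, hw, rfl⟩, hlt⟩ := exists_lt_of_lt_csSup (hne.image (fun w => w x))
      (show U x - ε / 3 < sSup ((fun w => w x) '' G) by simp only [hU]; linarith)
    have c1 := continuousOn_of_holder hα h2 x hx
    have c2 := continuousOn_of_holder hα (hH w hw) x hx
    have c3 : ContinuousWithinAt (fun y => U y - w y) K x := c1.sub c2
    have hlt' : U x - w x < ε := by simp only at hlt; linarith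
    have := c3.tendsto.eventually_lt_const hlt'
    refine ⟨{y | U y - w y < ε}, this, w, hw, fun y hy _ => ?_⟩
    have : U y - w y < ε := hy
    linarith

section
variable {N : ℕ} {Ω : Set (Euc N)} {m : ℝ} {f : Euc N → ℝ}

lemma Fam.mono {c c' : ℝ} {u : Euc N → ℝ} (h : Fam Ω m f c u) (hc : c ≤ c') : Fam Ω m f c' u :=
  ⟨h.1, h.2.mono fun x _ => by linarith⟩

lemma Fam.add_const {c : ℝ} {u : Euc N → ℝ} (h : Fam Ω m f c u) (k : ℝ) :
    Fam Ω m f c (fun x => u x + k) :=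
  ⟨h.1.add continuousOn_const, h.2.add_const k⟩

lemma fam_holder (hm : 2 < m) (hΩo : IsOpen Ω)
    (hΩb : Bornology.IsBounded Ω) (hΩc : IsConnected Ω) (h2 : HasC2Boundary Ω)
    (hf : ContinuousOn f (closure Ω)) (c1 : ℝ) :
    ∃ C > (0:ℝ), ∀ c ≤ c1, ∀ u, Fam Ω m f c u → ∀ x ∈ closure Ω, ∀ y ∈ closure Ω,
      |u x - u y| ≤ C * ‖x - y‖ ^ ((m - 2) / (m - 1)) := by
  obtain ⟨F, hF⟩ := hΩb.isCompact_closure.bddAbove_image hf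
  obtain ⟨C, hC, h⟩ := global_holder hm (F + c1) hΩo hΩb hΩc h2
  refine ⟨C, hC, fun c hc u hu => h u ⟨hu.1, _, hu.2, fun x hx => ?_⟩⟩
  have := hF (mem_image_of_mem f (subset_closure hx))
  linarith

lemma holder_osc (hΩb : Bornology.IsBounded Ω) {C α : ℝ} (hC : 0 < C) (hα : 0 < α) :
    ∃ B : ℝ, ∀ u : Euc N → ℝ, (∀ x ∈ closure Ω, ∀ y ∈ closure Ω, |u x - u y| ≤ C * ‖x - y‖ ^ α) →
      ∀ x ∈ closure Ω, ∀ y ∈ closure Ω, |u x - u y| ≤ B := by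
  refine ⟨C * (diam (closure Ω)) ^ α, fun u hu x hx y hy => (hu x hx y hy).trans ?_⟩
  gcongr
  rw [← dist_eq_norm]
  exact dist_le_diam_of_mem hΩb.closure hx hy

lemma fam_max (hm : 2 < m) (hΩo : IsOpen Ω)
    (hΩb : Bornology.IsBounded Ω) (hΩc : IsConnected Ω) (h2 : HasC2Boundary Ω)
    (hf : ContinuousOn f (closure Ω)) (c : ℝ) {x0 : Euc N} (hx0 : x0 ∈ closure Ω)
    (hne : ∃ u, Fam Ω m f c u) :
    ∃ U, Fam Ω m f c U ∧ U x0 = 0 ∧ ∀ w, Fam Ω m f c w → w x0 = 0 → ∀ x ∈ closure Ω, w x ≤ U x := by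
  have hm1 : 0 < m - 1 := by linarith
  have hm2 : 0 < m - 2 := by linarith
  have hα0 : 0 < (m - 2) / (m - 1) := by positivity
  obtain ⟨C, hC, hH⟩ := fam_holder hm hΩo hΩb hΩc h2 hf c
  obtain ⟨B, hB⟩ := holder_osc hΩb hC hα0
  obtain ⟨u, hu⟩ := hne
  obtain ⟨U, hU1, hU2, hU3⟩ := sup_lemma hΩb.isCompact_closure (C := C) (B := B) hα0
    (G := {w | Fam Ω m f c w ∧ w x0 = 0})
    ⟨fun x => u x + (-u x0), hu.add_const _, by simp⟩
    (by
      rintro w ⟨hw, hw0⟩ w' ⟨hw', hw0'⟩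
      refine ⟨fun x => max (w x) (w' x), ⟨⟨hw.1.sup hw'.1, hw.2.max (by linarith) hw'.2⟩, ?_⟩,
        fun x _ => ⟨le_max_left _ _, le_max_right _ _⟩⟩
      simp [hw0, hw0'])
    (by
      rintro w ⟨hw, hw0⟩ x hx
      have := (abs_le.1 (hB w (hH c le_rfl w hw) x hx x0 hx0)).2
      linarith)
    (by
      rintro w ⟨hw, hw0⟩
      exact hH c le_rfl w hw)
  refine ⟨U, ⟨continuousOn_of_holder hα0 hU2, ?_⟩, ?_, fun w hw hw0 => hU1 w ⟨hw, hw0⟩⟩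
  · apply SSub.of_approx
    intro ε hε
    obtain ⟨w, hw, hwU⟩ := hU3 ε hε
    refine ⟨w, hw.1.2.mono fun x _ => by linarith, fun x hx => ?_⟩
    have a := hU1 w hw x (subset_closure hx)
    have b := hwU x (subset_closure hx)
    rw [abs_le]; constructor <;> linarith
  · apply le_antisymm
    · apply le_of_forall_pos_le_add
      intro ε hε
      obtain ⟨w, hw, hwU⟩ := hU3 ε hε
      have := hwU x0 hx0
      rw [hw.2] at this
      linarith
    · obtain ⟨w, hw, hwU⟩ := hU3 1 one_pos
      have := hU1 w hw x0 hx0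
      rw [hw.2] at this
      linarith

lemma fam_bddBelow (hm : 2 < m) (hΩo : IsOpen Ω)
    (hΩb : Bornology.IsBounded Ω) (hΩc : IsConnected Ω) (h2 : HasC2Boundary Ω)
    (hf : ContinuousOn f (closure Ω)) :
    BddBelow {c | ∃ u, Fam Ω m f c u} := by
  have hm1 : 0 < m - 1 := by linarith
  have hm2 : 0 < m - 2 := by linarith
  have hα0 : 0 < (m - 2) / (m - 1) := by positivity
  obtain ⟨C, hC, hH⟩ := fam_holder hm hΩo hΩb hΩc h2 hf 0
  obtain ⟨B, hB⟩ := holder_osc hΩb hC hα0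
  obtain ⟨F, hF⟩ := hΩb.isCompact_closure.bddAbove_image hf
  obtain ⟨x1, hx1⟩ := hΩc.nonempty
  obtain ⟨R, hR, hball⟩ := Metric.nhds_basis_closedBall.mem_iff.1 (hΩo.mem_nhds hx1)
  set A := (|B| + 3) / R ^ 2 with hA
  have hA0 : 0 < A := by positivity
  have hAR : A * R ^ 2 = |B| + 3 := by rw [hA]; field_simp
  refine ⟨min 0 (-(2 * N * A) - F - 1), ?_⟩
  rintro c ⟨u, hu⟩
  rcases le_total 0 c with h0 | h0
  · exact (min_le_left _ _).trans h0
  refine (min_le_right _ _).trans ?_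
  obtain ⟨φ, hφ, hφu⟩ := hu.2 (closedBall x1 R) (isCompact_closedBall _ _) hball 1 one_pos
  have hcont : Continuous fun x => φ x - A * ‖x - x1‖ ^ 2 := by
    have := hφ.continuous
    fun_prop
  have hx1b : x1 ∈ closedBall x1 R := mem_closedBall_self hR.le
  obtain ⟨z, hz, hzmax⟩ := (isCompact_closedBall x1 R).exists_isMaxOn ⟨x1, hx1b⟩ hcont.continuousOn
  have hzlt : ‖z - x1‖ < R := by
    have hle : ‖z - x1‖ ≤ R := by simpa [dist_eq_norm] using hz
    refine lt_of_le_of_ne hle fun he => ?_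
    have h1 := hzmax hx1b
    simp only [mem_ofPred_eq, sub_self, norm_zero, he, hAR] at h1
    have a1 := abs_le.1 (hφu z hz).1
    have a2 := abs_le.1 (hφu x1 hx1b).1
    have a3 := abs_le.1 (hB u (hH c h0 u hu) z (subset_closure (hball hz)) x1 (subset_closure hx1))
    have := le_abs_self B
    norm_num at h1
    linarith
  have hloc : IsLocalMax (fun w => φ w - A * ‖w - x1‖ ^ 2) z :=
    hzmax.isLocalMax (mem_of_superset (isOpen_ball.mem_nhds (show z ∈ ball x1 R by
        rw [mem_ball, dist_eq_norm]; exact hzlt)) ball_subset_closedBall)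
  have jφ := Jet.of_contDiff (x := z) hφ
  have := ((jφ.sub ((Jet.normSq x1 z).const_mul A)).localMax hloc).2
  have h3 := (hφu z hz).2
  rw [jφ.ham] at h3
  have h4 := hF (mem_image_of_mem f (subset_closure (hball hz)))
  have h5 : 0 ≤ ‖gradient φ z‖ ^ m := by positivity
  linarith

lemma fam_zero (hm : 2 < m) (hΩb : Bornology.IsBounded Ω)
    (hf : ContinuousOn f (closure Ω)) : ∃ c, Fam Ω m f c (fun _ => 0) := by
  obtain ⟨F, hF⟩ := hΩb.isCompact_closure.bddBelow_image hf
  refine ⟨-F, continuousOn_const, fun K _ hK ε hε => ⟨fun _ => 0, contDiff_const, fun x hx => ?_⟩⟩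
  rw [(Jet.const 0 x).ham]
  have := hF (mem_image_of_mem f (subset_closure (hK hx)))
  simp only [norm_zero, Real.zero_rpow (by linarith : m ≠ 0), sub_self, abs_zero]
  constructor <;> linarith

lemma fam_cstar (hm : 2 < m) (hΩo : IsOpen Ω)
    (hΩb : Bornology.IsBounded Ω) (hΩc : IsConnected Ω) (h2 : HasC2Boundary Ω)
    (hf : ContinuousOn f (closure Ω)) :
    ∃ c, (∃ u, Fam Ω m f c u) ∧ ∀ c' w, Fam Ω m f c' w → c ≤ c' := by
  have hm1 : 0 < m - 1 := by linarith
  have hm2 : 0 < m - 2 := by linarith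
  have hα0 : 0 < (m - 2) / (m - 1) := by positivity
  set S := {c | ∃ u, Fam Ω m f c u} with hS
  have hbdd : BddBelow S := fam_bddBelow hm hΩo hΩb hΩc h2 hf
  have hSne : S.Nonempty := by
    obtain ⟨c, hc⟩ := fam_zero (m := m) (f := f) hm hΩb hf
    exact ⟨c, _, hc⟩
  set cs := sInf S with hcs
  refine ⟨cs, ?_, fun c' w hw => csInf_le hbdd ⟨w, hw⟩⟩
  have hex : ∀ c, cs < c → ∃ u, Fam Ω m f c u := by
    intro c hc
    obtain ⟨c', ⟨u, hu⟩, hlt⟩ := exists_lt_of_csInf_lt hSne hc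
    exact ⟨u, hu.mono hlt.le⟩
  obtain ⟨x0, hx0⟩ := hΩc.closure.nonempty
  have hmax := fun c (hc : cs < c) => fam_max hm hΩo hΩb hΩc h2 hf c hx0 (hex c hc)
  choose! U hU1 hU2 hU3 using hmax
  obtain ⟨C, hC, hH⟩ := fam_holder hm hΩo hΩb hΩc h2 hf (cs + 1)
  obtain ⟨B, hB⟩ := holder_osc hΩb hC hα0
  have hmono : ∀ c c', cs < c → c ≤ c' → ∀ x ∈ closure Ω, U c x ≤ U c' x := by
    intro c c' hc hcc x hx
    exact hU3 c' (hc.trans_le hcc) (U c) ((hU1 c hc).mono hcc) (hU2 c hc) x hx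
  obtain ⟨W, hW1, hW2, hW3⟩ := sup_lemma hΩb.isCompact_closure (C := C) (B := B) hα0
    (G := {w | ∃ c, cs < c ∧ c ≤ cs + 1 ∧ w = fun x => - U c x})
    ⟨_, cs + 1, by linarith, le_rfl, rfl⟩
    (by
      rintro _ ⟨c, hc, hc1, rfl⟩ _ ⟨c', hc', hc1', rfl⟩
      refine ⟨_, ⟨min c c', lt_min hc hc', (min_le_left _ _).trans hc1, rfl⟩, fun x hx => ?_⟩
      have a := hmono (min c c') c (lt_min hc hc') (min_le_left _ _) x hx
      have b := hmono (min c c') c' (lt_min hc hc') (min_le_right _ _) x hx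
      exact ⟨neg_le_neg a, neg_le_neg b⟩)
    (by
      rintro _ ⟨c, hc, hc1, rfl⟩ x hx
      have := (abs_le.1 (hB (U c) (hH c hc1 _ (hU1 c hc)) x hx x0 hx0)).1
      have e := hU2 c hc
      simp only
      linarith)
    (by
      rintro _ ⟨c, hc, hc1, rfl⟩ x hx y hy
      have := hH c hc1 _ (hU1 c hc) x hx y hy
      rw [abs_sub_comm] at this
      simpa [neg_add_eq_sub] using this)
  refine ⟨fun x => - W x, (continuousOn_of_holder hα0 hW2).neg, ?_⟩
  apply SSub.of_approx
  intro ε hε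
  obtain ⟨_, ⟨c, hc, hc1, rfl⟩, hw⟩ := hW3 ε hε
  have hc' : cs < min c (cs + ε) := lt_min hc (by linarith)
  refine ⟨U (min c (cs + ε)), (hU1 _ hc').2.mono fun x _ => ?_, fun x hx => ?_⟩
  · linarith [min_le_right c (cs + ε)]
  · have a := hw x (subset_closure hx)
    have b := hmono _ c hc' (min_le_left _ _) x (subset_closure hx)
    have d := hW1 _ ⟨_, hc', (min_le_left _ _).trans hc1, rfl⟩ x (subset_closure hx)
    simp only at a d
    rw [abs_le]; constructor <;> linarith

theorem exists_solution (hm : 2 < m) (hΩo : IsOpen Ω)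
    (hΩb : Bornology.IsBounded Ω) (hΩc : IsConnected Ω) (h2 : HasC2Boundary Ω)
    (hf : ContinuousOn f (closure Ω)) :
    ∃ c u, Fam Ω m f c u ∧ SCSuper Ω m (fun x => f x + c) u ∧
      ∀ c' w, Fam Ω m f c' w → c ≤ c' := by
  obtain ⟨c, hne, hmin⟩ := fam_cstar hm hΩo hΩb hΩc h2 hf
  by_contra hcon
  have hno : ∀ u, Fam Ω m f c u → ¬ SCSuper Ω m (fun x => f x + c) u :=
    fun u hu hs => hcon ⟨c, u, hu, hs, hmin⟩
  have hgc : ContinuousOn (fun x => f x + c) (closure Ω) := hf.add continuousOn_const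
  have hm1 : 1 ≤ m := by linarith
  suffices hh : ∃ w, ContinuousOn w (closure Ω) ∧ ∃ η > (0:ℝ),
      SSub Ω m (fun x => f x + c - (closure Ω).indicator (fun _ => η) x) w by
    obtain ⟨w, hw, η, hη, hS⟩ := hh
    have := hmin (c - η) w ⟨hw, hS.mono fun x hx => by
      rw [indicator_of_mem (subset_closure hx)]; linarith⟩
    linarith
  refine hΩb.isCompact_closure.induction_on (p := fun S => ∃ w, ContinuousOn w (closure Ω) ∧
    ∃ η > (0:ℝ), SSub Ω m (fun x => f x + c - S.indicator (fun _ => η) x) w) ?_ ?_ ?_ ?_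
  · obtain ⟨u, hu⟩ := hne
    exact ⟨u, hu.1, 1, one_pos, hu.2.mono fun x _ => by simp⟩
  · rintro S T hST ⟨w, hw, η, hη, h⟩
    refine ⟨w, hw, η, hη, h.mono fun x _ => ?_⟩
    have := indicator_le_indicator_of_subset hST (fun _ => hη.le) x (f := fun _ => η)
    linarith
  · rintro S T ⟨w, hw, η, hη, h⟩ ⟨w', hw', η', hη', h'⟩
    refine ⟨_, (hw.add hw').div_const 2, min η η' / 2, by positivity,
      (h.avg hm1 h').mono fun x _ => ?_⟩
    have a1 := min_le_left η η'
    have a2 := min_le_right η η'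
    by_cases h1 : x ∈ S <;> by_cases h2 : x ∈ T <;> simp [indicator, h1, h2] <;> linarith
  · intro x0 hx0
    obtain ⟨U, hU, hU0, hUmax⟩ := fam_max hm hΩo hΩb hΩc h2 hf c hx0 hne
    have hns := hno U hU
    unfold SCSuper at hns
    push Not at hns
    obtain ⟨φ, hφ, y, hy, hloc, hlt⟩ := hns
    by_cases hyx : y = x0
    · subst hyx
      obtain ⟨w, hw, ⟨η, hη, r', hr', -, hS⟩, -⟩ := ssub_bump hm1 hU.1 hU.2 hgc hy hφ hloc hlt one_pos
      exact ⟨ball y r', mem_nhdsWithin_of_mem_nhds (ball_mem_nhds _ hr'), w, hw, η, hη, hS⟩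
    · exfalso
      obtain ⟨w, hw, ⟨η, hη, r', hr', hS, -⟩, hge, heq, hgt⟩ := ssub_bump hm1 hU.1 hU.2 hgc hy hφ hloc
        hlt (dist_pos.2 (Ne.symm hyx) : 0 < dist x0 y)
      have := hUmax w ⟨hw, hS⟩ (by rw [heq x0 hx0 le_rfl, hU0]) y hy
      linarith
end



section
variable {N : ℕ} {Ω : Set (Euc N)} {m : ℝ}

lemma ham_le_of_localMax {φ ψ : Euc N → ℝ} {x p q : Euc N} {l k : ℝ} (hφ : Jet φ x p l)
    (hψ : Jet ψ x q k) (h : IsLocalMax (fun y => φ y - ψ y) x) : Ham m ψ x ≤ Ham m φ x := by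
  have := (hφ.sub hψ).localMax h
  rw [hφ.ham, hψ.ham, sub_eq_zero.1 this.1]
  linarith [this.2]

lemma SCSuper.jet {g u χ : Euc N → ℝ} {x p : Euc N} {l : ℝ} (h : SCSuper Ω m g u)
    (hx : x ∈ closure Ω) (j : Jet χ x p l)
    (hmin : IsLocalMinOn (fun y => u y - χ y) (closure Ω) x) : g x ≤ -l + ‖p‖ ^ m := by
  obtain ⟨ψ, hψ, he⟩ := exists_global_C2 j.1
  have j' : Jet ψ x p l := j.congr he
  rw [← j'.ham m]
  apply h ψ hψ x hx
  have hex := he.self_of_nhds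
  filter_upwards [hmin, mem_nhdsWithin_of_mem_nhds he] with y h1 h2
  have h2' : ψ y = χ y := h2
  simp only [Pi.sub_apply, h2', hex]
  exact h1

lemma SSub.visc_sub {g u : Euc N → ℝ} (hm : 0 ≤ m) (hΩo : IsOpen Ω) (hS : SSub Ω m g u)
    (hg : ContinuousOn g Ω) {φ : Euc N → ℝ} (hφ : ContDiff ℝ 2 φ) {x0 : Euc N} (hx0 : x0 ∈ Ω)
    (hmax : IsLocalMaxOn (u - φ) Ω x0) : Ham m φ x0 ≤ g x0 := by
  by_contra hcon
  push Not at hcon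
  set e := Ham m φ x0 - g x0 with he
  have he0 : 0 < e := by linarith
  set η := e / (4 * (N + 1)) with hη
  have hη0 : 0 < η := by positivity
  have hηN : 2 * N * η ≤ e / 2 := by
    rw [hη]; rw [mul_div_assoc', div_le_div_iff₀ (by positivity) (by norm_num)]
    nlinarith
  set ψ : Euc N → ℝ := fun x => φ x + η * ‖x - x0‖ ^ 2 with hψdef
  have hψ : ContDiff ℝ 2 ψ := by
    apply hφ.add (contDiff_const.mul _)
    exact (contDiff_id.sub contDiff_const).norm_sq ℝ
  have jψ : Jet ψ x0 _ _ := (Jet.of_contDiff (x := x0) hφ).add ((Jet.normSq x0 x0).const_mul η)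
  have hH0 : g x0 + e / 3 < Ham m ψ x0 := by
    rw [jψ.ham]
    simp only [sub_self, smul_zero, add_zero]
    have : Ham m φ x0 = -lapl φ x0 + ‖gradient φ x0‖ ^ m := rfl
    linarith
  have hgc : ContinuousAt g x0 := hg.continuousAt (hΩo.mem_nhds hx0)
  have hev : ∀ᶠ x in 𝓝 x0, g x + e / 3 < Ham m ψ x :=
    (hgc.add continuousAt_const).eventually_lt (continuous_ham hm hψ).continuousAt hH0
  have hev2 := hmax.isLocalMax (hΩo.mem_nhds hx0)
  obtain ⟨r, hr, hball⟩ := Metric.nhds_basis_closedBall.mem_iff.1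
    (inter_mem (inter_mem hev hev2) (hΩo.mem_nhds hx0))
  set ε := min (e / 3) (η * r ^ 2 / 4) with hε
  have hε0 : 0 < ε := by positivity
  obtain ⟨θ, hθ, hθu⟩ := hS (closedBall x0 r) (isCompact_closedBall _ _) (fun x hx => (hball hx).2) ε hε0
  have hx0b : x0 ∈ closedBall x0 r := mem_closedBall_self hr.le
  obtain ⟨z, hz, hzmax⟩ := (isCompact_closedBall x0 r).exists_isMaxOn ⟨x0, hx0b⟩
    (hθ.continuous.sub hψ.continuous).continuousOn
  have hzlt : ‖z - x0‖ < r := by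
    have hle : ‖z - x0‖ ≤ r := by simpa [dist_eq_norm] using hz
    refine lt_of_le_of_ne hle fun heq => ?_
    have h1 := hzmax hx0b
    simp only [mem_ofPred_eq, Pi.sub_apply, hψdef, sub_self, norm_zero, heq] at h1
    have a1 := abs_le.1 (hθu z hz).1
    have a2 := abs_le.1 (hθu x0 hx0b).1
    have a3 : (u - φ) z ≤ (u - φ) x0 := (hball hz).1.2
    simp only [Pi.sub_apply] at a3
    have a4 := min_le_right (e / 3) (η * r ^ 2 / 4)
    have a5 : 0 < η * r ^ 2 := by positivity
    norm_num at h1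
    linarith
  have hloc : IsLocalMax (fun w => θ w - ψ w) z :=
    hzmax.isLocalMax (mem_of_superset (isOpen_ball.mem_nhds (show z ∈ ball x0 r by
        rw [mem_ball, dist_eq_norm]; exact hzlt)) ball_subset_closedBall)
  have h1 := ham_le_of_localMax (m := m) (Jet.of_contDiff hθ) (Jet.of_contDiff hψ) hloc
  have h2 : g z + e / 3 < Ham m ψ z := (hball hz).1.1
  have h3 := (hθu z hz).2
  linarith [min_le_left (e / 3) (η * r ^ 2 / 4)]

lemma rpow_sub_le {a b : ℝ} (hm : 1 ≤ m) (hb : 0 ≤ b) (ha : 0 < a) :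
    a ^ m - b ^ m ≤ m * a ^ (m - 1) * (a - b) := by
  have h := one_add_mul_self_le_rpow_one_add (s := b / a - 1) (p := m)
    (by have : 0 ≤ b / a := by positivity
        linarith) hm
  rw [add_sub_cancel, Real.div_rpow hb ha.le] at h
  have ham : 0 < a ^ m := by positivity
  rw [le_div_iff₀ ham] at h
  have e : a ^ m = a ^ (m - 1) * a := by
    rw [← Real.rpow_add_one ha.ne']; congr 1; ring
  have e2 : (1 + m * (b / a - 1)) * a ^ m = a ^ m + m * a ^ (m - 1) * (b - a) := by
    rw [add_mul, one_mul, e]; field_simp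
  linarith

set_option maxHeartbeats 1000000 in
lemma lip_core (hm : 2 < m) {g u : Euc N → ℝ} {M C r L A β : ℝ} {y1 : Euc N}
    (hS : SSub Ω m g u) (hu : ContinuousOn u (closure Ω))
    (hsup : SCSuper Ω m g u) (hg : ∀ x ∈ Ω, |g x| ≤ M) (hC : 0 < C)
    (hH : ∀ x ∈ Ω, ∀ y ∈ Ω, |u x - u y| ≤ C * ‖x - y‖ ^ ((m - 2) / (m - 1)))
    (hr : 0 < r) (hr1 : r ≤ 1) (hball : closedBall y1 (2 * r) ⊆ Ω) (hβ : β = 1 / (2 * (m - 1)))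
    (hA0 : 0 < A) (hA : C < A * r ^ 2) (hL1 : 1 ≤ L) (hL2 : 2 * C < L * r) (hL3 : 2 * A * r ≤ L)
    (hL4 : 2 * M + 1 + 2 * N * A + m * (2 * L) ^ (m - 1) * (2 * A * r) <
      L * β * (L / (2 * C)) ^ ((m - 1) * (1 - β)))
    {x1 : Euc N} (hx1 : ‖x1 - y1‖ ≤ r) : u x1 - u y1 ≤ L * ‖x1 - y1‖ := by
  have hm1 : 0 < m - 1 := by linarith
  have hm2 : 0 < m - 2 := by linarith
  set α := (m - 2) / (m - 1) with hα
  have hα0 : 0 < α := by positivity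
  have hα1 : (1 - α) * (m - 1) = 1 := by rw [hα]; field_simp; ring
  have hβ0 : 0 < β := by rw [hβ]; positivity
  have hβ1 : β < 1 := by rw [hβ, div_lt_one (by positivity)]; linarith
  have hL0 : 0 < L := by linarith
  set ψ : ℝ → ℝ := fun t => t - t ^ (1 + β) / 4 with hψ
  set ψ1 : ℝ → ℝ := fun t => 1 - (1 + β) * t ^ β / 4 with hψ1
  have hψle : ∀ t, 0 ≤ t → ψ t ≤ t := by
    intro t ht
    have : 0 ≤ t ^ (1 + β) := by positivity
    simp only [hψ]; linarith
  have hψge : ∀ t, 0 ≤ t → t ≤ 1 → t / 2 ≤ ψ t := by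
    intro t ht ht1
    have : t ^ (1 + β) ≤ t ^ (1:ℝ) := by
      rcases ht.eq_or_lt with h | h
      · rw [← h, Real.zero_rpow (by linarith), Real.zero_rpow one_ne_zero]
      · exact Real.rpow_le_rpow_of_exponent_ge h ht1 (by linarith)
    rw [Real.rpow_one] at this
    simp only [hψ]; linarith
  by_contra hcon
  push Not at hcon
  set σ := (u x1 - u y1 - L * ‖x1 - y1‖) / 2 with hσ
  have hσ0 : 0 < σ := by linarith
  set ε := min (σ / 2) 1 with hε
  have hε0 : 0 < ε := by positivity
  have hε1 : ε ≤ σ / 2 := min_le_left _ _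
  have hε2 : ε ≤ 1 := min_le_right _ _
  obtain ⟨φ, hφ, hφu⟩ := hS (closedBall y1 (2 * r)) (isCompact_closedBall _ _) hball ε hε0
  set Φ : Euc N × Euc N → ℝ := fun q => φ q.1 - u q.2 - L * ψ ‖q.1 - q.2‖ - A * ‖q.2 - y1‖ ^ 2
    with hΦ
  set Kc : Set (Euc N × Euc N) := {q | ‖q.1 - q.2‖ ≤ r ∧ ‖q.2 - y1‖ ≤ r} with hKc
  have hKsub : ∀ q ∈ Kc, q.1 ∈ closedBall y1 (2 * r) ∧ q.2 ∈ closedBall y1 (2 * r) := by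
    rintro q ⟨h1, h2⟩
    rw [mem_closedBall, mem_closedBall, dist_eq_norm, dist_eq_norm]
    have := norm_add_le (q.1 - q.2) (q.2 - y1)
    rw [sub_add_sub_cancel] at this
    constructor <;> linarith
  have hKcomp : IsCompact Kc := by
    apply ((isCompact_closedBall y1 (2 * r)).prod (isCompact_closedBall y1 (2 * r))).of_isClosed_subset
    · have c1 : Continuous fun q : Euc N × Euc N => ‖q.1 - q.2‖ := by fun_prop
      have c2 : Continuous fun q : Euc N × Euc N => ‖q.2 - y1‖ := by fun_prop
      exact (isClosed_le c1 continuous_const).inter (isClosed_le c2 continuous_const)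
    · exact fun q hq => hKsub q hq
  have hΦc : ContinuousOn Φ Kc := by
    have c1 : Continuous fun q : Euc N × Euc N => φ q.1 := hφ.continuous.comp continuous_fst
    have c2 : ContinuousOn (fun q : Euc N × Euc N => u q.2) Kc :=
      hu.comp continuous_snd.continuousOn fun q hq => subset_closure (hball (hKsub q hq).2)
    have cψ : Continuous ψ :=
      continuous_id.sub ((continuous_id.rpow_const fun _ => Or.inr (by linarith)).div_const 4)
    have c3 : Continuous fun q : Euc N × Euc N => L * ψ ‖q.1 - q.2‖ :=
      continuous_const.mul (cψ.comp (by fun_prop))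
    have c4 : Continuous fun q : Euc N × Euc N => A * ‖q.2 - y1‖ ^ 2 := by fun_prop
    exact ((c1.continuousOn.sub c2).sub c3.continuousOn).sub c4.continuousOn
  have hq1 : (x1, y1) ∈ Kc := ⟨hx1, by simpa using hr.le⟩
  obtain ⟨⟨xh, yh⟩, hq, hqmax⟩ := hKcomp.exists_isMaxOn ⟨_, hq1⟩ hΦc
  have hxh : xh ∈ closedBall y1 (2 * r) := (hKsub _ hq).1
  have hyh : yh ∈ closedBall y1 (2 * r) := (hKsub _ hq).2
  have htr : ‖xh - yh‖ ≤ r := hq.1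
  have hyr : ‖yh - y1‖ ≤ r := hq.2
  set t := ‖xh - yh‖ with ht
  have ht0' : 0 ≤ t := norm_nonneg _
  have hval : σ + L * ψ t + A * ‖yh - y1‖ ^ 2 ≤ u xh - u yh := by
    have h1 : Φ (x1, y1) ≤ Φ (xh, yh) := hqmax hq1
    simp only [hΦ, sub_self, norm_zero] at h1
    have a1 := abs_le.1 (hφu x1 (hKsub _ hq1).1).1
    have a2 := abs_le.1 (hφu xh hxh).1
    have a3 : L * ψ ‖x1 - y1‖ ≤ L * ‖x1 - y1‖ :=
      mul_le_mul_of_nonneg_left (hψle _ (norm_nonneg _)) hL0.le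
    norm_num at h1
    linarith
  have hHt : u xh - u yh ≤ C * t ^ α := (abs_le.1 (hH xh (hball hxh) yh (hball hyh))).2
  have htα : t ^ α ≤ 1 := Real.rpow_le_one ht0' (by linarith) hα0.le
  have hCt : C * t ^ α ≤ C := by nlinarith
  have hψt := hψge t ht0' (by linarith)
  have hLt : L * (t / 2) ≤ L * ψ t := mul_le_mul_of_nonneg_left hψt hL0.le
  have hsq : 0 ≤ A * ‖yh - y1‖ ^ 2 := by positivity
  have ht0 : 0 < t := by
    refine lt_of_le_of_ne ht0' fun h0 => ?_
    rw [← h0] at hHt hLt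
    rw [Real.zero_rpow hα0.ne'] at hHt
    rw [← h0] at hval
    linarith
  have htlt : t < r := by
    refine lt_of_le_of_ne htr fun h0 => ?_
    rw [h0] at hLt
    rw [h0] at hval
    linarith
  have hylt : ‖yh - y1‖ < r := by
    refine lt_of_le_of_ne hyr fun h0 => ?_
    rw [h0] at hval
    have : 0 ≤ L * (t / 2) := by positivity
    linarith
  -- bound on t
  have htb : t ≤ (2 * C / L) ^ (m - 1) := by
    have h1 : L * (t / 2) ≤ C * t ^ α := by linarith
    have h2 : t ^ (1 - α) ≤ 2 * C / L := by
      rw [le_div_iff₀ hL0]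
      have e : t ^ (1 - α) * t ^ α = t := by
        rw [← Real.rpow_add ht0]; simp
      have hp : 0 < t ^ α := Real.rpow_pos_of_pos ht0 _
      have : t ^ (1 - α) * L * t ^ α ≤ 2 * C * t ^ α := by
        calc t ^ (1 - α) * L * t ^ α = L * (t ^ (1 - α) * t ^ α) := by ring
          _ = L * t := by rw [e]
          _ ≤ _ := by linarith
      exact le_of_mul_le_mul_right this hp
    have h3 := Real.rpow_le_rpow (Real.rpow_nonneg ht0' _) h2 hm1.le
    rwa [← Real.rpow_mul ht0', hα1, Real.rpow_one] at h3
  -- directions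
  have hne : xh ≠ yh := by
    intro h
    rw [ht, h, sub_self, norm_zero] at ht0
    exact lt_irrefl _ ht0
  set e : Euc N := t⁻¹ • (xh - yh) with he
  have hen : ‖e‖ = 1 := by
    rw [he, norm_smul, norm_inv, Real.norm_of_nonneg ht0', ← ht]; field_simp
  have hte : xh - yh = t • e := by
    rw [he, smul_smul, mul_inv_cancel₀ ht0.ne', one_smul]
  have hee : inner ℝ e e = (1:ℝ) := by rw [real_inner_self_eq_norm_sq, hen]; norm_num
  -- derivative facts for ψ
  have hd1 : ∀ s, 0 < s → HasDerivAt ψ (ψ1 s) s := by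
    intro s hs
    have := (hasDerivAt_id s).sub
      ((Real.hasDerivAt_rpow_const (x := s) (p := 1 + β) (Or.inl hs.ne')).div_const 4)
    refine this.congr_deriv ?_
    simp only [hψ1]
    rw [show (1 + β) - 1 = β by ring]
  have hd2 : HasDerivAt ψ1 (-((1 + β) * (β * t ^ (β - 1)) / 4)) t := by
    have := (((Real.hasDerivAt_rpow_const (x := t) (p := β) (Or.inl ht0.ne')).const_mul
      (1 + β)).div_const 4).const_sub 1
    exact this
  have hcd : ContDiffAt ℝ 2 ψ t :=
    contDiffAt_id.sub (((contDiffAt_id (𝕜 := ℝ) (n := 2) (x := t)).rpow_const_of_ne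
      (p := 1 + β) ht0.ne').div_const 4)
  have hevd : ∀ᶠ s in 𝓝 t, HasDerivAt ψ (ψ1 s) s := by
    filter_upwards [lt_mem_nhds ht0] with s hs using hd1 s hs
  have htβ : t ^ β ≤ 1 := Real.rpow_le_one ht0' (by linarith) hβ0.le
  have htβ0 : 0 < t ^ β := Real.rpow_pos_of_pos ht0 _
  have hψ1le : ψ1 t ≤ 1 := by
    simp only [hψ1]
    have : 0 ≤ (1 + β) * t ^ β / 4 := by positivity
    linarith
  have hψ1ge : 0 ≤ ψ1 t := by
    simp only [hψ1]; nlinarith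
  -- gradient of φ at xh
  have jφ := Jet.of_contDiff (x := xh) hφ
  have hgrad : gradient φ xh = (L * ψ1 t) • e := by
    have jn := ((Jet.norm yh xh hne).comp (F := ψ) (F1 := ψ1) ht hcd hevd hd2).const_mul L
    have hloc : IsLocalMax (fun x => φ x - L * ψ ‖x - yh‖) xh := by
      have : ∀ᶠ x in 𝓝 xh, ‖x - yh‖ < r :=
        (by fun_prop : Continuous fun x : Euc N => ‖x - yh‖).continuousAt.eventually_lt
          continuousAt_const htlt
      filter_upwards [this] with x hx
      have h1 : Φ (x, yh) ≤ Φ (xh, yh) := hqmax (show (x, yh) ∈ Kc from ⟨hx.le, hyr⟩)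
      simp only [hΦ] at h1
      linarith
    have := ((jφ.sub jn).localMax hloc).1
    rw [sub_eq_zero.1 this, smul_smul, he]
  -- reflection
  set R : Euc N ≃ₗᵢ[ℝ] Euc N := (ℝ ∙ e)ᗮ.reflection with hR
  have hRv : ∀ v, R v = v - (2 * inner ℝ e v) • e := by
    intro v
    rw [hR, Submodule.reflection_orthogonal_apply, Submodule.reflection_singleton_apply, hen]
    simp [smul_smul, two_smul, two_mul, add_smul]
  have hRe : R.symm e = -e := by
    rw [hR, Submodule.reflection_symm, Submodule.reflection_orthogonalComplement_singleton_eq_neg]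
  -- test function
  have j1 : Jet (fun y => φ (xh + R (y - yh))) yh (R.symm (gradient φ xh)) (lapl φ xh) :=
    Jet.comp_isom R yh xh (by simpa using jφ)
  have j2a : Jet (fun y => (t + 2 * inner ℝ e yh) - 2 * inner ℝ e y) yh (0 - (2:ℝ) • e) (0 - 2 * 0) :=
    (Jet.const _ yh).sub ((Jet.innerL e yh).const_mul 2)
  have j2 := (j2a.comp (F := ψ) (F1 := ψ1) (a := t) (by ring) hcd hevd hd2).const_mul L
  have j3 := (Jet.normSq y1 yh).const_mul A
  have j := (j1.sub j2).sub j3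
  have hmin : IsLocalMinOn (fun y => u y - (φ (xh + R (y - yh)) -
      L * ψ ((t + 2 * inner ℝ e yh) - 2 * inner ℝ e y) - A * ‖y - y1‖ ^ 2)) (closure Ω) yh := by
    apply IsLocalMin.on
    have ev1 : ∀ᶠ y in 𝓝 yh, ‖y - y1‖ < r :=
      (by fun_prop : Continuous fun y : Euc N => ‖y - y1‖).continuousAt.eventually_lt
          continuousAt_const hylt
    have cin : Continuous fun y : Euc N => (t + 2 * inner ℝ e yh) - 2 * inner ℝ e y := by fun_prop
    have ev2 : ∀ᶠ y in 𝓝 yh, 0 < (t + 2 * inner ℝ e yh) - 2 * inner ℝ e y :=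
      continuousAt_const.eventually_lt cin.continuousAt (by simpa using ht0)
    have ev3 : ∀ᶠ y in 𝓝 yh, (t + 2 * inner ℝ e yh) - 2 * inner ℝ e y < r :=
      cin.continuousAt.eventually_lt continuousAt_const (by simpa using htlt)
    filter_upwards [ev1, ev2, ev3] with y h1 h2 h3
    have hn : ‖xh + R (y - yh) - y‖ = (t + 2 * inner ℝ e yh) - 2 * inner ℝ e y := by
      have : xh + R (y - yh) - y = ((t + 2 * inner ℝ e yh) - 2 * inner ℝ e y) • e := by
        rw [hRv]
        have : xh + (y - yh - (2 * inner ℝ e (y - yh)) • e) - y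
          = (xh - yh) - (2 * inner ℝ e (y - yh)) • e := by abel
        rw [this, hte, ← sub_smul, inner_sub_right]
        congr 1; ring
      rw [this, norm_smul, hen, mul_one, Real.norm_of_nonneg h2.le]
    have h4 : Φ (xh + R (y - yh), y) ≤ Φ (xh, yh) :=
      hqmax (show (xh + R (y - yh), y) ∈ Kc from ⟨by simp only [hn]; exact h3.le, h1.le⟩)
    simp only [hΦ, hn] at h4
    simp only [sub_self, map_zero, add_zero, add_sub_cancel_right]
    rw [← ht] at h4
    linarith
  have hsupv := hsup.jet (subset_closure (hball hyh)) j hmin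
  have hsubv := (hφu xh hxh).2
  rw [jφ.ham, hgrad, norm_smul, hen, mul_one, Real.norm_of_nonneg (by positivity)] at hsubv
  -- gradient of the test function
  have hpy : ‖R.symm (gradient φ xh) - L • ψ1 t • ((0:Euc N) - (2:ℝ) • e) - A • (2:ℝ) • (yh - y1)‖
      ≤ L * ψ1 t + 2 * A * r := by
    have e1 : R.symm (gradient φ xh) - L • ψ1 t • ((0:Euc N) - (2:ℝ) • e) - A • (2:ℝ) • (yh - y1)
        = (L * ψ1 t) • e - (2 * A) • (yh - y1) := by
      rw [hgrad, map_smul, hRe]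
      module
    rw [e1]
    refine (norm_sub_le _ _).trans ?_
    rw [norm_smul (L * ψ1 t) e, norm_smul (2 * A) (yh - y1), hen, Real.norm_of_nonneg (by positivity),
      Real.norm_of_nonneg (by positivity), mul_one]
    exact add_le_add le_rfl (mul_le_mul_of_nonneg_left hyr (by positivity))
  have hpm := Real.rpow_le_rpow (norm_nonneg _) hpy (by linarith : 0 ≤ m)
  have hdiff := rpow_sub_le (m := m) (a := L * ψ1 t + 2 * A * r) (b := L * ψ1 t) (by linarith)
    (by positivity) (by positivity)
  have ha2 : L * ψ1 t + 2 * A * r ≤ 2 * L := by nlinarith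
  have hap : (L * ψ1 t + 2 * A * r) ^ (m - 1) ≤ (2 * L) ^ (m - 1) :=
    Real.rpow_le_rpow (by positivity) ha2 hm1.le
  have hdiff2 : m * (L * ψ1 t + 2 * A * r) ^ (m - 1) * (2 * A * r) ≤
      m * (2 * L) ^ (m - 1) * (2 * A * r) := by gcongr
  rw [add_sub_cancel_left] at hdiff
  have hn2 : ‖(0:Euc N) - (2:ℝ) • e‖ ^ 2 = 4 := by
    rw [zero_sub, norm_neg, norm_smul, hen]; norm_num
  rw [hn2] at hsupv
  have htpow : (L / (2 * C)) ^ ((m - 1) * (1 - β)) ≤ t ^ (β - 1) := by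
    have h1 := Real.rpow_le_rpow_of_nonpos ht0 htb (by linarith : β - 1 ≤ 0)
    refine le_trans (le_of_eq ?_) h1
    rw [← Real.rpow_mul (by positivity), show 2 * C / L = (L / (2 * C))⁻¹ by rw [inv_div],
      Real.inv_rpow (by positivity), ← Real.rpow_neg (by positivity)]
    congr 1; ring
  have hgain : L * β * (L / (2 * C)) ^ ((m - 1) * (1 - β)) ≤ L * ((1 + β) * (β * t ^ (β - 1))) := by
    have h1 : L * β * (L / (2 * C)) ^ ((m - 1) * (1 - β)) ≤ L * β * t ^ (β - 1) := by gcongr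
    have h2 : 0 ≤ L * β * t ^ (β - 1) := by positivity
    nlinarith
  have hg1 := (abs_le.1 (hg xh (hball hxh))).2
  have hg2 := (abs_le.1 (hg yh (hball hyh))).1
  nlinarith

lemma exists_lip_const (hm : 2 < m) (M : ℝ) {C r A β : ℝ} (hC : 0 < C) (hr : 0 < r)
    (hA0 : 0 < A) (hβ : β = 1 / (2 * (m - 1))) (D : ℝ) :
    ∃ L : ℝ, 1 ≤ L ∧ 2 * C < L * r ∧ 2 * A * r ≤ L ∧
      2 * M + 1 + 2 * D * A + m * (2 * L) ^ (m - 1) * (2 * A * r) <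
      L * β * (L / (2 * C)) ^ ((m - 1) * (1 - β)) := by
  have hm1 : 0 < m - 1 := by linarith
  have hβ0 : 0 < β := by rw [hβ]; positivity
  set k := β * ((2 * C) ^ ((m - 1) * (1 - β)))⁻¹ with hk
  have hk0 : 0 < k := by positivity
  set k' := m * 2 ^ (m - 1) * (2 * A * r) with hk'
  set B := |2 * M + 1 + 2 * D * A| with hB
  have ht : Tendsto (fun L : ℝ => k * L ^ (1/2 : ℝ)) atTop atTop :=
    (tendsto_rpow_atTop (by norm_num)).const_mul_atTop hk0
  obtain ⟨L, h1, h2, h3, h4⟩ := (((eventually_ge_atTop (1:ℝ)).and ((eventually_gt_atTop (2 * C / r)).and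
    ((eventually_ge_atTop (2 * A * r)).and (ht.eventually_gt_atTop (k' + B)))))).exists
  refine ⟨L, h1, by rwa [div_lt_iff₀ hr] at h2, h3, ?_⟩
  have hL0 : 0 < L := by linarith
  have e1 : L * β * (L / (2 * C)) ^ ((m - 1) * (1 - β)) = k * L ^ (1/2:ℝ) * L ^ (m - 1) := by
    rw [Real.div_rpow hL0.le (by positivity), hk]
    have : L ^ (1/2:ℝ) * L ^ (m - 1) = L * L ^ ((m - 1) * (1 - β)) := by
      nth_rewrite 3 [← Real.rpow_one L]
      rw [← Real.rpow_add hL0, ← Real.rpow_add hL0]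
      congr 1
      rw [hβ]; field_simp; ring
    calc _ = β * ((2 * C) ^ ((m - 1) * (1 - β)))⁻¹ * (L * L ^ ((m - 1) * (1 - β))) := by
          rw [div_eq_mul_inv]; ring
      _ = _ := by rw [← this]; ring
  have e2 : m * (2 * L) ^ (m - 1) * (2 * A * r) = k' * L ^ (m - 1) := by
    rw [Real.mul_rpow (by norm_num) hL0.le, hk']; ring
  rw [e1, e2]
  have h5 : 1 ≤ L ^ (m - 1) := Real.one_le_rpow h1 hm1.le
  have h6 : 2 * M + 1 + 2 * D * A ≤ B := le_abs_self _
  have h7 : 0 ≤ B := abs_nonneg _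
  have h8 : (k' + B) * L ^ (m - 1) < k * L ^ (1/2:ℝ) * L ^ (m - 1) := by gcongr
  nlinarith

lemma loc_lip (hm : 2 < m) (hΩo : IsOpen Ω) {g u : Euc N → ℝ} {M C : ℝ}
    (hS : SSub Ω m g u) (hu : ContinuousOn u (closure Ω))
    (hsup : SCSuper Ω m g u) (hg : ∀ x ∈ Ω, |g x| ≤ M) (hC : 0 < C)
    (hH : ∀ x ∈ Ω, ∀ y ∈ Ω, |u x - u y| ≤ C * ‖x - y‖ ^ ((m - 2) / (m - 1))) :
    LocLipIn Ω u := by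
  intro x0 hx0
  obtain ⟨r0, hr0, hb0⟩ := Metric.isOpen_iff.1 hΩo x0 hx0
  set r := min (r0 / 4) 1 with hr
  have hrp : 0 < r := by positivity
  have hr1 : r ≤ 1 := min_le_right _ _
  have hr4 : r ≤ r0 / 4 := min_le_left _ _
  set A := (C + 1) / r ^ 2 with hA
  have hA0 : 0 < A := by positivity
  have hAr : A * r ^ 2 = C + 1 := by rw [hA]; field_simp
  obtain ⟨L, h1, h2, h3, h4⟩ := exists_lip_const hm M hC hrp hA0 rfl (N : ℝ)
  refine ⟨r / 2, by positivity, L, by linarith, ?_⟩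
  have key : ∀ y ∈ ball x0 (r / 2), ∀ z ∈ ball x0 (r / 2), u y - u z ≤ L * ‖y - z‖ := by
    intro y hy z hz
    rw [mem_ball] at hy hz
    refine lip_core hm hS hu hsup hg hC hH hrp hr1 ?_ rfl hA0 (by linarith) h1 h2 h3 h4 ?_
    · intro w hw
      apply hb0
      rw [mem_closedBall] at hw
      rw [mem_ball]
      linarith [dist_triangle w z x0]
    · rw [← dist_eq_norm]
      linarith [dist_triangle_right y z x0]
  intro y hy z hz
  rw [abs_le]
  have a := key y hy.1 z hz.1
  have b := key z hz.1 y hy.1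
  rw [norm_sub_rev] at b
  constructor <;> linarith
end



section resolvent

open scoped ContDiff
open SchwartzMap FourierTransform LineDeriv Laplacian

variable {N : ℕ}

/-- temperate growth of the resolvent symbol -/
lemma exists_resolvent_symbol (q : Euc N) {s : ℝ} (hs : 0 < s) :
    ∃ g : Euc N → ℂ, g.HasTemperateGrowth ∧ ∀ ξ : Euc N,
      (1 + s * ((2 * Real.pi) ^ 2 * ‖ξ‖ ^ 2) + s * (2 * Real.pi * Complex.I * (inner ℝ ξ q : ℝ)) : ℂ)
        * g ξ = 1 := by
  set c : ℝ := Real.sqrt s * (2 * Real.pi) with hc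
  have hc2 : c ^ 2 = s * (2 * Real.pi) ^ 2 := by rw [hc, mul_pow, Real.sq_sqrt hs.le]
  set A : Euc N → ℝ := fun ξ => (1 + ‖c • ξ‖ ^ 2) ^ (-1 : ℝ) with hA
  have hAt : A.HasTemperateGrowth := by
    have h1 := Function.hasTemperateGrowth_one_add_norm_sq_rpow (Euc N) (-1)
    have h2 : (fun ξ : Euc N => c • ξ).HasTemperateGrowth :=
      (c • ContinuousLinearMap.id ℝ (Euc N)).hasTemperateGrowth
    exact h1.comp h2
  set t : Euc N → ℝ := fun ξ => (s * (2 * Real.pi)) * inner ℝ ξ q * A ξ with ht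
  have htt : t.HasTemperateGrowth := by
    have h1 : (fun ξ : Euc N => inner ℝ ξ q).HasTemperateGrowth :=
      Function.hasTemperateGrowth_inner_left q
    exact ((Function.HasTemperateGrowth.const _).mul h1).mul hAt
  set B : Euc N → ℝ := fun ξ => (1 + ‖t ξ‖ ^ 2) ^ (-1 : ℝ) with hB
  have hBt : B.HasTemperateGrowth :=
    (Function.hasTemperateGrowth_one_add_norm_sq_rpow ℝ (-1)).comp htt
  refine ⟨fun ξ => (1 - Complex.I * (t ξ : ℂ)) * ((A ξ : ℂ) * (B ξ : ℂ)), ?_, ?_⟩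
  · have c1 : (fun ξ => (t ξ : ℂ)).HasTemperateGrowth := Function.Complex.hasTemperateGrowth_ofReal.comp htt
    have c2 : (fun ξ => (A ξ : ℂ)).HasTemperateGrowth := Function.Complex.hasTemperateGrowth_ofReal.comp hAt
    have c3 : (fun ξ => (B ξ : ℂ)).HasTemperateGrowth := Function.Complex.hasTemperateGrowth_ofReal.comp hBt
    exact ((Function.HasTemperateGrowth.const _).sub
      ((Function.HasTemperateGrowth.const _).mul c1)).mul (c2.mul c3)
  · intro ξ
    have ha : (1 + s * ((2 * Real.pi) ^ 2 * ‖ξ‖ ^ 2)) * A ξ = 1 := by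
      have e : ‖c • ξ‖ ^ 2 = s * ((2 * Real.pi) ^ 2 * ‖ξ‖ ^ 2) := by
        rw [norm_smul, mul_pow, Real.norm_eq_abs, sq_abs, hc2]; ring
      simp only [hA, e]
      rw [Real.rpow_neg_one]
      exact mul_inv_cancel₀ (by positivity)
    have hb : (1 + t ξ ^ 2) * B ξ = 1 := by
      simp only [hB]
      rw [Real.rpow_neg_one, Real.norm_eq_abs, sq_abs]
      exact mul_inv_cancel₀ (by positivity)
    have ha' : (1 + s * ((2 * Real.pi) ^ 2 * ‖ξ‖ ^ 2) : ℂ) * A ξ = 1 := by exact_mod_cast ha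
    have hb' : (1 + (t ξ : ℂ) ^ 2) * B ξ = 1 := by exact_mod_cast hb
    have ht' : (t ξ : ℂ) = (s * (2 * Real.pi)) * (inner ℝ ξ q : ℝ) * A ξ := by
      simp only [ht]; push_cast; ring
    have h1 : (1 + s * ((2 * Real.pi) ^ 2 * ‖ξ‖ ^ 2) + s * (2 * Real.pi * Complex.I *
      (inner ℝ ξ q : ℝ)) : ℂ) * A ξ = 1 + Complex.I * t ξ := by
      rw [add_mul, ha', ht']; ring
    have h2 : (1 + Complex.I * (t ξ : ℂ)) * (1 - Complex.I * t ξ) = 1 + (t ξ : ℂ) ^ 2 := by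
      linear_combination (- (t ξ : ℂ) ^ 2) * Complex.I_sq
    calc _ = ((1 + s * ((2 * Real.pi) ^ 2 * ‖ξ‖ ^ 2) + s * (2 * Real.pi * Complex.I *
      (inner ℝ ξ q : ℝ)) : ℂ) * A ξ) * (1 - Complex.I * t ξ) * B ξ := by ring
      _ = 1 := by rw [h1, h2, hb']

/-- the operator identity on Schwartz functions -/
lemma schwartz_resolvent (q : Euc N) {s : ℝ} (hs : 0 < s) :
    ∃ R : 𝓢(Euc N, ℂ) → 𝓢(Euc N, ℂ), (∀ z, R z + (s:ℂ) • (- Δ (R z) + ∂_{q} (R z)) = z) ∧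
      ∀ k z, SchwartzMap.convolution (ContinuousLinearMap.mul ℂ ℂ) k (R z) =
        R (SchwartzMap.convolution (ContinuousLinearMap.mul ℂ ℂ) k z) := by
  obtain ⟨g, hg, hgs⟩ := exists_resolvent_symbol q hs
  refine ⟨fourierMultiplierCLM ℂ g, fun z => ?_, fun k z => ?_⟩
  · set w := fourierMultiplierCLM ℂ g z with hw
    have hFw : 𝓕 w = smulLeftCLM ℂ g (𝓕 z) := by
      rw [hw, fourierMultiplierCLM_apply, fourier_fourierInv_eq]
    have h2 : (fun ξ : Euc N => ‖ξ‖ ^ 2).HasTemperateGrowth := by fun_prop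
    have h1 : (fun ξ : Euc N => inner ℝ ξ q).HasTemperateGrowth :=
      Function.hasTemperateGrowth_inner_left q
    have key : 𝓕 (w + (s:ℂ) • (- Δ w + ∂_{q} w)) = 𝓕 z := by
      rw [laplacian_eq_fourierMultiplierCLM, lineDeriv_eq_fourierMultiplierCLM,
        fourierMultiplierCLM_apply, fourierMultiplierCLM_apply]
      simp only [FourierTransform.fourier_add, FourierTransform.fourier_smul, FourierTransform.fourier_neg, FourierTransform.fourier_fourierInv_eq]
      rw [hFw]
      ext ξ
      have := hgs ξ
      simp only [add_apply, smul_apply, neg_apply, smulLeftCLM_apply_apply h1,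
        smulLeftCLM_apply_apply h2, smulLeftCLM_apply_apply hg, smul_eq_mul, Complex.real_smul]
      push_cast
      linear_combination (𝓕 z ξ) * this
    have := congrArg (fun v => 𝓕⁻ v) key
    simpa only [fourierInv_fourier_eq] using this
  · have key : 𝓕 (SchwartzMap.convolution (ContinuousLinearMap.mul ℂ ℂ) k (fourierMultiplierCLM ℂ g z))
      = 𝓕 (fourierMultiplierCLM ℂ g (SchwartzMap.convolution (ContinuousLinearMap.mul ℂ ℂ) k z)) := by
      rw [fourier_convolution, fourierMultiplierCLM_apply, fourierMultiplierCLM_apply,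
        fourier_fourierInv_eq, fourier_fourierInv_eq, fourier_convolution]
      ext ξ
      simp [smulLeftCLM_apply_apply hg]
      ring
    have := congrArg (fun v => 𝓕⁻ v) key
    simpa only [fourierInv_fourier_eq] using this

/-- the constant coefficient linear operator -/
noncomputable def Lop (q : Euc N) (φ : Euc N → ℝ) (x : Euc N) : ℝ :=
  -lapl φ x + inner ℝ q (gradient φ x)

lemma schwartz_re (q : Euc N) (W : 𝓢(Euc N, ℂ)) :
    ContDiff ℝ 2 (fun x => (W x).re) ∧ Tendsto (fun x => (W x).re) (cocompact (Euc N)) (𝓝 0) ∧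
      ∀ x, Lop q (fun x => (W x).re) x = ((- Δ W + ∂_{q} W) x).re := by
  have hW : ContDiff ℝ 2 W := W.smooth 2
  refine ⟨Complex.reCLM.contDiff.comp hW, ?_, fun x => ?_⟩
  · have h := (ZeroAtInftyContinuousMapClass.zero_at_infty W)
    have := (Complex.continuous_re.tendsto 0).comp h
    simpa [Function.comp_def] using this
  · have h1 : lapl (fun x => (W x).re) x = (Δ W x).re := by
      rw [lapl_eq_laplacian, SchwartzMap.laplacian_apply]
      exact (hW.contDiffAt.laplacian_CLM_comp_left (l := Complex.reCLM))
    have h2 : inner ℝ q (gradient (fun x => (W x).re) x) = (∂_{q} W x).re := by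
      rw [real_inner_comm, ← grad_apply, SchwartzMap.lineDerivOp_apply_eq_fderiv]
      have hd : HasFDerivAt W (fderiv ℝ W x) x :=
        (hW.contDiffAt.differentiableAt (by norm_num)).hasFDerivAt
      have := (Complex.reCLM.hasFDerivAt.comp x hd).fderiv
      have e : (fun x => (W x).re) = Complex.reCLM ∘ W := rfl
      rw [e, this]; rfl
    rw [Lop, h1, h2]; simp

lemma real_resolvent (q : Euc N) {s : ℝ} (hs : 0 < s) {z k : Euc N → ℝ}
    (hz : ContDiff ℝ ∞ z) (hzc : HasCompactSupport z) (hk : ContDiff ℝ ∞ k)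
    (hkc : HasCompactSupport k) :
    ∃ w Y : Euc N → ℝ, ContDiff ℝ 2 w ∧ ContDiff ℝ 2 Y ∧ Tendsto w (cocompact _) (𝓝 0) ∧
      Tendsto Y (cocompact _) (𝓝 0) ∧ (∀ x, w x + s * Lop q w x = z x) ∧
      (∀ x, Y x + s * Lop q Y x = ∫ y, k y * z (x - y)) ∧
      ∀ x, Y x = ∫ y, k y * w (x - y) := by
  obtain ⟨R, hR1, hR2⟩ := schwartz_resolvent q hs
  have hof : ContDiff ℝ ∞ (fun x : ℝ => (x : ℂ)) := Complex.ofRealCLM.contDiff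
  set zs : 𝓢(Euc N, ℂ) := HasCompactSupport.toSchwartzMap (f := fun x => (z x : ℂ))
    (hzc.comp_left (g := fun x : ℝ => (x : ℂ)) (by simp)) (hof.comp hz) with hzs
  set ks : 𝓢(Euc N, ℂ) := HasCompactSupport.toSchwartzMap (f := fun x => (k x : ℂ))
    (hkc.comp_left (g := fun x : ℝ => (x : ℂ)) (by simp)) (hof.comp hk) with hks
  have ezs : ∀ x, zs x = z x := fun x => rfl
  have eks : ∀ x, ks x = k x := fun x => rfl
  have hconv : ∀ (g : 𝓢(Euc N, ℂ)) x,
      (SchwartzMap.convolution (ContinuousLinearMap.mul ℂ ℂ) ks g x).re = ∫ y, k y * (g (x - y)).re := by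
    intro g x
    rw [SchwartzMap.convolution_apply, MeasureTheory.convolution]
    have hIntegr0 : Integrable (fun t => (ContinuousLinearMap.mul ℂ ℂ) (ks t) (g (x - t))) := by
      apply Continuous.integrable_of_hasCompactSupport
      · exact ks.continuous.mul (g.continuous.comp (by fun_prop))
      · exact (hkc.comp_left (g := fun x : ℝ => (x : ℂ)) (by simp)).mul_right
    have := (Complex.reCLM.integral_comp_comm hIntegr0)
    simp only [Complex.reCLM_apply] at this
    rw [← this]
    congr 1
    ext t
    simp [eks]
  obtain ⟨a1, a2, a3⟩ := schwartz_re q (R zs)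
  obtain ⟨b1, b2, b3⟩ := schwartz_re q (SchwartzMap.convolution (ContinuousLinearMap.mul ℂ ℂ) ks (R zs))
  refine ⟨_, _, a1, b1, a2, b2, fun x => ?_, fun x => ?_, fun x => hconv _ x⟩
  · rw [a3]
    have := congrArg (fun v : 𝓢(Euc N, ℂ) => (v x).re) (hR1 zs)
    simpa [ezs, mul_add] using this
  · rw [b3, hR2]
    have := congrArg (fun v : 𝓢(Euc N, ℂ) => (v x).re)
      (hR1 (SchwartzMap.convolution (ContinuousLinearMap.mul ℂ ℂ) ks zs))
    rw [hconv] at this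
    simpa [ezs, mul_add] using this

end resolvent

section linearVM

variable {N : ℕ}

lemma max_principle_le {q : Euc N} {s M : ℝ} (hs : 0 < s) (hM : 0 ≤ M) {w z : Euc N → ℝ}
    (hw : ContDiff ℝ 2 w) (hw0 : Tendsto w (cocompact _) (𝓝 0))
    (heq : ∀ x, w x + s * Lop q w x = z x) (hz : ∀ x, z x ≤ M) (x : Euc N) : w x ≤ M := by
  by_contra! hx
  have hev : ∀ᶠ y in cocompact (Euc N), w y ≤ w x := by
    have := hw0.eventually (gt_mem_nhds (hM.trans_lt hx))
    filter_upwards [this] with y hy using hy.le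
  obtain ⟨x1, hx1⟩ := hw.continuous.exists_forall_ge' x hev
  have hl : IsLocalMax w x1 := Eventually.of_forall hx1
  obtain ⟨h1, h2⟩ := (Jet.of_contDiff (x := x1) hw).localMax hl
  have h3 := heq x1
  rw [Lop, h1, inner_zero_right] at h3
  have := hx1 x
  have := hz x1
  nlinarith

lemma Lop_neg (q : Euc N) {w : Euc N → ℝ} (hw : ContDiff ℝ 2 w) (x : Euc N) :
    Lop q (fun y => - w y) x = - Lop q w x := by
  have h := (Jet.of_contDiff (x := x) hw).neg
  rw [Lop, Lop, h.2.1, h.2.2, inner_neg_right]; ring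

lemma max_principle_abs {q : Euc N} {s M : ℝ} (hs : 0 < s) (hM : 0 ≤ M) {w z : Euc N → ℝ}
    (hw : ContDiff ℝ 2 w) (hw0 : Tendsto w (cocompact _) (𝓝 0))
    (heq : ∀ x, w x + s * Lop q w x = z x) (hz : ∀ x, |z x| ≤ M) (x : Euc N) : |w x| ≤ M := by
  rw [abs_le]
  constructor
  · have := max_principle_le (q := q) (w := fun y => - w y) (z := fun y => - z y) hs hM hw.neg
      (by simpa using hw0.neg) (fun y => by rw [Lop_neg q hw, ← heq y]; ring)
      (fun y => by linarith [(abs_le.1 (hz y)).1]) x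
    linarith
  · exact max_principle_le hs hM hw hw0 heq (fun y => (abs_le.1 (hz y)).2) x

/-- comparison of a viscosity subsolution of a linear equation with a resolvent -/
lemma linear_barrier {q x' : Euc N} {r s C om M : ℝ} (hr : 0 < r) (hs : 0 < s) (hM : 0 ≤ M)
    {z y Z' : Euc N → ℝ} (hz : ContinuousOn z (closedBall x' r)) (hy : ContDiff ℝ 2 y)
    (hvisc : ∀ x ∈ ball x' r, ∀ φ p l, Jet φ x p l → IsLocalMax (fun y => z y - φ y) x →
      -l + inner ℝ q p ≤ C)
    (hzM : ∀ x ∈ closedBall x' r, |z x| ≤ M) (hyM : ∀ x, |y x| ≤ M)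
    (heq : ∀ x, y x + s * Lop q y x = Z' x) (hom : ∀ x ∈ closedBall x' r, |Z' x - z x| ≤ om) :
    z x' ≤ y x' + s * C + om + ((4 * M + 1) / r ^ 4) * (4 * N + 8 + 4 * ‖q‖ * r) ^ 2 * s ^ 2 / 4 := by
  set A : ℝ := (4 * M + 1) / r ^ 4 with hA
  set κ : ℝ := 4 * N + 8 + 4 * ‖q‖ * r with hκ
  have hA0 : 0 < A := by positivity
  have hAr : A * r ^ 4 = 4 * M + 1 := by rw [hA]; field_simp
  set F : Euc N → ℝ := fun x => z x - (y x + A * (‖x - x'‖ ^ 2) ^ 2) with hF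
  have hFc : ContinuousOn F (closedBall x' r) := by
    have : Continuous fun x => y x + A * (‖x - x'‖ ^ 2) ^ 2 :=
      hy.continuous.add (by fun_prop)
    exact hz.sub this.continuousOn
  obtain ⟨xh, hxh, hmax⟩ := (isCompact_closedBall x' r).exists_isMaxOn
    ⟨x', mem_closedBall_self hr.le⟩ hFc
  have h0 : F x' ≤ F xh := hmax (mem_closedBall_self hr.le)
  have hxh' : ‖xh - x'‖ ≤ r := by rwa [mem_closedBall, dist_eq_norm] at hxh
  simp only [hF, sub_self, norm_zero] at h0
  have hin : xh ∈ ball x' r := by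
    rw [mem_ball, dist_eq_norm]
    refine lt_of_le_of_ne hxh' fun h => ?_
    rw [h] at h0
    have e1 := abs_le.1 (hzM xh hxh)
    have e2 := abs_le.1 (hzM x' (mem_closedBall_self hr.le))
    have e3 := abs_le.1 (hyM xh)
    have e4 := abs_le.1 (hyM x')
    have : A * (r ^ 2) ^ 2 = 4 * M + 1 := by rw [← hAr]; ring
    rw [this] at h0
    norm_num at h0
    linarith [e1.2, e2.1, e3.1, e4.2]
  have hloc : IsLocalMax (fun x => z x - (y x + A * (‖x - x'‖ ^ 2) ^ 2)) xh := by
    filter_upwards [isOpen_ball.mem_nhds hin] with x hx using hmax (ball_subset_closedBall hx)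
  have j1 := Jet.of_contDiff (x := xh) hy
  have j2 := ((Jet.normSq x' xh).comp (F := fun u => u ^ 2) (F1 := fun u => 2 * u) (F2 := 2) rfl
    (by fun_prop) (Eventually.of_forall fun u => by simpa using hasDerivAt_pow 2 u)
    (by simpa using (hasDerivAt_id (‖xh - x'‖ ^ 2)).const_mul 2)).const_mul A
  have hv := hvisc xh hin _ _ _ (j1.add j2) hloc
  set D := ‖xh - x'‖ ^ 2 with hD
  have hD0 : 0 ≤ D := by positivity
  have hn : ‖(2:ℝ) • (xh - x')‖ ^ 2 = 4 * D := by
    rw [norm_smul, mul_pow, ← hD]; norm_num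
  rw [hn, inner_add_right, inner_smul_right, inner_smul_right, inner_smul_right] at hv
  have hqi : -(‖q‖ * r) ≤ inner ℝ q (xh - x') := by
    have := (abs_le.1 (abs_real_inner_le_norm q (xh - x'))).1
    have := mul_le_mul_of_nonneg_left hxh' (norm_nonneg q)
    linarith
  have hL : Lop q y xh ≤ C + A * κ * D := by
    rw [Lop, hκ]
    have : A * D * (-(‖q‖ * r)) ≤ A * D * inner ℝ q (xh - x') :=
      mul_le_mul_of_nonneg_left hqi (by positivity)
    linarith
  have h5 := (abs_le.1 (hom xh hxh)).1
  have h6 := heq xh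
  have h7 := mul_le_mul_of_nonneg_left hL hs.le
  have h8 : 0 ≤ A * (D - s * κ / 2) ^ 2 := by positivity
  norm_num at h0
  linarith

end linearVM



section linearVM2

open scoped ContDiff

variable {N : ℕ}

lemma integrable_ker {k h : Euc N → ℝ} (hk : Continuous k) (hkc : HasCompactSupport k)
    (hh : Continuous h) (x : Euc N) : Integrable (fun y => k y * h (x - y)) := by
  apply Continuous.integrable_of_hasCompactSupport
  · exact hk.mul (hh.comp (by fun_prop))
  · exact hkc.mul_right

lemma conv_le {k h h' : Euc N → ℝ} {c : ℝ} (hk : Continuous k) (hkc : HasCompactSupport k)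
    (hk0 : ∀ y, 0 ≤ k y) (hk1 : ∫ y, k y = 1) (hh : Continuous h) (hh' : Continuous h') (x : Euc N)
    (hle : ∀ y, k y ≠ 0 → h (x - y) ≤ h' (x - y) + c) :
    ∫ y, k y * h (x - y) ≤ (∫ y, k y * h' (x - y)) + c := by
  have hki : Integrable k := hk.integrable_of_hasCompactSupport hkc
  have e : (∫ y, k y * h' (x - y)) + c = ∫ y, (k y * h' (x - y) + k y * c) := by
    rw [integral_add (integrable_ker hk hkc hh' x) (hki.mul_const c), integral_mul_const, hk1, one_mul]
  rw [e]
  apply integral_mono (integrable_ker hk hkc hh x)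
    ((integrable_ker hk hkc hh' x).add (hki.mul_const c))
  intro y
  by_cases hy : k y = 0
  · simp [hy]
  · have := mul_le_mul_of_nonneg_left (hle y hy) (hk0 y)
    simp only [Pi.add_apply]
    linarith

lemma conv_abs_sub_le {k h h' : Euc N → ℝ} {c : ℝ} (hk : Continuous k) (hkc : HasCompactSupport k)
    (hk0 : ∀ y, 0 ≤ k y) (hk1 : ∫ y, k y = 1) (hh : Continuous h) (hh' : Continuous h') (x : Euc N)
    (hle : ∀ y, k y ≠ 0 → |h (x - y) - h' (x - y)| ≤ c) :
    |(∫ y, k y * h (x - y)) - ∫ y, k y * h' (x - y)| ≤ c := by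
  have h1 := conv_le hk hkc hk0 hk1 hh hh' x (c := c)
    fun y hy => by linarith [(abs_le.1 (hle y hy)).2]
  have h2 := conv_le hk hkc hk0 hk1 hh' hh x (c := c)
    fun y hy => by linarith [(abs_le.1 (hle y hy)).1]
  rw [abs_le]; constructor <;> linarith

lemma continuous_Lop (q : Euc N) {φ : Euc N → ℝ} (h : ContDiff ℝ 2 φ) : Continuous (Lop q φ) :=
  (continuous_lapl h).neg.add (continuous_const.inner (continuous_gradient h))

lemma linear_vm {q x : Euc N} {R δ C M : ℝ} (hδR : δ < R) (hM : 0 ≤ M) {z k : Euc N → ℝ}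
    (hz : Continuous z) (hzM : ∀ x, |z x| ≤ M)
    (happ : ∀ om > 0, ∃ zη : Euc N → ℝ, ContDiff ℝ ∞ zη ∧ HasCompactSupport zη ∧
      ∀ x, |zη x - z x| ≤ om)
    (hk : ContDiff ℝ ∞ k) (hkc : HasCompactSupport k) (hk0 : ∀ y, 0 ≤ k y) (hk1 : ∫ y, k y = 1)
    (hkδ : ∀ y, k y ≠ 0 → ‖y‖ ≤ δ) (hZ : ContDiff ℝ 2 fun x => ∫ y, k y * z (x - y))
    (hvisc : ∀ x1 ∈ ball x R, ∀ φ p l, Jet φ x1 p l → IsLocalMax (fun y => z y - φ y) x1 →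
      -l + inner ℝ q p ≤ C) :
    Lop q (fun x => ∫ y, k y * z (x - y)) x ≤ C := by
  set Z : Euc N → ℝ := fun x => ∫ y, k y * z (x - y) with hZdef
  by_contra! hcon
  obtain ⟨ε, hε, hCε⟩ : ∃ ε > 0, C + ε < Lop q Z x := ⟨(Lop q Z x - C) / 2, by linarith, by linarith⟩
  have hev : ∀ᶠ y in 𝓝 x, C + ε < Lop q Z y :=
    continuousAt_const.eventually_lt (continuous_Lop q hZ).continuousAt hCε
  obtain ⟨r0, hr0, hr0s⟩ := Metric.eventually_nhds_iff_ball.1 hev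
  set r := min r0 (R - δ) with hr
  have hr' : 0 < r := lt_min hr0 (by linarith)
  set B : ℝ := ((4 * (M + 1) + 1) / r ^ 4) * (4 * N + 8 + 4 * ‖q‖ * r) ^ 2 with hB
  have hB0 : 0 < B := by positivity
  set s : ℝ := ε / B with hs
  have hs0 : 0 < s := by positivity
  have hsB : B * s = ε := by rw [hs]; field_simp
  set om : ℝ := min 1 (s * ε / 8) with hom
  have hom0 : 0 < om := lt_min one_pos (by positivity)
  have hom1 : om ≤ 1 := min_le_left _ _
  have hom2 : om ≤ s * ε / 8 := min_le_right _ _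
  obtain ⟨zη, hzη, hzηc, hzηom⟩ := happ om hom0
  obtain ⟨w, Y, hw, hY, hw0, hY0, hweq, hYeq, hYw⟩ := real_resolvent q hs0 hzη hzηc hk hkc
  have hkcont := hk.continuous
  have hzηM : ∀ x, |zη x| ≤ M + 1 := fun x => by
    have h1 := hzηom x
    have h2 := abs_le.1 (hzM x)
    rw [abs_le] at h1 ⊢
    constructor <;> linarith [h1.1, h1.2, h2.1, h2.2]
  have hwM : ∀ x, |w x| ≤ M + 1 := max_principle_abs hs0 (by linarith) hw hw0 hweq hzηM
  have hkz0 : ∀ x, (∫ y, k y * (fun _ : Euc N => (0:ℝ)) (x - y)) = 0 := fun x => by simp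
  have hkzM : ∀ x, |∫ y, k y * zη (x - y)| ≤ M + 1 := fun x => by
    have := conv_abs_sub_le hkcont hkc hk0 hk1 hzη.continuous continuous_const (h' := fun _ => (0:ℝ)) x
      (c := M + 1) fun y _ => by simpa using hzηM (x - y)
    simpa only [mul_zero, integral_zero, sub_zero] using this
  have hYM : ∀ x, |Y x| ≤ M + 1 := max_principle_abs hs0 (by linarith) hY hY0 hYeq hkzM
  have hZM : ∀ x, |Z x| ≤ M + 1 := fun x => by
    have := conv_abs_sub_le hkcont hkc hk0 hk1 hz continuous_const (h' := fun _ => (0:ℝ)) x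
      (c := M + 1) fun y _ => by simpa using (hzM (x - y)).trans (by linarith)
    simpa only [mul_zero, integral_zero, sub_zero] using this
  -- first comparison
  have h1 : Z x ≤ Y x + (s * C + om + B * s ^ 2 / 4) := by
    rw [hYw]
    apply conv_le hkcont hkc hk0 hk1 hz hw.continuous x
    intro y hy
    have hyδ := hkδ y hy
    have := linear_barrier (q := q) (x' := x - y) (r := r) (s := s) (C := C) (om := om) (M := M + 1)
      (z := z) (y := w) (Z' := zη) hr' hs0 (by linarith) hz.continuousOn hw (fun x1 hx1 => by
        apply hvisc x1
        rw [mem_ball, dist_eq_norm] at hx1 ⊢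
        have h2 : r ≤ R - δ := min_le_right _ _
        have h3 : x1 - x = (x1 - (x - y)) - y := by abel
        rw [h3]
        linarith [norm_sub_le (x1 - (x - y)) y]) (fun x1 _ => (hzM x1).trans (by linarith)) hwM hweq
      (fun x1 _ => hzηom x1)
    linarith
  -- second comparison
  have h2 : - Z x ≤ - Y x + s * (-(C + ε)) + om + B * s ^ 2 / 4 := by
    refine linear_barrier (q := q) (x' := x) (r := r) (s := s) (C := -(C + ε)) (om := om) (M := M + 1)
      (z := fun x => - Z x) (y := fun x => - Y x) (Z' := fun x => - ∫ y, k y * zη (x - y)) hr' hs0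
      (by linarith) hZ.continuous.neg.continuousOn hY.neg (fun x1 hx1 φ p l hj hmax => ?_)
      (fun x1 _ => by simpa using hZM x1) (fun x1 => by simpa using hYM x1)
      (fun x1 => by rw [Lop_neg q hY, ← hYeq x1]; ring) (fun x1 _ => ?_)
    · have hx1' : x1 ∈ ball x r0 := ball_subset_ball (min_le_left _ _) hx1
      have h3 := hr0s x1 hx1'
      have jZ := (Jet.of_contDiff (x := x1) hZ).neg
      obtain ⟨e1, e2⟩ := (jZ.sub hj).localMax hmax
      have e1' : p = - gradient Z x1 := (sub_eq_zero.1 e1).symm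
      rw [Lop] at h3
      rw [e1', inner_neg_right]
      linarith
    · have := conv_abs_sub_le hkcont hkc hk0 hk1 hz hzη.continuous x1 (c := om)
        fun y _ => by rw [abs_sub_comm]; exact hzηom _
      rw [show (-(∫ y, k y * zη (x1 - y)) - -Z x1) = Z x1 - ∫ y, k y * zη (x1 - y) by ring]
      exact this
  have h3 : B * s ^ 2 = s * ε := by rw [← hsB]; ring
  rw [h3] at h1 h2
  nlinarith


lemma exists_kernel {δ : ℝ} (hδ : 0 < δ) : ∃ k : Euc N → ℝ, ContDiff ℝ ∞ k ∧ HasCompactSupport k ∧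
    (∀ y, 0 ≤ k y) ∧ (∫ y, k y = 1) ∧ ∀ y, k y ≠ 0 → ‖y‖ ≤ δ := by
  let b : ContDiffBump (0 : Euc N) := ⟨δ / 2, δ, by linarith, by linarith⟩
  refine ⟨b.normed volume, b.contDiff_normed, b.hasCompactSupport_normed, b.nonneg_normed,
    b.integral_normed, fun y hy => ?_⟩
  have : y ∈ Function.support (b.normed volume) := hy
  rw [b.support_normed_eq, mem_ball, dist_zero_right] at this
  exact this.le

lemma conv_smooth {k z : Euc N → ℝ} (hk : ContDiff ℝ ∞ k) (hkc : HasCompactSupport k)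
    (hz : Continuous z) : ContDiff ℝ ∞ fun x => ∫ y, k y * z (x - y) := by
  have := hkc.contDiff_convolution_left (ContinuousLinearMap.mul ℝ ℝ) hk
    (hz.locallyIntegrable (μ := volume))
  exact this

lemma conv_compact {k z : Euc N → ℝ} (hkc : HasCompactSupport k) (hzc : HasCompactSupport z) :
    HasCompactSupport fun x => ∫ y, k y * z (x - y) :=
  HasCompactSupport.convolution (μ := volume) (ContinuousLinearMap.mul ℝ ℝ) hkc hzc

lemma conv_close {z : Euc N → ℝ} (hz : Continuous z) (hzc : HasCompactSupport z) {ε : ℝ} (hε : 0 < ε) :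
    ∃ δ > 0, ∀ k : Euc N → ℝ, ContDiff ℝ ∞ k → HasCompactSupport k → (∀ y, 0 ≤ k y) →
      (∫ y, k y = 1) → (∀ y, k y ≠ 0 → ‖y‖ ≤ δ) → ∀ x, |(∫ y, k y * z (x - y)) - z x| ≤ ε := by
  obtain ⟨δ, hδ, h⟩ := Metric.uniformContinuous_iff.1 (hzc.uniformContinuous_of_continuous hz) ε hε
  refine ⟨δ / 2, by linarith, fun k hk hkc hk0 hk1 hkδ x => ?_⟩
  have := conv_abs_sub_le hk.continuous hkc hk0 hk1 hz continuous_const (h' := fun _ => z x) x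
    (c := ε) fun y hy => by
      have := @h (x - y) x (by rw [dist_eq_norm]; simpa using (hkδ y hy).trans_lt (by linarith))
      rw [Real.dist_eq] at this
      exact this.le
  rwa [integral_mul_const, hk1, one_mul] at this

lemma grad_ineq {m : ℝ} (hm : 2 < m) (a p : Euc N) :
    ‖p‖ ^ m + (inner ℝ ((m * ‖p‖ ^ (m - 2)) • p) a - inner ℝ ((m * ‖p‖ ^ (m - 2)) • p) p) ≤ ‖a‖ ^ m := by
  by_cases hp : p = 0
  · subst hp
    simp only [norm_zero, smul_zero, inner_zero_left, sub_self, add_zero]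
    rw [Real.zero_rpow (by linarith)]; positivity
  · have hp0 : 0 < ‖p‖ := norm_pos_iff.2 hp
    have h1 := rpow_sub_le (m := m) (a := ‖p‖) (b := ‖a‖) (by linarith) (norm_nonneg _) hp0
    rw [inner_smul_left, inner_smul_left, real_inner_self_eq_norm_sq]
    simp only [conj_trivial]
    have h2 : inner ℝ p a ≤ ‖p‖ * ‖a‖ := real_inner_le_norm p a
    have h3 : ‖p‖ ^ (m - 1) = ‖p‖ ^ (m - 2) * ‖p‖ := by
      rw [← Real.rpow_add_one hp0.ne']; congr 1; ring
    rw [h3] at h1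
    have h4 : m * ‖p‖ ^ (m - 2) * inner ℝ p a ≤ m * ‖p‖ ^ (m - 2) * (‖p‖ * ‖a‖) :=
      mul_le_mul_of_nonneg_left h2 (by positivity)
    nlinarith

lemma visc_SSub {Ω : Set (Euc N)} {m : ℝ} (hm : 2 < m) (hΩo : IsOpen Ω) {g v : Euc N → ℝ}
    (hv : ContinuousOn v Ω) (hg : ContinuousOn g Ω)
    (hsub : ∀ φ, ContDiff ℝ 2 φ → ∀ x ∈ Ω, IsLocalMaxOn (v - φ) Ω x → Ham m φ x ≤ g x) :
    SSub Ω m g v := by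
  intro K hK hKΩ ε hε
  obtain ⟨δ1, hδ1, hK1⟩ := hK.exists_cthickening_subset_open hΩo hKΩ
  have hKc : IsCompact (cthickening δ1 K) := hK.cthickening
  obtain ⟨χ, hχ1, hχc, hχΩ, -⟩ := exists_continuousMap_one_of_isCompact_subset_isOpen hKc hΩo hK1
  set z : Euc N → ℝ := fun x => χ x * v x with hz
  have hts : tsupport z ⊆ tsupport χ := tsupport_mul_subset_left
  have hzcs : HasCompactSupport z := hχc.of_isClosed_subset (isClosed_tsupport _) hts
  have hzc : Continuous z := by
    have : ContinuousOn z Ω := χ.continuous.continuousOn.mul hv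
    exact this.continuous_of_tsupport_subset hΩo (hts.trans hχΩ)
  have hzv : ∀ x ∈ cthickening δ1 K, z x = v x := fun x hx => by
    simp only [hz, hχ1 hx, Pi.one_apply, one_mul]
  obtain ⟨M, hM⟩ := hzcs.exists_bound_of_continuous hzc
  have hM0 : 0 ≤ M := (norm_nonneg _).trans (hM 0)
  obtain ⟨δ2, hδ2, hg2⟩ := Metric.uniformContinuousOn_iff.1
    (hKc.uniformContinuousOn_of_continuous (hg.mono hK1)) ε hε
  obtain ⟨δ0, hδ0, hcl⟩ := conv_close hzc hzcs hε
  set R := min δ1 δ2 with hR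
  have hR0 : 0 < R := lt_min hδ1 hδ2
  set δ := min δ0 (R / 2) with hδ
  have hδ' : 0 < δ := lt_min hδ0 (by linarith)
  obtain ⟨k, hk, hkc, hk0, hk1, hkδ⟩ := exists_kernel (N := N) hδ'
  have hZ := conv_smooth hk hkc hzc
  have hZ2 : ContDiff ℝ 2 fun x => ∫ y, k y * z (x - y) := contDiff_infty.1 hZ 2
  refine ⟨_, hZ2, fun x hx => ⟨?_, ?_⟩⟩
  · have := hcl k hk hkc hk0 hk1 (fun y hy => (hkδ y hy).trans (min_le_left _ _)) x
    rwa [hzv x (self_subset_cthickening K hx)] at this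
  · set Z : Euc N → ℝ := fun x => ∫ y, k y * z (x - y) with hZd
    set p := gradient Z x with hp
    set q : Euc N := (m * ‖p‖ ^ (m - 2)) • p with hq
    have happ : ∀ om > 0, ∃ zη : Euc N → ℝ, ContDiff ℝ ∞ zη ∧ HasCompactSupport zη ∧
        ∀ x, |zη x - z x| ≤ om := by
      intro om hom
      obtain ⟨δ', hδ', hcl'⟩ := conv_close hzc hzcs hom
      obtain ⟨k', hk', hkc', hk0', hk1', hkδ'⟩ := exists_kernel (N := N) hδ'
      exact ⟨_, conv_smooth hk' hkc' hzc, conv_compact hkc' hzcs, hcl' k' hk' hkc' hk0' hk1' hkδ'⟩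
    have key := linear_vm (q := q) (x := x) (R := R) (δ := δ)
      (C := g x + ε + inner ℝ q p - ‖p‖ ^ m) (M := M) ((min_le_right _ _).trans_lt (by linarith)) hM0 hzc
      (fun x => hM x) happ hk hkc hk0 hk1 hkδ hZ2 (fun x1 hx1 φ p1 l hj hmax => ?_)
    · rw [Lop] at key
      rw [Ham]
      linarith
    · obtain ⟨ψ, hψ, hψφ⟩ := exists_global_C2 hj.1
      have jψ : Jet ψ x1 p1 l := hj.congr hψφ
      rw [mem_ball] at hx1
      have hx1t : x1 ∈ thickening δ1 K :=
        mem_thickening_iff.2 ⟨x, hx, hx1.trans_le (min_le_left _ _)⟩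
      have hx1c := thickening_subset_cthickening _ _ hx1t
      have hmax' : IsLocalMaxOn (v - ψ) Ω x1 := by
        apply IsLocalMax.on
        filter_upwards [hmax, hψφ, isOpen_thickening.mem_nhds hx1t] with y h1 h2 h3
        have e1 := hzv y (thickening_subset_cthickening _ _ h3)
        have e2 := hzv x1 hx1c
        have e3 := hψφ.self_of_nhds
        simp only [Pi.sub_apply]
        rw [h2, e3, ← e1, ← e2]
        exact h1
      have h1 := hsub ψ hψ x1 (hK1 hx1c) hmax'
      rw [jψ.ham] at h1
      have h2 := hg2 x1 hx1c x (self_subset_cthickening K hx) (hx1.trans_le (min_le_right _ _))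
      rw [Real.dist_eq] at h2
      have h3 := (abs_lt.1 h2).2
      have h4 := grad_ineq hm p1 p
      rw [← hq] at h4
      linarith

end linearVM2



section uniqueness

variable {N : ℕ} {Ω : Set (Euc N)} {m : ℝ}

/-- gradient bound at a touching point from below for a locally Lipschitz function -/
lemma grad_le_lip {v χ : Euc N → ℝ} {x p : Euc N} {l L : ℝ} (hL0 : 0 ≤ L) (j : Jet χ x p l)
    (hL : ∀ᶠ y in 𝓝 x, |v y - v x| ≤ L * ‖y - x‖)
    (hmin : IsLocalMin (fun y => v y - χ y) x) : ‖p‖ ≤ L := by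
  by_cases hp : p = 0
  · rw [hp, norm_zero]; exact hL0
  · have hp0 : 0 < ‖p‖ := norm_pos_iff.2 hp
    have hd : HasDerivAt (fun t : ℝ => χ (x + t • p)) (‖p‖ ^ 2) 0 := by
      have h1 : HasDerivAt (fun t : ℝ => x + t • p) p 0 := by
        simpa using ((hasDerivAt_id (0:ℝ)).smul_const p).const_add x
      have h2 : HasFDerivAt χ (innerSL ℝ p) (x + (0:ℝ) • p) := by simpa using j.hasFDerivAt
      have h3 := h2.comp_hasDerivAt (0:ℝ) h1
      simpa [Function.comp_def, real_inner_self_eq_norm_sq] using h3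
    have hs := (hasDerivAt_iff_tendsto_slope_zero.1 hd).mono_left
      (nhdsWithin_mono (0:ℝ) (fun t (ht : (0:ℝ) < t) => ht.ne') : 𝓝[>] (0:ℝ) ≤ 𝓝[≠] 0)
    have h1 : Tendsto (fun t : ℝ => x + t • p) (𝓝[>] 0) (𝓝 x) := by
      have : Continuous fun t : ℝ => x + t • p := by fun_prop
      have h2 := (this.tendsto 0).mono_left (nhdsWithin_le_nhds (s := Ioi 0))
      simpa using h2
    have hle : ‖p‖ ^ 2 ≤ L * ‖p‖ := by
      refine le_of_tendsto hs ?_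
      filter_upwards [h1.eventually hL, h1.eventually hmin, self_mem_nhdsWithin] with t e1 e2 e3
      have e3' : (0:ℝ) < t := e3
      rw [add_sub_cancel_left, norm_smul, Real.norm_of_nonneg e3'.le] at e1
      simp only [zero_add, zero_smul, add_zero, smul_eq_mul]
      rw [inv_mul_le_iff₀ e3']
      have := (abs_le.1 e1).2
      linarith
    nlinarith

lemma touch_ineq (hm : 2 < m) (hΩo : IsOpen Ω) {g v φ b : Euc N → ℝ} (hv : SCSuper Ω m g v)
    {x p1 p2 : Euc N} {l1 l2 L : ℝ} (hx : x ∈ Ω) (hL0 : 0 ≤ L) (j1 : Jet φ x p1 l1)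
    (j2 : Jet b x p2 l2) (hL : ∀ᶠ y in 𝓝 x, |v y - v x| ≤ L * ‖y - x‖)
    (hmin : IsLocalMin (fun y => v y - (φ y + b y)) x) :
    g x ≤ (-l1 + ‖p1‖ ^ m) - l2 + m * L ^ (m - 1) * ‖p2‖ := by
  have hP := grad_le_lip hL0 (j1.add j2) hL hmin
  have h1 := hv.jet (subset_closure hx) (j1.add j2) (hmin.on _)
  have h2 : ‖p1 + p2‖ ^ m ≤ ‖p1‖ ^ m + m * L ^ (m - 1) * ‖p2‖ := by
    by_cases h0 : ‖p1 + p2‖ = 0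
    · rw [h0, Real.zero_rpow (by linarith)]
      positivity
    · have hpos : 0 < ‖p1 + p2‖ := lt_of_le_of_ne (norm_nonneg _) (Ne.symm h0)
      have h3 := rpow_sub_le (m := m) (a := ‖p1 + p2‖) (b := ‖p1‖) (by linarith) (norm_nonneg _) hpos
      have h4 : ‖p1 + p2‖ ^ (m - 1) ≤ L ^ (m - 1) :=
        Real.rpow_le_rpow (norm_nonneg _) hP (by linarith)
      have h5 : ‖p1 + p2‖ - ‖p1‖ ≤ ‖p2‖ := by linarith [norm_add_le p1 p2]
      have h6 : m * ‖p1 + p2‖ ^ (m - 1) * (‖p1 + p2‖ - ‖p1‖) ≤ m * ‖p1 + p2‖ ^ (m - 1) * ‖p2‖ :=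
        mul_le_mul_of_nonneg_left h5 (by positivity)
      have h7 : m * ‖p1 + p2‖ ^ (m - 1) * ‖p2‖ ≤ m * L ^ (m - 1) * ‖p2‖ := by gcongr
      linarith
  linarith

lemma lip_on_compact (hΩo : IsOpen Ω) {v : Euc N → ℝ} (hv : LocLipIn Ω v) {K : Set (Euc N)}
    (hK : IsCompact K) (hKΩ : K ⊆ Ω) :
    ∃ L, 0 ≤ L ∧ ∀ x ∈ K, ∀ᶠ y in 𝓝 x, |v y - v x| ≤ L * ‖y - x‖ := by
  refine hK.induction_on (p := fun S => ∃ L, 0 ≤ L ∧ ∀ x ∈ S, ∀ᶠ y in 𝓝 x, |v y - v x| ≤ L * ‖y - x‖)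
    ⟨0, le_rfl, by simp⟩ ?_ ?_ ?_
  · rintro S T hST ⟨L, hL, h⟩
    exact ⟨L, hL, fun x hx => h x (hST hx)⟩
  · rintro S T ⟨L, hL, h⟩ ⟨L', hL', h'⟩
    refine ⟨L + L', by linarith, fun x hx => ?_⟩
    rcases hx with hx | hx
    · filter_upwards [h x hx] with y hy
      nlinarith [norm_nonneg (y - x)]
    · filter_upwards [h' x hx] with y hy
      nlinarith [norm_nonneg (y - x)]
  · intro x hx
    obtain ⟨ε, hε, L, hL, h⟩ := hv x (hKΩ hx)
    have ho : IsOpen (ball x ε ∩ Ω) := isOpen_ball.inter hΩo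
    refine ⟨ball x ε ∩ Ω, mem_nhdsWithin_of_mem_nhds (ho.mem_nhds ⟨mem_ball_self hε, hKΩ hx⟩), L, hL,
      fun y hy => ?_⟩
    filter_upwards [ho.mem_nhds hy] with w hw using h w hw y hy


lemma interior_contact (hm : 2 < m) (hΩo : IsOpen Ω) {g1 g2 u v b l : Euc N → ℝ}
    {p : Euc N → Euc N} {L β γ : ℝ} {K : Set (Euc N)} {x1 : Euc N}
    (hS : SSub Ω m g1 u) (hv : SCSuper Ω m g2 v) (hvc : ContinuousOn v (closure Ω))
    (hK : IsCompact K) (hKΩ : K ⊆ Ω) (hL0 : 0 ≤ L)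
    (hL : ∀ x ∈ K, ∀ᶠ y in 𝓝 x, |v y - v x| ≤ L * ‖y - x‖)
    (hb : ∀ x ∈ K, Jet b x (p x) (l x)) (hβ : 0 < β)
    (hβ2 : ∀ x ∈ K, β ≤ g2 x - g1 x + l x - m * L ^ (m - 1) * ‖p x‖)
    (hx1 : x1 ∈ K) (hγ : 0 < γ)
    (hbd : ∀ x ∈ K, x ∉ interior K → u x + b x - v x ≤ u x1 + b x1 - v x1 - γ) : False := by
  obtain ⟨φ, hφ, hφK⟩ := hS K hK hKΩ (min (γ / 4) (β / 2)) (by positivity)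
  have e1 : min (γ / 4) (β / 2) ≤ γ / 4 := min_le_left _ _
  have e2 : min (γ / 4) (β / 2) ≤ β / 2 := min_le_right _ _
  have hcont : ContinuousOn (fun x => v x - (φ x + b x)) K := by
    refine (hvc.mono (hKΩ.trans subset_closure)).sub (hφ.continuous.continuousOn.add ?_)
    intro x hx
    exact (hb x hx).1.continuousAt.continuousWithinAt
  obtain ⟨x, hx, hmin⟩ := hK.exists_isMinOn ⟨x1, hx1⟩ hcont
  have h1 := abs_le.1 (hφK x hx).1
  have h2 := abs_le.1 (hφK x1 hx1).1
  have h3 : v x - (φ x + b x) ≤ v x1 - (φ x1 + b x1) := hmin hx1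
  by_cases hi : x ∈ interior K
  · have hlm : IsLocalMin (fun y => v y - (φ y + b y)) x :=
      hmin.isLocalMin (mem_interior_iff_mem_nhds.1 hi)
    have h4 := touch_ineq hm hΩo hv (hKΩ hx) hL0 (Jet.of_contDiff (x := x) hφ) (hb x hx) (hL x hx) hlm
    have h5 : -lapl φ x + ‖gradient φ x‖ ^ m ≤ _ := (hφK x hx).2
    have h6 := hβ2 x hx
    linarith
  · have := hbd x hx hi
    linarith

lemma smp_ball (hm : 2 < m) (hΩo : IsOpen Ω) {g1 g2 u v : Euc N → ℝ} {M R : ℝ} {y : Euc N}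
    (hS : SSub Ω m g1 u) (hv : SCSuper Ω m g2 v) (huc : ContinuousOn u (closure Ω))
    (hvc : ContinuousOn v (closure Ω)) (hvl : LocLipIn Ω v) (hg : ∀ x ∈ Ω, g1 x ≤ g2 x)
    (hM : ∀ x ∈ closure Ω, u x - v x ≤ M) (hR : 0 < R) (hB : closedBall y R ⊆ Ω)
    (hy : u y - v y < M) : ∀ x ∈ ball y R, u x - v x < M := by
  obtain ⟨L, hL0, hL⟩ := lip_on_compact hΩo hvl (isCompact_closedBall y R) hB
  have hyΩ : y ∈ Ω := hB (mem_closedBall_self hR.le)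
  have hca : ContinuousAt (fun x => u x - v x) y :=
    (huc.sub hvc).continuousAt (mem_of_superset (hΩo.mem_nhds hyΩ) subset_closure)
  set γ0 := (M - (u y - v y)) / 2 with hγ0
  have hγ0p : 0 < γ0 := by rw [hγ0]; linarith
  obtain ⟨r, hr, hrb⟩ := Metric.eventually_nhds_iff_ball.1
    (hca.eventually (gt_mem_nhds (show u y - v y < M - γ0 by rw [hγ0]; linarith)))
  set r' := min (r / 2) (R / 2) with hr'
  have hr'p : 0 < r' := by positivity
  have hr'1 : r' ≤ r / 2 := min_le_left _ _
  have hr'2 : r' ≤ R / 2 := min_le_right _ _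
  have hin : ∀ x, dist x y ≤ r' → u x - v x < M - γ0 := fun x hx =>
    hrb x (by rw [mem_ball]; linarith)
  set κ := m * L ^ (m - 1) with hκ
  have hκ0 : 0 ≤ κ := by positivity
  set a := (2 * N + 2 * κ * R + 1) / (4 * r' ^ 2) with ha
  have ha0 : 0 < a := by positivity
  have har : 4 * a * r' ^ 2 = 2 * N + 2 * κ * R + 1 := by rw [ha]; field_simp
  set K := closedBall y R \ ball y r' with hK
  have hKc : IsCompact K := (isCompact_closedBall y R).diff isOpen_ball
  have hKΩ : K ⊆ Ω := sdiff_subset.trans hB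
  set b : Euc N → ℝ := fun x => γ0 * (Real.exp (-a * ‖x - y‖ ^ 2) - Real.exp (-a * R ^ 2)) with hbdef
  have hjb : ∀ x : Euc N, Jet b x (γ0 • ((-a * Real.exp (-a * ‖x - y‖ ^ 2)) • ((2:ℝ) • (x - y))))
      (γ0 * ((a ^ 2 * Real.exp (-a * ‖x - y‖ ^ 2)) * ‖(2:ℝ) • (x - y)‖ ^ 2 +
        (-a * Real.exp (-a * ‖x - y‖ ^ 2)) * (2 * N))) := by
    intro x
    have hd : ∀ s : ℝ, HasDerivAt (fun s => Real.exp (-a * s)) (-a * Real.exp (-a * s)) s := by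
      intro s
      have := ((hasDerivAt_id s).const_mul (-a)).exp
      simpa [mul_comm] using this
    have hd2 : ∀ s : ℝ, HasDerivAt (fun s => -a * Real.exp (-a * s)) (a ^ 2 * Real.exp (-a * s)) s := by
      intro s
      have := (hd s).const_mul (-a)
      exact this.congr_deriv (by ring)
    have j := (Jet.normSq y x).comp (F := fun s => Real.exp (-a * s))
      (F1 := fun s => -a * Real.exp (-a * s)) (F2 := a ^ 2 * Real.exp (-a * ‖x - y‖ ^ 2)) rfl
      (by fun_prop) (Eventually.of_forall hd) (hd2 _)
    exact (j.sub_const _).const_mul γ0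
  intro x1 hx1
  rw [mem_ball] at hx1
  by_cases hx1r : dist x1 y ≤ r'
  · linarith [hin x1 hx1r]
  push Not at hx1r
  have hx1K : x1 ∈ K := ⟨mem_closedBall.2 hx1.le, by rw [mem_ball]; linarith⟩
  have hb1 : 0 < b x1 := by
    refine mul_pos hγ0p (sub_pos.2 (Real.exp_lt_exp.2 ?_))
    rw [dist_eq_norm] at hx1
    have : ‖x1 - y‖ ^ 2 < R ^ 2 := by gcongr
    nlinarith
  by_contra! hcon
  refine interior_contact (x1 := x1) (β := γ0 * (a * Real.exp (-a * R ^ 2))) (γ := b x1) hm hΩo hS hv hvc hKc hKΩ hL0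
    (fun x hx => hL x hx.1) (fun x _ => hjb x) (by positivity) ?_ hx1K hb1 ?_
  · intro x hx
    have hxR : ‖x - y‖ ≤ R := by have := hx.1; rwa [mem_closedBall, dist_eq_norm] at this
    have hxr : r' ≤ ‖x - y‖ := by have := hx.2; rwa [mem_ball, dist_eq_norm, not_lt] at this
    have hgx := hg x (hKΩ hx)
    set E := Real.exp (-a * ‖x - y‖ ^ 2) with hE
    have hE0 : 0 < E := Real.exp_pos _
    have hEge : Real.exp (-a * R ^ 2) ≤ E := by
      refine Real.exp_le_exp.2 ?_
      have : ‖x - y‖ ^ 2 ≤ R ^ 2 := by gcongr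
      nlinarith
    have hn1 : ‖γ0 • ((-a * E) • ((2:ℝ) • (x - y)))‖ = γ0 * (a * E * (2 * ‖x - y‖)) := by
      rw [norm_smul, norm_smul, norm_smul, Real.norm_of_nonneg hγ0p.le, neg_mul, norm_neg,
        Real.norm_of_nonneg (by positivity : 0 ≤ a * E)]
      norm_num
    have hn2 : ‖(2:ℝ) • (x - y)‖ ^ 2 = 4 * ‖x - y‖ ^ 2 := by
      rw [norm_smul, mul_pow]; norm_num
    rw [hn1, hn2]
    have k1 : a * r' ^ 2 ≤ a * ‖x - y‖ ^ 2 := by gcongr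
    have k2 : κ * ‖x - y‖ ≤ κ * R := by gcongr
    have k3 : 1 ≤ 4 * (a * ‖x - y‖ ^ 2) - 2 * N - 2 * (κ * ‖x - y‖) := by linarith
    have k4 : γ0 * (a * Real.exp (-a * R ^ 2)) ≤ γ0 * (a * E) := by gcongr
    have k5 : γ0 * (a * E) * 1 ≤ γ0 * (a * E) * (4 * (a * ‖x - y‖ ^ 2) - 2 * N - 2 * (κ * ‖x - y‖)) :=
      mul_le_mul_of_nonneg_left k3 (by positivity)
    have k6 : γ0 * (a ^ 2 * E * (4 * ‖x - y‖ ^ 2) + -a * E * (2 * N)) - κ * (γ0 * (a * E * (2 * ‖x - y‖)))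
      = γ0 * (a * E) * (4 * (a * ‖x - y‖ ^ 2) - 2 * N - 2 * (κ * ‖x - y‖)) := by ring
    linarith
  · intro x hx hxi
    suffices h : u x + b x - v x ≤ M by linarith
    have hxc : x ∈ closure Ω := subset_closure (hKΩ hx)
    have hxR : dist x y ≤ R := hx.1
    have hxr : r' ≤ dist x y := by have := hx.2; rwa [mem_ball, not_lt] at this
    by_cases h1 : dist x y = r'
    · have h2 := hin x h1.le
      have h3 : b x ≤ γ0 := by
        have e1 : Real.exp (-a * ‖x - y‖ ^ 2) ≤ 1 := Real.exp_le_one_iff.2 (by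
          have : 0 ≤ a * ‖x - y‖ ^ 2 := by positivity
          linarith)
        have e2 := Real.exp_pos (-a * R ^ 2)
        simp only [hbdef]
        nlinarith
      linarith
    · by_cases h2 : dist x y = R
      · have : b x = 0 := by
          simp only [hbdef]
          rw [← dist_eq_norm, h2]; ring
        linarith [hM x hxc]
      · exfalso
        apply hxi
        refine mem_interior.2 ⟨ball y R ∩ (closedBall y r')ᶜ, ?_, isOpen_ball.inter isClosed_closedBall.isOpen_compl,
          lt_of_le_of_ne hxR h2, ?_⟩
        · rintro z ⟨hz1, hz2⟩
          exact ⟨ball_subset_closedBall hz1, fun h => hz2 (ball_subset_closedBall h)⟩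
        · rw [mem_compl_iff, mem_closedBall, not_le]
          exact lt_of_le_of_ne hxr (Ne.symm h1)

/-- strong maximum principle in connected domains -/
lemma smp (hm : 2 < m) (hΩo : IsOpen Ω) (hΩc : IsConnected Ω) {g1 g2 u v : Euc N → ℝ} {M : ℝ}
    (hS : SSub Ω m g1 u) (hv : SCSuper Ω m g2 v) (huc : ContinuousOn u (closure Ω))
    (hvc : ContinuousOn v (closure Ω)) (hvl : LocLipIn Ω v) (hg : ∀ x ∈ Ω, g1 x ≤ g2 x)
    (hM : ∀ x ∈ closure Ω, u x - v x ≤ M) {x0 : Euc N} (hx0 : x0 ∈ Ω) (hx0M : u x0 - v x0 = M) :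
    ∀ x ∈ closure Ω, u x - v x = M := by
  have hc : ContinuousOn (fun x => u x - v x) (closure Ω) := huc.sub hvc
  set U := Ω ∩ {x | u x - v x < M} with hU
  have hUo : IsOpen U := (hc.mono subset_closure).isOpen_inter_preimage hΩo isOpen_Iio
  have hcl : closure U ∩ Ω ⊆ U := by
    rintro x ⟨hx, hxΩ⟩
    obtain ⟨r, hr, hrb⟩ := Metric.isOpen_iff.1 hΩo x hxΩ
    obtain ⟨y, hyU, hxy⟩ := Metric.mem_closure_iff.1 hx (r / 3) (by positivity)
    refine ⟨hxΩ, smp_ball hm hΩo hS hv huc hvc hvl hg hM (R := r / 2) (y := y) (by positivity) ?_ hyU.2 x ?_⟩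
    · intro z hz
      apply hrb
      rw [mem_closedBall] at hz
      rw [mem_ball]
      have := dist_triangle z y x
      rw [dist_comm] at hxy
      linarith
    · rw [mem_ball]; linarith
  have hΩM : ∀ x ∈ Ω, u x - v x = M := by
    intro x hx
    by_contra hne
    have hxU : x ∈ U := ⟨hx, lt_of_le_of_ne (hM x (subset_closure hx)) hne⟩
    have := hΩc.isPreconnected.subset_of_closure_inter_subset hUo ⟨x, hx, hxU⟩ hcl
    exact (this hx0).2.ne hx0M
  intro x hx
  have : EqOn (fun x => u x - v x) (fun _ => M) (closure Ω) :=
    EqOn.of_subset_closure hΩM hc continuousOn_const subset_closure subset_rfl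
  exact this hx

lemma const_le (hm : 2 < m) (hΩo : IsOpen Ω) {f u v : Euc N → ℝ} {M c c' : ℝ}
    (hS : SSub Ω m (fun x => f x + c) u) (hv : SCSuper Ω m (fun x => f x + c') v)
    (hvc : ContinuousOn v (closure Ω)) (hvl : LocLipIn Ω v) {x1 : Euc N} (hx1 : x1 ∈ Ω)
    (hM : ∀ x ∈ Ω, u x - v x = M) : c' ≤ c := by
  by_contra! hcc
  obtain ⟨r, hr, hrb⟩ := Metric.isOpen_iff.1 hΩo x1 hx1
  set R := r / 2 with hR
  have hR0 : 0 < R := by positivity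
  have hB : closedBall x1 R ⊆ Ω := (closedBall_subset_ball (by linarith)).trans hrb
  obtain ⟨L, hL0, hL⟩ := lip_on_compact hΩo hvl (isCompact_closedBall x1 R) hB
  set κ := m * L ^ (m - 1) with hκ
  have hκ0 : 0 ≤ κ := by positivity
  set T : ℝ := 2 * N + 2 * κ * R + 1 with hT
  have hT0 : 0 < T := by positivity
  have hd : 0 < c' - c := by linarith
  set η := (c' - c) / (2 * T) with hη
  have hη0 : 0 < η := by positivity
  have hηT : η * T = (c' - c) / 2 := by rw [hη]; field_simp
  refine interior_contact (x1 := x1) (β := (c' - c) / 2) (γ := η * R ^ 2)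
    (b := fun x => (-η) * ‖x - x1‖ ^ 2) hm hΩo hS hv hvc
    (isCompact_closedBall x1 R) hB hL0 hL (fun x _ => (Jet.normSq x1 x).const_mul (-η)) (by positivity) ?_
    (mem_closedBall_self hR0.le) (by positivity) ?_
  · intro x hx
    rw [mem_closedBall, dist_eq_norm] at hx
    have e1 : ‖(-η) • (2:ℝ) • (x - x1)‖ = η * (2 * ‖x - x1‖) := by
      rw [norm_smul, norm_smul, norm_neg, Real.norm_of_nonneg hη0.le]; norm_num
    rw [e1]
    have k : η * (κ * ‖x - x1‖) ≤ η * (κ * R) := by gcongr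
    have : η * T = 2 * (η * N) + 2 * (η * (κ * R)) + η := by rw [hT]; ring
    nlinarith
  · intro x hx hxi
    have hxd : dist x x1 = R := by
      by_contra hne
      exact hxi (ball_subset_interior_closedBall (lt_of_le_of_ne hx hne))
    have e1 := hM x (hB hx)
    have e2 := hM x1 hx1
    rw [← dist_eq_norm, hxd]
    simp
    linarith

end uniqueness



section boundary

variable {N : ℕ} {Ω : Set (Euc N)} {m : ℝ}

/-- a strict subsolution near a boundary point -/
lemma boundary_barrier (hm : 2 < m) (hΩo : IsOpen Ω) (h2 : HasC2Boundary Ω) {z : Euc N}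
    (hz : z ∈ frontier Ω) {S Mg r : ℝ} (hS0 : 0 ≤ S) (hMg : 0 ≤ Mg) (hr : 0 < r) :
    ∃ (ρ ψ : Euc N → ℝ) (r1 δ : ℝ) (p : Euc N → Euc N) (l : Euc N → ℝ), Continuous ρ ∧ Continuous ψ ∧
      0 < r1 ∧ r1 < r ∧ 0 < δ ∧
      (∀ x ∈ closure Ω, ρ x < 0 → x ∈ Ω) ∧ ρ z = 0 ∧ ψ z = 0 ∧
      (∀ x ∈ closure Ω, -δ ≤ ρ x → ψ x ≤ 1 / 2) ∧
      (∀ x ∈ closure Ω, -δ ≤ ρ x → dist x z = r1 → ψ x ≤ -2 * S - 1 / 2) ∧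
      (∀ x, Jet ψ x (p x) (l x)) ∧
      (∀ x ∈ closure Ω, -δ ≤ ρ x → dist x z ≤ r1 → -l x + ‖p x‖ ^ m ≤ -Mg - 1) := by
  obtain ⟨ρ, hρ, hΩeq, hfr, hgrad⟩ := h2
  have hρz : ρ z = 0 := by rw [hfr] at hz; exact hz
  have hρle : ∀ x ∈ closure Ω, ρ x ≤ 0 := by
    intro x hx
    rcases mem_closure_cases hΩo hx with h | h
    · rw [hΩeq] at h; exact le_of_lt h
    · rw [hfr] at h; exact le_of_eq h
  have hn : 0 < ‖gradient ρ z‖ := norm_pos_iff.2 (hgrad z hz)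
  set g0 := ‖gradient ρ z‖ / 2 with hg0
  set G := ‖gradient ρ z‖ + 1 with hG
  set H := |lapl ρ z| + 1 with hH
  have hg0p : 0 < g0 := by positivity
  have hGp : 0 < G := by positivity
  have hHp : 0 < H := by positivity
  have c1 : Tendsto (fun x => ‖gradient ρ x‖) (𝓝 z) (𝓝 ‖gradient ρ z‖) :=
    (continuous_gradient hρ).norm.tendsto z
  have c2 : Tendsto (fun x => |lapl ρ x|) (𝓝 z) (𝓝 |lapl ρ z|) :=
    (continuous_lapl hρ).abs.tendsto z
  obtain ⟨r2, hr2, hr2b⟩ := Metric.eventually_nhds_iff_ball.1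
    ((c1.eventually (lt_mem_nhds (show g0 < ‖gradient ρ z‖ by linarith))).and
      ((c1.eventually (gt_mem_nhds (show ‖gradient ρ z‖ < G by linarith))).and
        (c2.eventually (gt_mem_nhds (show |lapl ρ z| < H by linarith)))))
  set r1 := min (r / 2) (r2 / 2) with hr1
  have hr1p : 0 < r1 := by positivity
  have hr1r : r1 ≤ r / 2 := min_le_left _ _
  have hr1r2 : r1 ≤ r2 / 2 := min_le_right _ _
  set B := (2 * S + 1) / r1 ^ 2 with hB
  have hBp : 0 < B := by positivity
  have hBr : B * r1 ^ 2 = 2 * S + 1 := by rw [hB]; field_simp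
  set X := H + 2 * B * N + (G + 2 * B * r1) ^ m + Mg + 1 with hX
  have hXp : 0 < X := by positivity
  set A := X / g0 ^ 2 with hA
  have hAp : 0 < A := by positivity
  have hAg : A * g0 ^ 2 = X := by rw [hA]; field_simp
  set δ := 1 / (A + 1) with hδ
  have hδp : 0 < δ := by positivity
  have hδ1 : δ ≤ 1 := by rw [hδ, div_le_one (by linarith)]; linarith
  have hAδ : A * δ ≤ 1 := by
    rw [hδ, mul_one_div, div_le_one (by linarith)]; linarith
  have hsq : ∀ x ∈ closure Ω, -δ ≤ ρ x → A / 2 * ρ x ^ 2 ≤ 1 / 2 := by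
    intro x hx hx2
    have h1 := hρle x hx
    have h3 : ρ x ^ 2 ≤ δ ^ 2 := by nlinarith
    have h4 : A / 2 * ρ x ^ 2 ≤ A / 2 * δ ^ 2 := by gcongr
    nlinarith
  refine ⟨ρ, fun x => A / 2 * ρ x ^ 2 - B * ‖x - z‖ ^ 2, r1, δ,
    fun x => (A * ρ x) • gradient ρ x - B • ((2:ℝ) • (x - z)),
    fun x => (A * ‖gradient ρ x‖ ^ 2 + (A * ρ x) * lapl ρ x) - B * (2 * N), hρ.continuous, ?_, hr1p,
    by linarith, hδp, ?_, hρz, ?_, ?_, ?_, ?_, ?_⟩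
  · have := hρ.continuous
    fun_prop
  · intro x _ hx; rw [hΩeq]; exact hx
  · simp [hρz]
  · intro x hx hx2
    have := hsq x hx hx2
    have : 0 ≤ B * ‖x - z‖ ^ 2 := by positivity
    linarith
  · intro x hx hx2 hd
    have := hsq x hx hx2
    rw [dist_eq_norm] at hd
    simp only [hd, hBr]
    linarith
  · intro x
    have j := (Jet.of_contDiff (x := x) hρ).comp (F := fun s => A / 2 * s ^ 2)
      (F1 := fun s => A * s) (F2 := A) rfl (by fun_prop)
      (Eventually.of_forall fun s => by
        have := (hasDerivAt_pow 2 s).const_mul (A / 2)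
        exact this.congr_deriv (by push_cast; ring))
      (by simpa using (hasDerivAt_id (ρ x)).const_mul A)
    exact j.sub ((Jet.normSq z x).const_mul B)
  · intro x hx hx2 hd
    obtain ⟨e1, e2, e3⟩ := hr2b x (by rw [mem_ball]; linarith)
    have h1 := hρle x hx
    have hab : |A * ρ x| ≤ 1 := by
      rw [abs_le]
      constructor
      · nlinarith
      · nlinarith
    have hp : ‖(A * ρ x) • gradient ρ x - B • ((2:ℝ) • (x - z))‖ ≤ G + 2 * B * r1 := by
      refine (norm_sub_le _ _).trans ?_
      rw [norm_smul, norm_smul, norm_smul, Real.norm_of_nonneg hBp.le, Real.norm_eq_abs, ← dist_eq_norm,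
        Real.norm_of_nonneg (by norm_num : (0:ℝ) ≤ 2)]
      have k1 : |A * ρ x| * ‖gradient ρ x‖ ≤ 1 * G := by gcongr
      have k2 : B * (2 * dist x z) ≤ B * (2 * r1) := by gcongr
      linarith
    have hpm := Real.rpow_le_rpow (norm_nonneg _) hp (by linarith : 0 ≤ m)
    have k3 : A * g0 ^ 2 ≤ A * ‖gradient ρ x‖ ^ 2 := by gcongr
    have k4 : -(A * ρ x * lapl ρ x) ≤ H := by
      have : |A * ρ x * lapl ρ x| ≤ 1 * H := by
        rw [abs_mul]; gcongr
      have := neg_le_abs (A * ρ x * lapl ρ x)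
      linarith
    simp only
    linarith

lemma jet_shift {φ : Euc N → ℝ} (hφ : ContDiff ℝ 2 φ) (w x : Euc N) :
    Jet (fun y => φ (y + w)) x (gradient φ (x + w)) (lapl φ (x + w)) := by
  have j := Jet.comp_isom (x := x) (LinearIsometryEquiv.refl ℝ (Euc N)) 0 w
    (Jet.of_contDiff hφ)
  have e : w + (LinearIsometryEquiv.refl ℝ (Euc N)) (x - 0) = x + w := by
    simp [add_comm]
  rw [e] at j
  refine Jet.congr j (Eventually.of_forall fun y => ?_)
  simp [add_comm]

set_option maxHeartbeats 1000000 in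
lemma boundary_step (hm : 2 < m) (hΩo : IsOpen Ω) (hΩb : Bornology.IsBounded Ω)
    (h2 : HasC2Boundary Ω) {g1 g2 u v : Euc N → ℝ} {M : ℝ}
    (hS : SSub Ω m g1 u) (hv : SCSuper Ω m g2 v) (huc : ContinuousOn u (closure Ω))
    (hvc : ContinuousOn v (closure Ω)) (hg1 : ContinuousOn g1 (closure Ω))
    (hg : ∀ x, g1 x ≤ g2 x)
    (hM : ∀ x ∈ closure Ω, u x - v x ≤ M) (hin : ∀ x ∈ Ω, u x - v x < M)
    {z : Euc N} (hz : z ∈ frontier Ω) (hzM : u z - v z = M) : False := by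
  have hcc : IsCompact (closure Ω) := hΩb.isCompact_closure
  have hzc : z ∈ closure Ω := frontier_subset_closure hz
  obtain ⟨S, hSb⟩ := hcc.exists_bound_of_continuousOn huc
  obtain ⟨Mg, hMg⟩ := hcc.exists_bound_of_continuousOn hg1
  have hS0 : 0 ≤ S := (norm_nonneg _).trans (hSb z hzc)
  have hMg0 : 0 ≤ Mg := (norm_nonneg _).trans (hMg z hzc)
  obtain ⟨r, hr, ν, θ, hθ, hθ1, hcone⟩ := interior_cone hΩo h2 hzc
  obtain ⟨ρ, ψ, r1, δ, p, l, hρc, hψc, hr1, hr1r, hδ, hρΩ, hρz, hψz, hψ1, hψ2, hψj, hψH⟩ :=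
    boundary_barrier hm hΩo h2 hz hS0 hMg0 hr
  set D := (closedBall z r1 ∩ closure Ω) ∩ {x | -δ ≤ ρ x} with hD
  have hDc : IsCompact D := (((isCompact_closedBall z r1).inter_right isClosed_closure)).inter_right
    (isClosed_le continuous_const hρc)
  have hzD : z ∈ D := ⟨⟨mem_closedBall_self hr1.le, hzc⟩, by change -δ ≤ ρ z; linarith⟩
  have hDcl : ∀ x ∈ D, x ∈ closure Ω := fun x hx => hx.1.2
  -- gap on the inner face
  obtain ⟨γ, hγ, hγb⟩ : ∃ γ > 0, ∀ x ∈ D, ρ x = -δ → u x - v x ≤ M - γ := by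
    have hD'c : IsCompact (D ∩ {x | ρ x = -δ}) := hDc.inter_right (isClosed_eq hρc continuous_const)
    rcases (D ∩ {x | ρ x = -δ}).eq_empty_or_nonempty with he | hne
    · refine ⟨1, one_pos, fun x hx hx2 => ?_⟩
      have : x ∈ D ∩ {x | ρ x = -δ} := ⟨hx, hx2⟩
      rw [he] at this
      exact this.elim
    · obtain ⟨y, hy, hmax⟩ := hD'c.exists_isMaxOn hne
        ((huc.sub hvc).mono (fun x hx => hDcl x hx.1))
      have hyΩ : y ∈ Ω := hρΩ y (hDcl y hy.1) (by have : ρ y = -δ := hy.2; linarith)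
      refine ⟨M - (u y - v y), by linarith [hin y hyΩ], fun x hx hx2 => ?_⟩
      have : u x - v x ≤ u y - v y := hmax (show x ∈ D ∩ {x | ρ x = -δ} from ⟨hx, hx2⟩)
      linarith
  set μ := min (1 / 2) (γ / (2 * S + 2)) with hμ
  have hμ0 : 0 < μ := by positivity
  have hμ1 : μ ≤ 1 / 2 := min_le_left _ _
  have hμγ : μ * (2 * S + 2) ≤ γ := by
    have : μ ≤ γ / (2 * S + 2) := min_le_right _ _
    rwa [le_div_iff₀ (by positivity)] at this
  set ε := μ / 16 with hε
  have hε0 : 0 < ε := by positivity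
  obtain ⟨d1, hd1, hu1⟩ := Metric.uniformContinuousOn_iff.1
    (hcc.uniformContinuousOn_of_continuous huc) ε hε0
  obtain ⟨d2, hd2, hu2⟩ := Metric.uniformContinuousOn_iff.1
    (hcc.uniformContinuousOn_of_continuous hg1) ε hε0
  obtain ⟨t, ht0, ht1, htd1, htd2⟩ : ∃ t : ℝ, 0 < t ∧ t ≤ 1 ∧ t * ‖ν‖ < d1 ∧ t * ‖ν‖ < d2 := by
    have h0 : Tendsto (fun t : ℝ => t * ‖ν‖) (𝓝[>] 0) (𝓝 0) := by
      have : Continuous fun t : ℝ => t * ‖ν‖ := by fun_prop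
      have h2 := (this.tendsto 0).mono_left (nhdsWithin_le_nhds (s := Ioi 0))
      simpa using h2
    have h1 : ∀ᶠ t : ℝ in 𝓝[>] 0, t < 1 := nhdsWithin_le_nhds (gt_mem_nhds one_pos)
    obtain ⟨t, a1, a2, a3, a4⟩ := ((h0.eventually (gt_mem_nhds hd1)).and
      ((h0.eventually (gt_mem_nhds hd2)).and (h1.and self_mem_nhdsWithin))).exists
    exact ⟨t, a4, a3.le, a1, a2⟩
  have hshift : ∀ x ∈ D, x + t • ν ∈ Ω := by
    intro x hx
    refine hcone x ⟨?_, hDcl x hx⟩ t ht0 ht1 (mem_ball_self (by positivity))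
    have : dist x z ≤ r1 := hx.1.1
    rw [mem_ball]; linarith
  have hdist : ∀ x : Euc N, dist (x + t • ν) x = t * ‖ν‖ := by
    intro x
    rw [dist_eq_norm, add_sub_cancel_left, norm_smul, Real.norm_of_nonneg ht0.le]
  obtain ⟨φ, hφ, hφK⟩ := hS ((fun x => x + t • ν) '' D) (hDc.image (by fun_prop))
    (by rintro _ ⟨x, hx, rfl⟩; exact hshift x hx) ε hε0
  have hφu : ∀ x ∈ D, |φ (x + t • ν) - u x| ≤ 2 * ε := by
    intro x hx
    have e1 := (hφK _ ⟨x, hx, rfl⟩).1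
    have e2 := hu1 (x + t • ν) (subset_closure (hshift x hx)) x (hDcl x hx) (by rw [hdist]; exact htd1)
    rw [Real.dist_eq] at e2
    simp only at e1
    have := abs_sub_le (φ (x + t • ν)) (u (x + t • ν)) (u x)
    linarith
  have hφH : ∀ x ∈ D, Ham m φ (x + t • ν) ≤ g1 x + 2 * ε := by
    intro x hx
    have e1 := (hφK _ ⟨x, hx, rfl⟩).2
    have e2 := hu2 (x + t • ν) (subset_closure (hshift x hx)) x (hDcl x hx) (by rw [hdist]; exact htd2)
    rw [Real.dist_eq] at e2
    simp only at e1
    have := (abs_lt.1 e2).2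
    linarith
  have hWc : ContinuousOn (fun x => v x - ((1 - μ) * φ (x + t • ν) + μ * ψ x)) D := by
    refine (hvc.mono hDcl).sub (Continuous.continuousOn ?_)
    have := hφ.continuous
    fun_prop
  obtain ⟨x, hx, hmin⟩ := hDc.exists_isMinOn ⟨z, hzD⟩ hWc
  have hxz : v x - ((1 - μ) * φ (x + t • ν) + μ * ψ x) ≤ v z - ((1 - μ) * φ (z + t • ν) + μ * ψ z) :=
    hmin hzD
  have hxc := hDcl x hx
  have b1 := abs_le.1 (hφu x hx)
  have b2 := abs_le.1 (hφu z hzD)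
  have b3 := abs_le.1 (hSb x hxc)
  have b4 := abs_le.1 (hSb z hzc)
  have w1 : (1 - μ) * φ (x + t • ν) ≤ (1 - μ) * (u x + 2 * ε) :=
    mul_le_mul_of_nonneg_left (by linarith) (by linarith)
  have w2 : (1 - μ) * (u z - 2 * ε) ≤ (1 - μ) * φ (z + t • ν) :=
    mul_le_mul_of_nonneg_left (by linarith) (by linarith)
  have w3 : μ * (-S) ≤ μ * u x := mul_le_mul_of_nonneg_left b3.1 hμ0.le
  have w4 : μ * u z ≤ μ * S := mul_le_mul_of_nonneg_left b4.2 hμ0.le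
  have w5 : 0 < μ * ε := by positivity
  rw [hψz] at hxz
  have hρx : -δ ≤ ρ x := hx.2
  have hxr : dist x z ≤ r1 := hx.1.1
  have n1 : dist x z < r1 := by
    refine lt_of_le_of_ne hxr fun he => ?_
    have w6 : μ * ψ x ≤ μ * (-2 * S - 1 / 2) := mul_le_mul_of_nonneg_left (hψ2 x hxc hρx he) hμ0.le
    have := hM x hxc
    nlinarith
  have n2 : -δ < ρ x := by
    refine lt_of_le_of_ne hρx fun he => ?_
    have w6 : μ * ψ x ≤ μ * (1 / 2) := mul_le_mul_of_nonneg_left (hψ1 x hxc hρx) hμ0.le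
    have := hγb x hx he.symm
    nlinarith
  have hloc : IsLocalMinOn (fun y => v y - ((1 - μ) * φ (y + t • ν) + μ * ψ y)) (closure Ω) x := by
    have hnb : ∀ᶠ y in 𝓝[closure Ω] x, y ∈ D := by
      have a1 : ∀ᶠ y in 𝓝[closure Ω] x, dist y z < r1 :=
        nhdsWithin_le_nhds ((isOpen_ball (x := z) (ε := r1)).mem_nhds n1)
      have a2 : ∀ᶠ y in 𝓝[closure Ω] x, -δ < ρ y :=
        nhdsWithin_le_nhds ((hρc.tendsto x).eventually (lt_mem_nhds n2))
      filter_upwards [a1, a2, self_mem_nhdsWithin] with y y1 y2 y3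
      exact ⟨⟨le_of_lt y1, y3⟩, le_of_lt y2⟩
    filter_upwards [hnb] with y hy using hmin hy
  have jφ : Jet (fun y => φ (y + t • ν)) x (gradient φ (x + t • ν)) (lapl φ (x + t • ν)) :=
    jet_shift hφ _ x
  have hfin := hv.jet hxc ((jφ.const_mul (1 - μ)).add ((hψj x).const_mul μ)) hloc
  have hconv := norm_rpow_convex (m := m) (by linarith) (gradient φ (x + t • ν)) (p x) hμ0.le (by linarith)
  have q1 : -lapl φ (x + t • ν) + ‖gradient φ (x + t • ν)‖ ^ m ≤ g1 x + 2 * ε := hφH x hx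
  have q2 := hψH x hxc hρx hxr
  have q3 := (abs_le.1 (hMg x hxc)).1
  have q4 := hg x
  have q5 : (1 - μ) * (-lapl φ (x + t • ν) + ‖gradient φ (x + t • ν)‖ ^ m) ≤ (1 - μ) * (g1 x + 2 * ε) :=
    mul_le_mul_of_nonneg_left q1 (by linarith)
  have q6 : μ * (-l x + ‖p x‖ ^ m) ≤ μ * (g1 x - 1) := mul_le_mul_of_nonneg_left (by linarith) hμ0.le
  nlinarith

/-- uniqueness -/
lemma uniqueness_core (hm : 2 < m) (hΩo : IsOpen Ω) (hΩb : Bornology.IsBounded Ω)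
    (hΩc : IsConnected Ω) (h2 : HasC2Boundary Ω) {f u v : Euc N → ℝ} {c c' : ℝ}
    (hf : ContinuousOn f (closure Ω)) (hcc' : c ≤ c')
    (hS : SSub Ω m (fun x => f x + c) u) (hv : SCSuper Ω m (fun x => f x + c') v)
    (huc : ContinuousOn u (closure Ω))
    (hvc : ContinuousOn v (closure Ω)) (hvl : LocLipIn Ω v) :
    c' = c ∧ ∃ K : ℝ, ∀ x ∈ closure Ω, v x = u x + K := by
  obtain ⟨z, hz, hmax⟩ := hΩb.isCompact_closure.exists_isMaxOn hΩc.nonempty.closure (huc.sub hvc)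
  have hM : ∀ x ∈ closure Ω, u x - v x ≤ u z - v z := fun x hx => hmax hx
  have hg : ∀ x, f x + c ≤ f x + c' := fun x => by linarith
  have hex : ∃ x0 ∈ Ω, u x0 - v x0 = u z - v z := by
    by_contra! hno
    have hin : ∀ x ∈ Ω, u x - v x < u z - v z := fun x hx =>
      lt_of_le_of_ne (hM x (subset_closure hx)) (hno x hx)
    rcases mem_closure_cases hΩo hz with h | h
    · exact hno z h rfl
    · exact boundary_step hm hΩo hΩb h2 hS hv huc hvc (hf.add continuousOn_const) hg hM hin h rfl
  obtain ⟨x0, hx0, hx0M⟩ := hex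
  have hall := smp hm hΩo hΩc hS hv huc hvc hvl (fun x _ => hg x) hM hx0 hx0M
  refine ⟨le_antisymm (const_le hm hΩo hS hv hvc hvl hx0 fun x hx => hall x (subset_closure hx)) hcc',
    -(u z - v z), fun x hx => ?_⟩
  linarith [hall x hx]

end boundary


/-- Existence and uniqueness for the ergodic state-constraint
problem, Theorem 3.1 of the paper. -/
theorem stmt13 {N : ℕ} (hN : 1 ≤ N) (Ω : Set (Euc N))
    (hΩo : IsOpen Ω) (hΩb : Bornology.IsBounded Ω) (hΩc : IsConnected Ω)
    (hΩ2 : HasC2Boundary Ω)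
    (m : ℝ) (hm : 2 < m) (f : Euc N → ℝ) (hf : ContinuousOn f (closure Ω)) :
    ∃ c : ℝ, ∃ uInf : Euc N → ℝ,
      HolderOnCl ((m - 2) / (m - 1)) (closure Ω) uInf ∧
      LocLipIn Ω uInf ∧
      IsSCSolution Ω (fun x => f x + c) 0 m uInf ∧
      ∀ ctil : ℝ, ∀ vtil : Euc N → ℝ,
        HolderOnCl ((m - 2) / (m - 1)) (closure Ω) vtil →
        LocLipIn Ω vtil →
        IsSCSolution Ω (fun x => f x + ctil) 0 m vtil →
        ctil = c ∧ ∃ K : ℝ, ∀ x ∈ closure Ω, vtil x = uInf x + K := by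

  obtain ⟨c, u, hu, hsup, hmin⟩ := exists_solution hm hΩo hΩb hΩc hΩ2 hf
  obtain ⟨C, hC, hH⟩ := fam_holder hm hΩo hΩb hΩc hΩ2 hf c
  have hHu := hH c le_rfl u hu
  have hstat : ∀ (c : ℝ) (φ : Euc N → ℝ) (r : ℝ) (x : Euc N),
      statOp (fun x => f x + c) 0 m φ r x = Ham m φ x - (f x + c) := by
    intro c φ r x
    simp only [statOp, Ham]; ring
  have hgc : ∀ c : ℝ, ContinuousOn (fun x => f x + c) (closure Ω) := fun c => hf.add continuousOn_const
  obtain ⟨Mg, hMg⟩ := hΩb.isCompact_closure.exists_bound_of_continuousOn (hgc c)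
  refine ⟨c, u, ⟨C, hC, hHu⟩, ?_, ⟨hu.1, ?_, ?_⟩, ?_⟩
  · exact loc_lip hm hΩo hu.2 hu.1 hsup (fun x hx => hMg x (subset_closure hx)) hC
      (fun x hx y hy => hHu x (subset_closure hx) y (subset_closure hy))
  · intro φ hφ x hx hmax
    rw [hstat]
    have := hu.2.visc_sub (by linarith) hΩo ((hgc c).mono subset_closure) hφ hx hmax
    beta_reduce at this
    linarith
  · intro φ hφ x hx hmn
    rw [hstat]
    have := hsup φ hφ x hx hmn
    beta_reduce at this
    linarith
  · rintro c' v hvH hvl ⟨hvc, hvsub, hvsup⟩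
    have hvS : SSub Ω m (fun x => f x + c') v := by
      refine visc_SSub hm hΩo (hvc.mono subset_closure) ((hgc c').mono subset_closure) ?_
      intro φ hφ x hx hmax
      have := hvsub φ hφ x hx hmax
      rw [hstat] at this
      beta_reduce
      linarith
    have hvSup : SCSuper Ω m (fun x => f x + c') v := by
      intro φ hφ x hx hmn
      have := hvsup φ hφ x hx hmn
      rw [hstat] at this
      beta_reduce
      linarith
    exact uniqueness_core hm hΩo hΩb hΩc hΩ2 hf (hmin c' v ⟨hvc, hvS⟩) hu.2 hvSup hu.1 hvc hvl
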